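/- Every graph that is not planar contains a subgraph homeomorphic to K₅ or to K₃,₃ (Kuratowski's theorem). -/

import Mathlib

open Set

noncomputable section

/-- The point of `ℝ^V` corresponding to a vertex `v` of a graph. -/
def vert {V : Type*} [DecidableEq V] (v : V) : V → ℝ := fun i => if i = v then 1 else 0

/-- Geometric realization of a simple graph as a subset of `ℝ^V`:
the union of the straight segments joining the standard points of adjacent vertices. -/
def graphRealization {V : Type*} [DecidableEq V] (G : SimpleGraph V) : Set (V → ℝ) :=
  ⋃ p : {p : V × V // G.Adj p.1 p.2}, segment ℝ (vert p.1.1) (vert p.1.2)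

/-- A (compact) polyhedron: a finite union of polytopes (convex hulls of finite sets). -/
def IsPolyhedron {E : Type*} [AddCommGroup E] [Module ℝ E] (s : Set E) : Prop :=
  ∃ T : Set (Set E), T.Finite ∧ (∀ P ∈ T, ∃ Q : Set E, Q.Finite ∧ P = convexHull ℝ Q) ∧
    s = ⋃₀ T

/-- `f` is piecewise linear (PL) on `s`: there is a finite family of polytopes covering `s`
on each of which `f` coincides with an affine map. -/
def IsPLOn {E F : Type*} [AddCommGroup E] [Module ℝ E] [AddCommGroup F] [Module ℝ F]
    (f : E → F) (s : Set E) : Prop :=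
  ∃ T : Set (Set E), T.Finite ∧ (∀ P ∈ T, ∃ Q : Set E, Q.Finite ∧ P = convexHull ℝ Q) ∧
    s ⊆ ⋃₀ T ∧ ∀ P ∈ T, ∃ g : E →ᵃ[ℝ] F, EqOn f g (P ∩ s)

/-- The cone over a set `A` with apex `p` (union of segments from `p` to points of `A`). -/
def coneFrom {E : Type*} [AddCommGroup E] [Module ℝ E] (p : E) (A : Set E) : Set E :=
  ⋃ x ∈ A, segment ℝ p x

namespace Planarity

section Linked

variable {V : Type*} [DecidableEq V] {G H : SimpleGraph V} {S T C : Finset V}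

/-- A finite vertex set is linked if it induces a connected (or empty) subgraph, expressed by the
absence of nontrivial cuts. -/
def Linked (G : SimpleGraph V) (S : Finset V) : Prop :=
  ∀ C ⊆ S, C.Nonempty → (∀ a ∈ C, ∀ b ∈ S, G.Adj a b → b ∈ C) → S ⊆ C

/-- `C` is a proper nonempty part of `S` which no edge of `G` inside `S` leaves. -/
structure Part (G : SimpleGraph V) (S C : Finset V) : Prop where
  subset : C ⊆ S
  nonempty : C.Nonempty
  closed : ∀ a ∈ C, ∀ b ∈ S, G.Adj a b → b ∈ C
  proper : ∃ d ∈ S, d ∉ C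

theorem not_linked_iff : ¬ Linked G S ↔ ∃ C, Part G S C := by
  constructor
  · intro h
    simp only [Linked, not_forall] at h
    obtain ⟨C, h1, h2, h3, h4⟩ := h
    exact ⟨C, h1, h2, h3, Finset.not_subset.1 h4⟩
  · rintro ⟨C, h1, h2, h3, d, hd, hd'⟩ h
    exact hd' (h C h1 h2 h3 hd)

theorem Part.compl (h : Part G S C) : Part G S (S \ C) where
  subset := Finset.sdiff_subset
  nonempty := by
    obtain ⟨d, hd, hd'⟩ := h.proper
    exact ⟨d, by simp [hd, hd']⟩
  closed a ha b hb hab := by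
    have := h.closed b
    have := hab.symm
    grind
  proper := by
    obtain ⟨d, hd⟩ := h.nonempty
    exact ⟨d, h.subset hd, by simp [hd]⟩

theorem exists_part_avoiding (h : ¬ Linked G S) {u v : V} (huv : G.Adj u v) :
    ∃ C, Part G S C ∧ u ∉ C ∧ v ∉ C := by
  obtain ⟨C, hC⟩ := not_linked_iff.1 h
  by_cases hu : u ∈ C ∨ v ∈ C
  · refine ⟨S \ C, hC.compl, ?_⟩
    have h1 := hC.closed u
    have h2 := hC.closed v
    have := huv.symm
    grind
  · exact ⟨C, hC, by tauto⟩

theorem Linked.induction (h : Linked G S) {a : V} (ha : a ∈ S) {P : V → Prop} (h0 : P a)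
    (hs : ∀ c ∈ S, ∀ d ∈ S, G.Adj c d → P c → P d) {d : V} (hd : d ∈ S) : P d := by
  classical
  have := h (S.filter P) (Finset.filter_subset _ _) ⟨a, by simp [ha, h0]⟩ (by grind) hd
  exact (Finset.mem_filter.1 this).2

theorem Linked.mono (h : Linked G S) (hGH : ∀ a ∈ S, ∀ b ∈ S, G.Adj a b → H.Adj a b) :
    Linked H S :=
  fun C hC hne hcl => h C hC hne fun a ha b hb hab => hcl a ha b hb (hGH a (hC ha) b hb hab)

theorem linked_singleton (a : V) : Linked G {a} := by
  intro C hC hne _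
  rcases Finset.subset_singleton_iff.1 hC with h | h
  · simp [h] at hne
  · simp [h]

theorem Linked.union (hS : Linked G S) (hT : Linked G T) {c : V} (hcS : c ∈ S) (hcT : c ∈ T) :
    Linked G (S ∪ T) := by
  intro C hC hne hcl
  have key : ∀ {A : Finset V}, A ⊆ S ∪ T → Linked G A → (C ∩ A).Nonempty → A ⊆ C := by
    intro A hA hl hn
    exact (hl (C ∩ A) Finset.inter_subset_right hn (by grind)).trans Finset.inter_subset_left
  have hS' : (C ∩ S).Nonempty → S ⊆ C := key Finset.subset_union_left hS
  have hT' : (C ∩ T).Nonempty → T ⊆ C := key Finset.subset_union_right hT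
  obtain ⟨d, hd⟩ := hne
  rcases Finset.mem_union.1 (hC hd) with h | h
  · have h1 := hS' ⟨d, by simp [hd, h]⟩
    exact Finset.union_subset h1 (hT' ⟨c, by simp [h1 hcS, hcT]⟩)
  · have h1 := hT' ⟨d, by simp [hd, h]⟩
    exact Finset.union_subset (hS' ⟨c, by simp [h1 hcT, hcS]⟩) h1

theorem linked_pair {a b : V} (h : G.Adj a b) : Linked G {a, b} := by
  intro C hC hne hcl
  have := h.symm
  obtain ⟨c, hc⟩ := hne
  grind

theorem Linked.union_of_adj (hS : Linked G S) (hT : Linked G T) {a b : V} (ha : a ∈ S)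
    (hb : b ∈ T) (hab : G.Adj a b) : Linked G (S ∪ T) := by
  have h := (hS.union (linked_pair hab) ha (by simp)).union hT (c := b) (by simp) hb
  convert h using 1
  grind

theorem Linked.insert_of_adj (hS : Linked G S) {a b : V} (ha : a ∈ S) (hab : G.Adj a b) :
    Linked G (insert b S) := by
  have := hS.union_of_adj (linked_singleton b) ha (Finset.mem_singleton_self b) hab
  convert this using 1
  grind

/-- Every part contains a linked part. -/
theorem Part.exists_linked (h : Part G S C) : ∃ D ⊆ C, Part G S D ∧ Linked G D := by
  induction C using Finset.strongInduction with
  | H C ih =>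
    by_cases hl : Linked G C
    · exact ⟨C, subset_rfl, h, hl⟩
    · obtain ⟨E, hE⟩ := not_linked_iff.1 hl
      have hEC : E ⊂ C := ⟨hE.subset, fun hs => by
        obtain ⟨d, hd, hd'⟩ := hE.proper
        exact hd' (hs hd)⟩
      have hE' : Part G S E :=
        ⟨hE.subset.trans h.subset, hE.nonempty, fun a ha b hb hab =>
          hE.closed a ha b (h.closed a (hE.subset ha) b hb hab) hab, by
          obtain ⟨d, hd, hd'⟩ := h.proper
          exact ⟨d, hd, fun hh => hd' (hE.subset hh)⟩⟩
      obtain ⟨D, hD, hDpart⟩ := ih E hEC hE'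
      exact ⟨D, hD.trans hE.subset, hDpart⟩

/-- A linked set with at least two elements has a removable vertex different from a given one. -/
theorem Linked.exists_removable (h : Linked G S) (hS : 2 ≤ S.card) {r : V} (hr : r ∈ S) :
    ∃ y ∈ S, y ≠ r ∧ Linked G (S.erase y) := by
  classical
  obtain ⟨C, hC, hmax⟩ := Finset.exists_max_image
    (S.powerset.filter fun C => Linked G C ∧ r ∈ C ∧ C ≠ S) Finset.card
    ⟨{r}, by
      simp only [Finset.mem_filter, Finset.mem_powerset, Finset.singleton_subset_iff]
      refine ⟨hr, linked_singleton r, by simp, ?_⟩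
      rintro rfl
      simp at hS⟩
  simp only [Finset.mem_filter, Finset.mem_powerset] at hC hmax
  obtain ⟨hCS, hCl, hrC, hne⟩ := hC
  have : ∃ a ∈ C, ∃ b ∈ S, G.Adj a b ∧ b ∉ C := by
    by_contra! hcon
    exact hne (hCS.antisymm (h C hCS ⟨r, hrC⟩ hcon))
  obtain ⟨a, ha, b, hb, hab, hbC⟩ := this
  have hins : insert b C = S := by
    by_contra hcon
    have := hmax (insert b C) ⟨Finset.insert_subset hb hCS, hCl.insert_of_adj ha hab,
      Finset.mem_insert_of_mem hrC, hcon⟩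
    rw [Finset.card_insert_of_notMem hbC] at this
    omega
  refine ⟨b, hb, fun h => hbC (h ▸ hrC), ?_⟩
  rw [← hins, Finset.erase_insert hbC]
  exact hCl

end Linked

section Minor

variable {V κ : Type*} [DecidableEq V] {G G' : SimpleGraph V} {K : SimpleGraph κ}

/-- `B` assigns to every vertex of `K` a branch set, making `K` a minor of `G`. -/
structure IsModel (K : SimpleGraph κ) (G : SimpleGraph V) (B : κ → Finset V) : Prop where
  nonempty : ∀ k, (B k).Nonempty
  linked : ∀ k, Linked G (B k)
  disjoint : ∀ k l, k ≠ l → Disjoint (B k) (B l)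
  adj : ∀ k l, K.Adj k l → ∃ a ∈ B k, ∃ b ∈ B l, G.Adj a b

/-- `K` is a minor of `G`. -/
def HasMinor (K : SimpleGraph κ) (G : SimpleGraph V) : Prop := ∃ B, IsModel K G B

theorem HasMinor.mono (h : HasMinor K G) (hG : G ≤ G') : HasMinor K G' := by
  obtain ⟨B, h1, h2, h3, h4⟩ := h
  refine ⟨B, h1, fun k => (h2 k).mono fun a _ b _ hab => hG hab, h3, fun k l hkl => ?_⟩
  obtain ⟨a, ha, b, hb, hab⟩ := h4 k l hkl
  exact ⟨a, ha, b, hb, hG hab⟩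

theorem hasMinor_of_injective (c : κ → V) (hc : Function.Injective c)
    (h : ∀ k l, K.Adj k l → G.Adj (c k) (c l)) : HasMinor K G :=
  ⟨fun k => {c k}, fun k => by simp, fun k => linked_singleton _,
    fun k l hkl => by simpa using fun h => hkl (hc h), fun k l hkl => by simpa using h k l hkl⟩

/-- `G'` arises (up to deleting edges) from `G` by contracting the linked set `D` into `s`. -/
structure IsContraction (G G' : SimpleGraph V) (s : V) (D : Finset V) : Prop where
  linked : Linked G D
  notMem : s ∉ D
  adj : ∃ d ∈ D, G.Adj s d
  edges : ∀ a b, G'.Adj a b → a ∉ D ∧ b ∉ D ∧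
    (G.Adj a b ∨ (a = s ∧ ∃ d ∈ D, G.Adj d b) ∨ (b = s ∧ ∃ d ∈ D, G.Adj a d))

/-- The preimage of a vertex set under the contraction of `D` into `s`. -/
def unfold (s : V) (D S : Finset V) : Finset V := if s ∈ S then S ∪ D else S

theorem subset_unfold {s : V} {D S : Finset V} : S ⊆ unfold s D S := by
  unfold unfold; grind

theorem IsContraction.exists_adj {s : V} {D S T : Finset V} (h : IsContraction G G' s D) {a b : V}
    (ha : a ∈ S) (hb : b ∈ T) (hab : G'.Adj a b) :
    ∃ a' ∈ unfold s D S, ∃ b' ∈ unfold s D T, G.Adj a' b' := by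
  obtain ⟨-, -, h1 | ⟨rfl, d, hd, h1⟩ | ⟨rfl, d, hd, h1⟩⟩ := h.edges a b hab
  · exact ⟨a, subset_unfold ha, b, subset_unfold hb, h1⟩
  · exact ⟨d, by simp [unfold, ha, hd], b, subset_unfold hb, h1⟩
  · exact ⟨a, subset_unfold ha, d, by simp [unfold, hb, hd], h1⟩

theorem IsContraction.linked_unfold {s : V} {D S : Finset V} (h : IsContraction G G' s D)
    (hS : Linked G' S) : Linked G (unfold s D S) := by
  obtain ⟨d, hd, hsd⟩ := h.adj
  by_cases hs : s ∈ S
  · have hu : unfold s D S = S ∪ D := by simp [unfold, hs]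
    rw [hu]
    intro C hC hne hcl
    have hsC : Linked G (insert s D) := h.linked.insert_of_adj hd hsd.symm
    have hD : (C ∩ insert s D).Nonempty → insert s D ⊆ C := fun hn =>
      (hsC _ Finset.inter_subset_right hn (by grind)).trans Finset.inter_subset_left
    have hst : (C ∩ S).Nonempty → S ⊆ C := fun hn => by
      refine (hS _ Finset.inter_subset_right hn ?_).trans Finset.inter_subset_left
      intro a ha b hb hab
      have ha' : a ∈ C := by grind
      obtain ⟨-, -, h1 | ⟨rfl, e, he, h1⟩ | ⟨rfl, e, he, h1⟩⟩ := h.edges a b hab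
      · have := hcl a ha' b (by grind) h1
        grind
      · have h2 := hD ⟨a, by simp [ha']⟩
        have := hcl e (h2 (by simp [he])) b (by grind) h1
        grind
      · have h2 := hcl a ha' e (by grind) h1
        have := hD ⟨e, by simp [h2, he]⟩
        grind
    have hCS : C ∩ S = ∅ → False := by
      intro he
      obtain ⟨c, hc⟩ := hne
      have hcS : c ∉ S := fun hh => Finset.notMem_empty c (he ▸ Finset.mem_inter.2 ⟨hc, hh⟩)
      have hcD : c ∈ insert s D := by
        have := Finset.mem_union.1 (hC hc)
        simp only [Finset.mem_insert]
        tauto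
      have := hD ⟨c, Finset.mem_inter.2 ⟨hc, hcD⟩⟩ (Finset.mem_insert_self s D)
      exact Finset.notMem_empty s (he ▸ Finset.mem_inter.2 ⟨this, hs⟩)
    have h1 := hst (Finset.nonempty_iff_ne_empty.2 hCS)
    have h2 := hD ⟨s, by simp [h1 hs]⟩
    grind
  · have hu : unfold s D S = S := by simp [unfold, hs]
    rw [hu]
    refine hS.mono fun a ha b hb hab => ?_
    have := h.edges a b hab
    grind

theorem disjoint_unfold {s : V} {D S T : Finset V} (hST : Disjoint S T) (hS : Disjoint S D)
    (hT : Disjoint T D) : Disjoint (unfold s D S) (unfold s D T) := by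
  unfold unfold
  rw [Finset.disjoint_left] at *
  grind

theorem HasMinor.of_contraction {s : V} {D : Finset V} (h : HasMinor K G')
    (hc : IsContraction G G' s D) (hK : ∀ k, ∃ l, K.Adj k l) : HasMinor K G := by
  obtain ⟨B, h1, h2, h3, h4⟩ := h
  have hB : ∀ k, Disjoint (B k) D := by
    intro k
    rw [Finset.disjoint_left]
    intro d hd hdD
    obtain ⟨l, hkl⟩ := hK k
    obtain ⟨a, ha, b, hb, hab⟩ := h4 k l hkl
    have := h2 k {d} (by simpa using hd) (by simp)
      (fun a ha b _ hab => by have := hc.edges a b hab; grind) ha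
    have := hc.edges a b hab
    grind
  refine ⟨fun k => unfold s D (B k), fun k => (h1 k).mono subset_unfold,
    fun k => hc.linked_unfold (h2 k), fun k l hkl => disjoint_unfold (h3 k l hkl) (hB k) (hB l),
    fun k l hkl => ?_⟩
  obtain ⟨a, ha, b, hb, hab⟩ := h4 k l hkl
  exact hc.exists_adj ha hb hab

/-- The graph obtained by contracting `y` into `x`; afterwards `y` is isolated. -/
def contract (G : SimpleGraph V) (x y : V) : SimpleGraph V where
  Adj a b := a ≠ b ∧ a ≠ y ∧ b ≠ y ∧ (G.Adj a b ∨ (a = x ∧ G.Adj y b) ∨ (b = x ∧ G.Adj a y))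
  symm := ⟨fun a b h => by have := G.adj_comm; grind⟩
  loopless := ⟨fun a h => h.1 rfl⟩

theorem isContraction_contract {x y : V} (h : G.Adj x y) :
    IsContraction G (contract G x y) x {y} where
  linked := linked_singleton y
  notMem := by simpa using h.ne
  adj := ⟨y, by simp, h⟩
  edges a b hab := by
    obtain ⟨h1, h2, h3, h4⟩ := hab
    simp only [Finset.mem_singleton, exists_eq_left]
    exact ⟨h2, h3, h4⟩

theorem contract_adj_of_adj {x y a b : V} (h : G.Adj a b) (ha : a ≠ y) (hb : b ≠ y) :
    (contract G x y).Adj a b := ⟨h.ne, ha, hb, Or.inl h⟩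

theorem Linked.contract_erase {S : Finset V} {x y : V} (hS : Linked G S) (hx : x ∈ S)
    (hxy : x ≠ y) :
    Linked (contract G x y) (S.erase y) := by
  by_cases hy : y ∉ S
  · rw [Finset.erase_eq_of_notMem hy]
    exact hS.mono fun a ha b hb hab => contract_adj_of_adj hab (by grind) (by grind)
  rw [not_not] at hy
  intro C hC hne hcl
  have hcl' : ∀ a b, a ∈ C → b ∈ S → b ≠ y → a ≠ b →
      (G.Adj a b ∨ (a = x ∧ G.Adj y b) ∨ (b = x ∧ G.Adj a y)) → b ∈ C := by
    intro a b ha hb hby hab h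
    exact hcl a ha b (by grind) ⟨hab, by grind, hby, h⟩
  have := hS (if x ∈ C then insert y C else C) (by grind) (by
      obtain ⟨c, hc⟩ := hne
      exact ⟨c, by split_ifs <;> simp [hc]⟩) (by
    intro a ha b hb hab
    have hne := hab.ne
    have h1 := hcl' a b
    have h2 := hcl' x b
    have h3 := hcl' a x
    split_ifs at ha ⊢ <;> grind)
  intro b hb
  have := this (Finset.mem_of_mem_erase hb)
  grind

end Minor

section Realization

variable {V W : Type*} [Fintype V] [DecidableEq V] [Fintype W] [DecidableEq W]
  {G G' : SimpleGraph V} {H : SimpleGraph W}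

theorem mem_graphRealization {x : V → ℝ} : x ∈ graphRealization G ↔
    ∃ a b, G.Adj a b ∧ 0 ≤ x a ∧ 0 ≤ x b ∧ x a + x b = 1 ∧ ∀ v, v ≠ a → v ≠ b → x v = 0 := by
  simp only [graphRealization, mem_iUnion, Subtype.exists, Prod.exists]
  constructor
  · rintro ⟨a, b, hab, s, t, hs, ht, hst, rfl⟩
    have hne := hab.ne
    refine ⟨a, b, hab, ?_, ?_, ?_, ?_⟩ <;> simp +contextual [vert, hne, hne.symm, hs, ht, hst]
  · rintro ⟨a, b, hab, h1, h2, h3, h4⟩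
    have hne := hab.ne
    refine ⟨a, b, hab, x a, x b, h1, h2, h3, ?_⟩
    funext v
    by_cases hva : v = a
    · subst hva; simp [vert, hne]
    · by_cases hvb : v = b
      · subst hvb; simp [vert, hva]
      · simp [vert, hva, hvb, h4 v hva hvb]

theorem isCompact_graphRealization (G : SimpleGraph V) : IsCompact (graphRealization G) := by
  refine isCompact_iUnion fun p => ?_
  rw [← convexHull_pair]
  exact (Set.toFinite _).isCompact_convexHull ℝ

theorem exists_isEmbedding_of_injOn {E : Type*} [TopologicalSpace E] [T2Space E] {s : Set E}
    (F : (V → ℝ) → E) (hF : Continuous F) (hm : MapsTo F (graphRealization G) s)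
    (hi : InjOn F (graphRealization G)) :
    ∃ e : ↥(graphRealization G) → ↥s, Topology.IsEmbedding e := by
  have := isCompact_iff_compactSpace.1 (isCompact_graphRealization G)
  exact ⟨hm.restrict, (Continuous.isClosedEmbedding
    ((hF.comp continuous_subtype_val).subtype_mk _) (hm.restrict_inj.2 hi)).isEmbedding⟩

/-- The realization of `G` embeds into that of `H`. -/
def Embeds (G : SimpleGraph V) (H : SimpleGraph W) : Prop :=
  ∃ e : ↥(graphRealization G) → ↥(graphRealization H), Topology.IsEmbedding e

theorem Embeds.trans {U : Type*} [Fintype U] [DecidableEq U] {K : SimpleGraph U}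
    (h : Embeds K H) (h' : Embeds H G) : Embeds K G := by
  obtain ⟨e, he⟩ := h
  obtain ⟨f, hf⟩ := h'
  exact ⟨f ∘ e, hf.comp he⟩

theorem embeds_of_injective (c : W → V) (hc : Function.Injective c)
    (h : ∀ k l, H.Adj k l → G.Adj (c k) (c l)) : Embeds H G := by
  refine exists_isEmbedding_of_injOn (fun x => Function.extend c x 0) ?_ ?_ ?_
  · refine continuous_pi fun v => ?_
    by_cases hv : ∃ w, c w = v
    · obtain ⟨w, rfl⟩ := hv
      simpa [hc.extend_apply] using continuous_apply w
    · simpa [Function.extend_apply' _ _ _ hv] using continuous_const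
  · intro x hx
    obtain ⟨a, b, hab, h1, h2, h3, h4⟩ := mem_graphRealization.1 hx
    refine mem_graphRealization.2 ⟨c a, c b, h a b hab, ?_⟩
    simp only [hc.extend_apply]
    refine ⟨h1, h2, h3, fun v hva hvb => ?_⟩
    by_cases hv : ∃ w, c w = v
    · obtain ⟨w, rfl⟩ := hv
      rw [hc.extend_apply]
      exact h4 w (fun h => hva (h ▸ rfl)) (fun h => hvb (h ▸ rfl))
    · simp [Function.extend_apply' _ _ _ hv]
  · intro x _ y _ hxy
    funext w
    simpa [hc.extend_apply] using congrFun hxy (c w)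

theorem embeds_of_suppress {y a b : V} (hab : a ≠ b) (hay : G.Adj a y) (hby : G.Adj b y)
    (h : ∀ c d, G'.Adj c d → c ≠ y ∧ d ≠ y ∧ (G.Adj c d ∨ (c = a ∧ d = b) ∨ (c = b ∧ d = a))) :
    Embeds G' G := by
  have key : ∀ x ∈ graphRealization G', x y = 0 := by
    intro x hx
    obtain ⟨c, d, hcd, h1, h2, h3, h4⟩ := mem_graphRealization.1 hx
    obtain ⟨hc, hd, -⟩ := h c d hcd
    exact h4 y hc.symm hd.symm
  have hya := hay.ne
  have hyb := hby.ne
  refine exists_isEmbedding_of_injOn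
    (fun x v => if v = a then x a - min (x a) (x b) else if v = b then x b - min (x a) (x b) else
      if v = y then x y + 2 * min (x a) (x b) else x v) ?_ ?_ ?_
  · refine continuous_pi fun v => ?_
    split_ifs <;> fun_prop
  · intro x hx
    have hxy := key x hx
    obtain ⟨c, d, hcd, h1, h2, h3, h4⟩ := mem_graphRealization.1 hx
    obtain ⟨hc, hd, hG⟩ := h c d hcd
    rw [mem_graphRealization]
    by_cases hcase : (c = a ∧ d = b) ∨ (c = b ∧ d = a)
    · have h0 : 0 ≤ x a ∧ 0 ≤ x b ∧ x a + x b = 1 ∧ ∀ v, v ≠ a → v ≠ b → x v = 0 := by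
        rcases hcase with ⟨rfl, rfl⟩ | ⟨rfl, rfl⟩
        · exact ⟨h1, h2, h3, h4⟩
        · exact ⟨h2, h1, by linarith, fun v ha hb => h4 v hb ha⟩
      obtain ⟨ha, hb, hs, hz⟩ := h0
      rcases le_total (x a) (x b) with hle | hle
      · refine ⟨b, y, hby, ?_⟩
        simp only [min_eq_left hle, hab.symm, hya.symm, hyb.symm, if_true, if_false]
        refine ⟨by linarith, by linarith, by linarith, fun v hvb hvy => ?_⟩
        simp only [hvb, hvy, if_false]
        split_ifs with hva
        · simp
        · exact hz v hva hvb
      · refine ⟨a, y, hay, ?_⟩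
        simp only [min_eq_right hle, hya.symm, hyb.symm, if_true, if_false]
        refine ⟨by linarith, by linarith, by linarith, fun v hva hvy => ?_⟩
        simp only [hva, hvy, if_false]
        split_ifs with hvb
        · simp
        · exact hz v hva hvb
    · have hm : min (x a) (x b) = 0 := by
        have hnn : ∀ v, 0 ≤ x v := by
          intro v
          by_cases hvc : v = c
          · exact hvc ▸ h1
          · by_cases hvd : v = d
            · exact hvd ▸ h2
            · exact (h4 v hvc hvd).ge
        by_cases ha : a = c ∨ a = d
        · have : x b = 0 := h4 b (by grind) (by grind)
          rw [this]
          exact min_eq_right (hnn a)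
        · have : x a = 0 := h4 a (by tauto) (by tauto)
          rw [this]
          exact min_eq_left (hnn b)
      have hx' : (fun v => if v = a then x a - min (x a) (x b) else
          if v = b then x b - min (x a) (x b) else
          if v = y then x y + 2 * min (x a) (x b) else x v) = x := by
        funext v
        simp only [hm]
        split_ifs <;> simp_all
      have hxG : x ∈ graphRealization G :=
        mem_graphRealization.2 ⟨c, d, by tauto, h1, h2, h3, h4⟩
      rw [← mem_graphRealization]
      exact Eq.mpr (congrArg (· ∈ graphRealization G) hx') hxG
  · intro x hx x' hx' hxx
    have e1 := key x hx
    have e2 := key x' hx'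
    have ha := congrFun hxx a
    have hb := congrFun hxx b
    have hy := congrFun hxx y
    simp only [hab.symm, hya.symm, hyb.symm, if_true, if_false] at ha hb hy
    funext v
    have hv := congrFun hxx v
    simp only at hv
    split_ifs at hv with h1 h2 h3
    · subst h1; linarith
    · subst h2; linarith
    · subst h3; linarith
    · exact hv

end Realization

section Conversion

variable {V κ : Type*} [Fintype V] [DecidableEq V] [Fintype κ] [DecidableEq κ]
  {G : SimpleGraph V} {K : SimpleGraph κ} {B : κ → Finset V}

theorem IsModel.erase (h : IsModel K G B) {k : κ} {y : V} (hy : y ∈ B k) (hc : 2 ≤ (B k).card)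
    (hl : Linked G ((B k).erase y))
    (hK : ∀ l l', K.Adj k l → K.Adj k l' → (∀ c ∈ B k, ∀ d ∈ B l, G.Adj c d → c = y) →
      (∀ c ∈ B k, ∀ d ∈ B l', G.Adj c d → c = y) → l = l') :
    ∃ G' : SimpleGraph V, Embeds G' G ∧ IsModel K G' (Function.update B k ((B k).erase y)) := by
  have hne : ((B k).erase y).Nonempty := by
    rw [← Finset.card_pos, Finset.card_erase_of_mem hy]
    omega
  have hyB : ∀ l, l ≠ k → y ∉ B l := fun l hl hyl =>
    Finset.disjoint_left.1 (h.disjoint l k hl) hyl hy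
  have hdisj : ∀ l m, l ≠ m → Disjoint (Function.update B k ((B k).erase y) l)
      (Function.update B k ((B k).erase y) m) := by
    have hsub : ∀ l, Function.update B k ((B k).erase y) l ⊆ B l := by
      intro l
      by_cases hlk : l = k
      · subst hlk; simp [Finset.erase_subset]
      · simp [hlk]
    exact fun l m hlm => (h.disjoint l m hlm).mono (hsub l) (hsub m)
  -- a graph in which `B` with `y` removed is a model
  have main : ∀ G' : SimpleGraph V, (∀ c d, c ≠ y → d ≠ y → G.Adj c d → G'.Adj c d) →
      (∀ l, K.Adj k l → ∃ c ∈ (B k).erase y, ∃ d ∈ B l, G'.Adj c d) →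
      IsModel K G' (Function.update B k ((B k).erase y)) := by
    intro G' hG' hk
    refine ⟨fun l => ?_, fun l => ?_, hdisj, fun l m hlm => ?_⟩
    · by_cases hlk : l = k
      · subst hlk; simpa using hne
      · simpa [hlk] using h.nonempty l
    · by_cases hlk : l = k
      · subst hlk
        simpa using hl.mono fun a ha b hb => hG' a b (by grind) (by grind)
      · have := hyB l hlk
        simpa [hlk] using (h.linked l).mono fun a ha b hb => hG' a b (by grind) (by grind)
    · by_cases hlk : l = k
      · subst hlk
        simpa [hlm.ne.symm] using hk m hlm
      · by_cases hmk : m = k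
        · subst hmk
          obtain ⟨c, hc, d, hd, hcd⟩ := hk l hlm.symm
          simp only [Function.update_self, Function.update_of_ne hlk]
          exact ⟨d, hd, c, hc, hcd.symm⟩
        · simp only [Function.update_of_ne hlk, Function.update_of_ne hmk]
          obtain ⟨c, hc, d, hd, hcd⟩ := h.adj l m hlm
          have h1 := hyB l hlk
          have h2 := hyB m hmk
          exact ⟨c, hc, d, hd, hG' c d (by grind) (by grind) hcd⟩
  by_cases hex : ∃ l, K.Adj k l ∧ ∀ c ∈ B k, ∀ d ∈ B l, G.Adj c d → c = y
  · obtain ⟨l, hkl, hly⟩ := hex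
    obtain ⟨c, hcB, s, hs, hcs⟩ := h.adj k l hkl
    obtain rfl : c = y := hly c hcB s hs hcs
    obtain ⟨x, hx, hxy⟩ : ∃ x ∈ (B k).erase c, G.Adj x c := by
      by_contra! hcon
      have := h.linked k ((B k).erase c) (Finset.erase_subset _ _) hne (fun a ha b hb hab => by
        have := hcon a ha
        grind) hcB
      simp at this
    have hsc : s ≠ c := hcs.ne.symm
    have hsk : s ∉ B k := fun hh => Finset.disjoint_left.1 (h.disjoint k l hkl.ne) hh hs
    have hxs : x ≠ s := by grind
    refine ⟨{ Adj := fun a b => a ≠ c ∧ b ≠ c ∧ (G.Adj a b ∨ (a = x ∧ b = s) ∨ (a = s ∧ b = x))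
              symm := ⟨fun a b hab => by have := G.adj_comm; grind⟩
              loopless := ⟨fun a ha => by have := G.irrefl (v := a); grind⟩ }, ?_, ?_⟩
    · exact embeds_of_suppress hxs hxy hcs.symm fun _ _ hab => hab
    · refine main _ (fun a b ha hb hab => ⟨ha, hb, Or.inl hab⟩) fun m hkm => ?_
      by_cases hlm : m = l
      · subst hlm
        exact ⟨x, hx, s, hs, by grind, hsc, by simp⟩
      · have := mt (hK m l hkm hkl · hly) hlm
        push Not at this
        obtain ⟨a, ha, b, hb, hab, hac⟩ := this
        exact ⟨a, by grind, b, hb, hac, by rintro rfl; exact hyB m hkm.ne.symm hb, Or.inl hab⟩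
  · push Not at hex
    refine ⟨G, ⟨id, Topology.IsEmbedding.id⟩, main G (fun _ _ _ _ h => h) fun l hl => ?_⟩
    obtain ⟨c, hc, d, hd, hcd, hcy⟩ := hex l hl
    exact ⟨c, by grind, d, hd, hcd⟩

theorem injective_vec4 {α : Type*} {a b c d : α} (hab : a ≠ b) (hac : a ≠ c) (had : a ≠ d)
    (hbc : b ≠ c) (hbd : b ≠ d) (hcd : c ≠ d) : Function.Injective ![a, b, c, d] := by
  intro i j hij
  fin_cases i <;> fin_cases j <;> simp_all

theorem IsModel.embeds_or_split (h : IsModel K G B) : Embeds K G ∨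
    ∃ (G' : SimpleGraph V) (B' : κ → Finset V) (k : κ) (y : V) (l : Fin 4 → κ),
      Embeds G' G ∧ IsModel K G' B' ∧ y ∈ B' k ∧ Linked G' ((B' k).erase y) ∧
      Function.Injective l ∧ (∀ i, K.Adj k (l i)) ∧
      (∀ i < 2, ∃ d ∈ B' (l i), G'.Adj y d) ∧
      (∀ i ≥ 2, ∃ c ∈ (B' k).erase y, ∃ d ∈ B' (l i), G'.Adj c d) := by
  induction hn : ∑ k, (B k).card using Nat.strong_induction_on generalizing G B with
  | _ n ih =>
  subst hn
  by_cases hB : ∀ k, (B k).card = 1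
  · left
    choose c hc using fun k => Finset.card_eq_one.1 (hB k)
    refine embeds_of_injective c (fun k l hkl => ?_) fun k l hkl => ?_
    · by_contra hne
      have := h.disjoint k l hne
      simp [hc, hkl] at this
    · simpa [hc] using h.adj k l hkl
  · push Not at hB
    obtain ⟨k, hk⟩ := hB
    have hk2 : 2 ≤ (B k).card := by
      have := Finset.card_pos.2 (h.nonempty k)
      omega
    obtain ⟨r, hr⟩ := h.nonempty k
    obtain ⟨y, hy, -, hly⟩ := (h.linked k).exists_removable hk2 hr
    obtain ⟨z, hz, hzy, hlz⟩ := (h.linked k).exists_removable hk2 hy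
    have reduce : ∀ w ∈ B k, Linked G ((B k).erase w) →
        (∀ l l', K.Adj k l → K.Adj k l' → (∀ c ∈ B k, ∀ d ∈ B l, G.Adj c d → c = w) →
          (∀ c ∈ B k, ∀ d ∈ B l', G.Adj c d → c = w) → l = l') → Embeds K G ∨
        ∃ (G' : SimpleGraph V) (B' : κ → Finset V) (k : κ) (y : V) (l : Fin 4 → κ),
          Embeds G' G ∧ IsModel K G' B' ∧ y ∈ B' k ∧ Linked G' ((B' k).erase y) ∧
          Function.Injective l ∧ (∀ i, K.Adj k (l i)) ∧
          (∀ i < 2, ∃ d ∈ B' (l i), G'.Adj y d) ∧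
          (∀ i ≥ 2, ∃ c ∈ (B' k).erase y, ∃ d ∈ B' (l i), G'.Adj c d) := by
      intro w hw hlw hK
      obtain ⟨G', hG', hm⟩ := h.erase hw hk2 hlw hK
      have := ih _ (Finset.sum_lt_sum (fun l _ => ?_) ⟨k, Finset.mem_univ k, ?_⟩) hm rfl
      · rcases this with h1 | ⟨G'', B', k', y', l, h1, h2⟩
        · exact Or.inl (h1.trans hG')
        · exact Or.inr ⟨G'', B', k', y', l, h1.trans hG', h2⟩
      · by_cases hlk : l = k
        · subst hlk; simpa using Finset.card_le_card (Finset.erase_subset _ _)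
        · simp [hlk]
      · rw [Function.update_self]
        exact Finset.card_erase_lt_of_mem hw
    by_cases hKy : ∀ l l', K.Adj k l → K.Adj k l' → (∀ c ∈ B k, ∀ d ∈ B l, G.Adj c d → c = y) →
        (∀ c ∈ B k, ∀ d ∈ B l', G.Adj c d → c = y) → l = l'
    · exact reduce y hy hly hKy
    by_cases hKz : ∀ l l', K.Adj k l → K.Adj k l' → (∀ c ∈ B k, ∀ d ∈ B l, G.Adj c d → c = z) →
        (∀ c ∈ B k, ∀ d ∈ B l', G.Adj c d → c = z) → l = l'
    · exact reduce z hz hlz hKz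
    right
    push Not at hKy hKz
    obtain ⟨l₀, l₁, h0, h1, hl0, hl1, hl01⟩ := hKy
    obtain ⟨l₂, l₃, h2, h3, hl2, hl3, hl23⟩ := hKz
    have hyz : ∀ l l', K.Adj k l → (∀ c ∈ B k, ∀ d ∈ B l, G.Adj c d → c = y) →
        (∀ c ∈ B k, ∀ d ∈ B l', G.Adj c d → c = z) → l ≠ l' := by
      rintro l _ hl hly hlz rfl
      obtain ⟨c, hc, d, hd, hcd⟩ := h.adj k l hl
      exact hzy ((hlz c hc d hd hcd).symm.trans (hly c hc d hd hcd))
    have e02 := hyz _ _ h0 hl0 hl2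
    have e03 := hyz _ _ h0 hl0 hl3
    have e12 := hyz _ _ h1 hl1 hl2
    have e13 := hyz _ _ h1 hl1 hl3
    have hy' : ∀ l, K.Adj k l → (∀ c ∈ B k, ∀ d ∈ B l, G.Adj c d → c = y) →
        ∃ d ∈ B l, G.Adj y d := by
      intro l hl hly
      obtain ⟨c, hc, d, hd, hcd⟩ := h.adj k l hl
      exact ⟨d, hd, hly c hc d hd hcd ▸ hcd⟩
    have hz' : ∀ l, K.Adj k l → (∀ c ∈ B k, ∀ d ∈ B l, G.Adj c d → c = z) →
        ∃ c ∈ (B k).erase y, ∃ d ∈ B l, G.Adj c d := by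
      intro l hl hlz
      obtain ⟨c, hc, d, hd, hcd⟩ := h.adj k l hl
      exact ⟨c, by have := hlz c hc d hd hcd; grind, d, hd, hcd⟩
    refine ⟨G, B, k, y, ![l₀, l₁, l₂, l₃], ⟨id, Topology.IsEmbedding.id⟩, h, hy, hly,
      injective_vec4 hl01 e02 e03 e12 e13 hl23, ?_, ?_, ?_⟩
    · intro i
      fin_cases i <;> assumption
    · intro i hi
      fin_cases i
      · exact hy' _ h0 hl0
      · exact hy' _ h1 hl1
      · simp at hi
      · simp at hi
    · intro i hi
      fin_cases i
      · simp at hi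
      · simp at hi
      · exact hz' _ h2 hl2
      · exact hz' _ h3 hl3

theorem embeds_of_hasMinor_bipartite
    (h : HasMinor (completeBipartiteGraph (Fin 3) (Fin 3)) G) :
    Embeds (completeBipartiteGraph (Fin 3) (Fin 3)) G := by
  obtain ⟨B, hB⟩ := h
  rcases hB.embeds_or_split with h | ⟨_, _, k, _, l, _, _, _, _, hinj, hl, _⟩
  · exact h
  · exfalso
    rcases k with k | k
    · have : ∀ i, ∃ j, l i = Sum.inr j := by
        intro i
        have := hl i
        rcases h : l i with j | j <;> simp_all
      choose f hf using this
      have := Fintype.card_le_of_injective f fun i j hij => hinj (by rw [hf, hf, hij])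
      simp at this
    · have : ∀ i, ∃ j, l i = Sum.inl j := by
        intro i
        have := hl i
        rcases h : l i with j | j <;> simp_all
      choose f hf using this
      have := Fintype.card_le_of_injective f fun i j hij => hinj (by rw [hf, hf, hij])
      simp at this

theorem embeds_of_hasMinor_top (h : HasMinor (⊤ : SimpleGraph (Fin 5)) G) :
    Embeds (⊤ : SimpleGraph (Fin 5)) G ∨ Embeds (completeBipartiteGraph (Fin 3) (Fin 3)) G := by
  obtain ⟨B, hB⟩ := h
  rcases hB.embeds_or_split with h | ⟨G', B', k, y, l, hG', hm, hy, hlin, hinj, hl, hl1, hl2⟩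
  · exact Or.inl h
  refine Or.inr ((embeds_of_hasMinor_bipartite ?_).trans hG')
  obtain ⟨c2, hc2, -⟩ := hl2 2 le_rfl
  have hyk : ∃ c ∈ (B' k).erase y, G'.Adj y c := by
    by_contra! hcon
    have := hm.linked k {y} (by simpa using hy) (by simp) (fun a ha b hb hab => by
      have := hcon b
      grind) (Finset.mem_of_mem_erase hc2)
    grind
  have hdk : ∀ i, Disjoint (B' k) (B' (l i)) := fun i => hm.disjoint _ _ (hl i).ne
  have hd : ∀ i j, i ≠ j → Disjoint (B' (l i)) (B' (l j)) :=
    fun i j hij => hm.disjoint _ _ (hinj.ne hij)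
  have hdy : ∀ i, Disjoint {y} (B' (l i)) := fun i => (hdk i).mono_left (by simpa using hy)
  have hde : ∀ i, Disjoint ((B' k).erase y) (B' (l i)) :=
    fun i => (hdk i).mono_left (Finset.erase_subset _ _)
  have hye : Disjoint {y} ((B' k).erase y) := by simp
  have ha : ∀ i j, i ≠ j → ∃ c ∈ B' (l i), ∃ d ∈ B' (l j), G'.Adj c d :=
    fun i j hij => hm.adj _ _ (hinj.ne hij)
  have hadj : ∀ i j : Fin 3, ∃ c ∈ (![{y}, B' (l 2), B' (l 3)] : Fin 3 → Finset V) i,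
      ∃ d ∈ (![(B' k).erase y, B' (l 0), B' (l 1)] : Fin 3 → Finset V) j, G'.Adj c d := by
    have sw : ∀ {S T : Finset V}, (∃ c ∈ S, ∃ d ∈ T, G'.Adj c d) → ∃ c ∈ T, ∃ d ∈ S, G'.Adj c d :=
      fun ⟨c, hc, d, hd, h⟩ => ⟨d, hd, c, hc, h.symm⟩
    have h0 := hl1 0 (by decide)
    have h1 := hl1 1 (by decide)
    intro i j
    fin_cases i <;> fin_cases j
    · simpa using hyk
    · simpa using h0
    · simpa using h1
    · exact sw (hl2 2 le_rfl)
    · exact ha 2 0 (by decide)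
    · exact ha 2 1 (by decide)
    · exact sw (hl2 3 (by decide))
    · exact ha 3 0 (by decide)
    · exact ha 3 1 (by decide)
  have hdis : ∀ i j : Fin 3, Disjoint ((![{y}, B' (l 2), B' (l 3)] : Fin 3 → Finset V) i)
      ((![(B' k).erase y, B' (l 0), B' (l 1)] : Fin 3 → Finset V) j) := by
    intro i j
    fin_cases i <;> fin_cases j
    · exact hye
    · exact hdy 0
    · exact hdy 1
    · exact (hde 2).symm
    · exact hd 2 0 (by decide)
    · exact hd 2 1 (by decide)
    · exact (hde 3).symm
    · exact hd 3 0 (by decide)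
    · exact hd 3 1 (by decide)
  refine ⟨Sum.elim ![{y}, B' (l 2), B' (l 3)] ![(B' k).erase y, B' (l 0), B' (l 1)], ?_, ?_, ?_, ?_⟩
  · have := fun i => hm.nonempty (l i)
    rintro (i | i) <;> fin_cases i <;> simp [this]
    exact ⟨c2, by simpa using hc2⟩
  · have := fun i => hm.linked (l i)
    rintro (i | i) <;> fin_cases i <;> simp [this, linked_singleton, hlin]
  · rintro (i | i) (j | j) hij
    · have hij : i ≠ j := fun h => hij (h ▸ rfl)
      fin_cases i <;> fin_cases j <;> first | exact absurd rfl hij | skip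
      · exact hdy 2
      · exact hdy 3
      · exact (hdy 2).symm
      · exact hd 2 3 (by decide)
      · exact (hdy 3).symm
      · exact hd 3 2 (by decide)
    · exact hdis i j
    · exact (hdis j i).symm
    · have hij : i ≠ j := fun h => hij (h ▸ rfl)
      fin_cases i <;> fin_cases j <;> first | exact absurd rfl hij | skip
      · exact hde 0
      · exact hde 1
      · exact (hde 0).symm
      · exact hd 0 1 (by decide)
      · exact (hde 1).symm
      · exact hd 1 0 (by decide)
  · rintro (i | i) (j | j) hij
    · simp at hij
    · exact hadj i j
    · obtain ⟨c, hc, d, hd, hcd⟩ := hadj j i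
      exact ⟨d, hd, c, hc, hcd.symm⟩
    · simp at hij

end Conversion

section Signs

/-- The determinant of two plane vectors. -/
def det (u v : ℝ × ℝ) : ℝ := u.1 * v.2 - u.2 * v.1

/-- Whether `v` lies counterclockwise of `u`. -/
def pos (u v : ℝ × ℝ) : Bool := decide (0 < det u v)

theorem det_swap (u v : ℝ × ℝ) : det v u = -det u v := by unfold det; ring

theorem det_self (u : ℝ × ℝ) : det u u = 0 := by unfold det; ring

theorem det_ne_zero_symm {u v : ℝ × ℝ} (h : det u v ≠ 0) : det v u ≠ 0 := by
  rw [det_swap]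
  exact neg_ne_zero.2 h

theorem decide_pos_mul {x y : ℝ} (hx : x ≠ 0) (hy : y ≠ 0) :
    decide (0 < x * y) = (decide (0 < x) == decide (0 < y)) := by
  rcases hx.lt_or_gt with h | h <;> rcases hy.lt_or_gt with h' | h'
  · simp [mul_pos_of_neg_of_neg h h', h.not_gt, h'.not_gt]
  · simp [(mul_neg_of_neg_of_pos h h').not_gt, h.not_gt, h']
  · simp [(mul_neg_of_pos_of_neg h h').not_gt, h, h'.not_gt]
  · simp [mul_pos h h', h, h']

theorem pos_swap {u v : ℝ × ℝ} (h : det u v ≠ 0) : pos v u = !pos u v := by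
  unfold pos
  rw [det_swap]
  rcases h.lt_or_gt with h | h
  · simp [h, h.le]
  · simp [h, h.le]

/-- The sign constraint coming from the Grassmann-Plücker relation of four plane vectors. -/
def plu (ab cd ac bd ad bc : Bool) : Bool :=
  !(((ab == cd) == (ac != bd)) && ((ac != bd) == (ad == bc)))

theorem plu_pos {a b c d : ℝ × ℝ} (hab : det a b ≠ 0) (hac : det a c ≠ 0) (had : det a d ≠ 0)
    (hbc : det b c ≠ 0) (hbd : det b d ≠ 0) (hcd : det c d ≠ 0) :
    plu (pos a b) (pos c d) (pos a c) (pos b d) (pos a d) (pos b c) = true := by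
  have key : det a b * det c d - det a c * det b d + det a d * det b c = 0 := by
    unfold det; ring
  unfold plu pos
  simp only [bne, ← decide_pos_mul hab hcd, ← decide_pos_mul hac hbd, ← decide_pos_mul had hbc]
  have h2 := mul_ne_zero hac hbd
  by_contra hcon
  simp only [Bool.not_eq_true', Bool.not_eq_false, Bool.and_eq_true, beq_iff_eq] at hcon
  obtain ⟨h3, h4⟩ := hcon
  rcases h2.lt_or_gt with h | h
  · have e : decide (0 < det a c * det b d) = false := by simpa using h.le
    rw [e] at h3 h4
    simp at h3 h4
    linarith
  · have e : decide (0 < det a c * det b d) = true := by simpa using h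
    rw [e] at h3 h4
    simp at h3 h4
    linarith

/-- Whether `a` lies in the open convex cone spanned by `b` and `c`. -/
def inCone (a b c : ℝ × ℝ) : Bool := (pos b a == pos b c) && (pos c a == pos c b)

end Signs

section Drawings

variable {V W : Type*} [DecidableEq V] {G H : SimpleGraph V} {p : V → ℝ × ℝ}

/-- The orientation of a triple of vertices. -/
def ccw (p : V → ℝ × ℝ) (a b c : V) : Bool := pos (p b - p a) (p c - p a)

/-- Whether the segments `ab` and `cd` cross. -/
def cross (p : V → ℝ × ℝ) (a b c d : V) : Bool :=
  (ccw p a b c != ccw p a b d) && (ccw p c d a != ccw p c d b)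

/-- No three vertices are placed on a line. -/
def Generic (p : V → ℝ × ℝ) : Prop :=
  ∀ a b c : V, a ≠ b → a ≠ c → b ≠ c → det (p b - p a) (p c - p a) ≠ 0

/-- A straight line drawing of `G` in general position. -/
structure Drawing (G : SimpleGraph V) (p : V → ℝ × ℝ) : Prop where
  generic : Generic p
  plane : ∀ a b c d, G.Adj a b → G.Adj c d → a ≠ c → a ≠ d → b ≠ c → b ≠ d →
    cross p a b c d = false

/-- `G` has a straight line drawing in general position. -/
def Drawable (G : SimpleGraph V) : Prop := ∃ p, Drawing G p

theorem Drawing.mono {G' : SimpleGraph V} (h : Drawing G' p) (hG : G ≤ G') : Drawing G p :=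
  ⟨h.generic, fun a b c d h1 h2 => h.plane a b c d (hG h1) (hG h2)⟩

theorem Drawable.mono {G' : SimpleGraph V} (h : Drawable G') (hG : G ≤ G') : Drawable G := by
  obtain ⟨p, hp⟩ := h
  exact ⟨p, hp.mono hG⟩

theorem Drawing.comp {H : SimpleGraph W} {e : W → V} (h : Drawing G p) (he : Function.Injective e)
    (hH : ∀ a b, H.Adj a b → G.Adj (e a) (e b)) : Drawing H (p ∘ e) :=
  ⟨fun a b c hab hac hbc => h.generic _ _ _ (he.ne hab) (he.ne hac) (he.ne hbc),
    fun a b c d h1 h2 hac had hbc hbd => h.plane _ _ _ _ (hH a b h1) (hH c d h2) (he.ne hac)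
      (he.ne had) (he.ne hbc) (he.ne hbd)⟩

theorem ccw_rot (p : V → ℝ × ℝ) (a b c : V) : ccw p b c a = ccw p a b c := by
  have : det (p c - p b) (p a - p b) = det (p b - p a) (p c - p a) := by
    simp only [det, Prod.fst_sub, Prod.snd_sub]; ring
  simp [ccw, pos, this]

theorem ccw_rot' (p : V → ℝ × ℝ) (a b c : V) : ccw p c a b = ccw p a b c := by
  rw [← ccw_rot p c a b]

theorem Generic.ccw_swap (h : Generic p) {a b c : V} (hab : a ≠ b) (hac : a ≠ c) (hbc : b ≠ c) :
    ccw p a c b = !ccw p a b c := pos_swap (h a b c hab hac hbc)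

theorem Generic.ccw_swap' (h : Generic p) {a b c : V} (hab : a ≠ b) (hac : a ≠ c) (hbc : b ≠ c) :
    ccw p b a c = !ccw p a b c := by
  rw [← ccw_rot, h.ccw_swap hab hac hbc]

/-- The sign constraint coming from additivity of signed areas for four points. -/
def quad (abc abd acd bcd : Bool) : Bool := !((abc == acd) && (abd == bcd) && (abc != abd))

theorem Generic.quad_ccw (h : Generic p) {a b c d : V} (hab : a ≠ b) (hac : a ≠ c) (had : a ≠ d)
    (hbc : b ≠ c) (hbd : b ≠ d) (hcd : c ≠ d) :
    quad (ccw p a b c) (ccw p a b d) (ccw p a c d) (ccw p b c d) = true := by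
  have key : det (p b - p a) (p c - p a) + det (p c - p a) (p d - p a) =
      det (p b - p a) (p d - p a) + det (p c - p b) (p d - p b) := by
    simp only [det, Prod.fst_sub, Prod.snd_sub]; ring
  have h1 := h a b c hab hac hbc
  have h2 := h a b d hab had hbd
  have h3 := h a c d hac had hcd
  have h4 := h b c d hbc hbd hcd
  by_contra hcon
  simp only [quad, ccw, pos, Bool.not_eq_true', Bool.not_eq_false, Bool.and_eq_true, beq_iff_eq,
    bne_iff_ne, ne_eq, decide_eq_decide] at hcon
  obtain ⟨⟨h5, h6⟩, h7⟩ := hcon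
  rcases h1.lt_or_gt with h1 | h1 <;> rcases h2.lt_or_gt with h2 | h2
  · exact h7 ⟨fun h => by linarith, fun h => by linarith⟩
  · have := h6.1 h2
    have : ¬ 0 < det (p c - p a) (p d - p a) := fun h => by have := h5.2 h; linarith
    linarith
  · have := h5.1 h1
    have : ¬ 0 < det (p c - p b) (p d - p b) := fun h => by have := h6.2 h; linarith
    linarith
  · exact h7 ⟨fun h => h2, fun h => h1⟩

theorem Generic.plu_ccw (h : Generic p) {z a b c d : V} (hza : z ≠ a) (hzb : z ≠ b) (hzc : z ≠ c)
    (hzd : z ≠ d) (hab : a ≠ b) (hac : a ≠ c) (had : a ≠ d) (hbc : b ≠ c) (hbd : b ≠ d)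
    (hcd : c ≠ d) : plu (ccw p z a b) (ccw p z c d) (ccw p z a c) (ccw p z b d) (ccw p z a d)
      (ccw p z b c) = true :=
  plu_pos (h _ _ _ hza hzb hab) (h _ _ _ hza hzc hac) (h _ _ _ hza hzd had) (h _ _ _ hzb hzc hbc)
    (h _ _ _ hzb hzd hbd) (h _ _ _ hzc hzd hcd)

/-- Whether `q` lies in the triangle `abc`. -/
def inTriangle (p : V → ℝ × ℝ) (a b c q : V) : Bool :=
  (ccw p a b q == ccw p b c q) && (ccw p b c q == ccw p c a q)

/-- Whether `a` lies in the cone with apex `z` spanned by `b` and `c`. -/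
def coneAt (p : V → ℝ × ℝ) (z a b c : V) : Bool := inCone (p a - p z) (p b - p z) (p c - p z)

theorem coneAt_eq (p : V → ℝ × ℝ) (z a b c : V) : coneAt p z a b c =
    ((ccw p z b a == ccw p z b c) && (ccw p z c a == ccw p z c b)) := rfl

/-- A segment meets the boundary of a triangle an even number of times, counting each endpoint
inside the triangle once more. -/
theorem Generic.triangle_parity (h : Generic p) {z c d q r : V} (hzc : z ≠ c) (hzd : z ≠ d)
    (hzq : z ≠ q) (hzr : z ≠ r) (hcd : c ≠ d) (hcq : c ≠ q) (hcr : c ≠ r) (hdq : d ≠ q)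
    (hdr : d ≠ r) (hqr : q ≠ r) :
    (cross p z c q r ^^ cross p z d q r ^^ cross p c d q r) =
      (inTriangle p z c d q ^^ inTriangle p z c d r) := by
  have g1 := h.plu_ccw hzc hzd hzq hzr hcd hcq hcr hdq hdr hqr
  have g2 := h.plu_ccw hzc.symm hcd hcq hcr hzd hzq hzr hdq hdr hqr
  have g3 := h.plu_ccw hzd.symm hcd.symm hdq hdr hzc hzq hzr hcq hcr hqr
  have g4 := h.plu_ccw hzq.symm hcq.symm hdq.symm hqr hzc hzd hzr hcd hcr hdr
  have g5 := h.plu_ccw hzr.symm hcr.symm hdr.symm hqr.symm hzc hzd hzq hcd hcq hdq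
  have l1 := h.quad_ccw hzc hzd hzq hcd hcq hdq
  have l2 := h.quad_ccw hzc hzd hzr hcd hcr hdr
  have l3 := h.quad_ccw hzc hzq hzr hcq hcr hqr
  have l4 := h.quad_ccw hzd hzq hzr hdq hdr hqr
  have l5 := h.quad_ccw hcd hcq hcr hdq hdr hqr
  simp only [cross, inTriangle]
  rw [ccw_rot p z q r, ccw_rot p c q r, ccw_rot p d q r, h.ccw_swap' hzd hzq hdq,
    h.ccw_swap' hzd hzr hdr]
  rw [h.ccw_swap' hzc hzd hcd, h.ccw_swap' hzc hzq hcq, h.ccw_swap' hzc hzr hcr] at g2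
  rw [ccw_rot' p z c d, h.ccw_swap' hzd hzq hdq, h.ccw_swap' hzd hzr hdr, h.ccw_swap' hcd hcq hdq,
    h.ccw_swap' hcd hcr hdr] at g3
  rw [ccw_rot' p z c q, ccw_rot' p z d q, h.ccw_swap' hzq hzr hqr, ccw_rot' p c d q,
    h.ccw_swap' hcq hcr hqr, h.ccw_swap' hdq hdr hqr] at g4
  rw [ccw_rot' p z c r, ccw_rot' p z d r, ccw_rot' p z q r, ccw_rot' p c d r, ccw_rot' p c q r,
    ccw_rot' p d q r] at g5
  generalize ccw p z c d = zcd at *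
  generalize ccw p z c q = zcq at *
  generalize ccw p z c r = zcr at *
  generalize ccw p z d q = zdq at *
  generalize ccw p z d r = zdr at *
  generalize ccw p z q r = zqr at *
  generalize ccw p c d q = cdq at *
  generalize ccw p c d r = cdr at *
  generalize ccw p c q r = cqr at *
  generalize ccw p d q r = dqr at *
  clear * - g1 g2 g3 g4 g5 l1 l2 l3 l4 l5
  revert zcd zcq zcr zdq zdr zqr cdq cdr cqr dqr
  decide

theorem Generic.cone_parity (h : Generic p) {z a b c d : V} (hza : z ≠ a) (hzb : z ≠ b)
    (hzc : z ≠ c) (hzd : z ≠ d) (hab : a ≠ b) (hac : a ≠ c) (had : a ≠ d) (hbc : b ≠ c)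
    (hbd : b ≠ d) (hcd : c ≠ d) :
    (coneAt p z a c d ^^ coneAt p z b c d) = (coneAt p z c a b ^^ coneAt p z d a b) := by
  have g1 := h.plu_ccw hza hzb hzc hzd hab hac had hbc hbd hcd
  simp only [coneAt_eq]
  rw [h.ccw_swap hza hzb hab, h.ccw_swap hza hzc hac, h.ccw_swap hza hzd had,
    h.ccw_swap hzb hzc hbc, h.ccw_swap hzb hzd hbd, h.ccw_swap hzc hzd hcd]
  generalize ccw p z a b = ab at *
  generalize ccw p z a c = ac at *
  generalize ccw p z a d = ad at *
  generalize ccw p z b c = bc at *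
  generalize ccw p z b d = bd at *
  generalize ccw p z c d = cd at *
  clear * - g1
  revert ab ac ad bc bd cd
  decide

theorem Generic.inTriangle_eq_coneAt (h : Generic p) {z b c d : V} (hzb : z ≠ b) (hzc : z ≠ c)
    (hzd : z ≠ d) (hbc : b ≠ c) (hbd : b ≠ d) (hcd : c ≠ d) (hx : cross p z b c d = false) :
    inTriangle p z c d b = coneAt p z b c d := by
  have g1 := h.quad_ccw hzc hzd hzb hcd hbc.symm hbd.symm
  simp only [coneAt_eq, inTriangle, cross] at hx ⊢
  rw [h.ccw_swap hzc hzb hbc.symm, h.ccw_swap hzd hzb hbd.symm, ccw_rot p z c d] at hx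
  rw [h.ccw_swap' hzd hzb hbd.symm, h.ccw_swap hzc hzd hcd]
  generalize ccw p z c d = zcd at *
  generalize ccw p z c b = zcb at *
  generalize ccw p z d b = zdb at *
  generalize ccw p c d b = cdb at *
  clear * - g1 hx
  revert zcd zcb zdb cdb
  decide

theorem Drawing.coneAt_eq_of_linked (h : Drawing G p) {z a a' b b' : V} {P Q : Finset V}
    (hP : Linked G P) (hQ : Linked G Q) (hPQ : Disjoint P Q) (hzP : z ∉ P) (hzQ : z ∉ Q)
    (ha : a ∈ P) (ha' : a' ∈ P) (hb : b ∈ Q) (hb' : b' ∈ Q) (hbb : b ≠ b')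
    (hza : G.Adj z a) (hza' : G.Adj z a') (hzb : G.Adj z b) (hzb' : G.Adj z b') :
    coneAt p z a b b' = coneAt p z a' b b' := by
  have hg := h.generic
  have hne : ∀ c ∈ P, ∀ q ∈ Q, c ≠ q := fun c hc q hq hcq =>
    Finset.disjoint_left.1 hPQ hc (hcq ▸ hq)
  have hzP' : ∀ c ∈ P, z ≠ c := fun c hc h => hzP (h ▸ hc)
  have hzQ' : ∀ c ∈ Q, z ≠ c := fun c hc h => hzQ (h ▸ hc)
  have key : ∃ I : V → Bool,
      (∀ q ∈ Q, ∀ r ∈ Q, G.Adj q r → (I q ^^ I r) = (cross p z a' q r ^^ cross p z a q r)) ∧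
      (I b ^^ I b') = (coneAt p z a b b' ^^ coneAt p z a' b b') := by
    refine hP.induction ha (P := fun c => ∃ I : V → Bool,
      (∀ q ∈ Q, ∀ r ∈ Q, G.Adj q r → (I q ^^ I r) = (cross p z c q r ^^ cross p z a q r)) ∧
      (I b ^^ I b') = (coneAt p z a b b' ^^ coneAt p z c b b'))
      ⟨fun _ => false, by simp, by simp⟩ ?_ ha'
    rintro c hc d hd hcd ⟨I, h1, h2⟩
    refine ⟨fun q => I q ^^ inTriangle p z c d q, fun q hq r hr hqr => ?_, ?_⟩
    · have e1 := h1 q hq r hr hqr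
      have e2 := hg.triangle_parity (hzP' c hc) (hzP' d hd) (hzQ' q hq) (hzQ' r hr) hcd.ne
        (hne c hc q hq) (hne c hc r hr) (hne d hd q hq) (hne d hd r hr) hqr.ne
      rw [h.plane c d q r hcd hqr (hne c hc q hq) (hne c hc r hr) (hne d hd q hq)
        (hne d hd r hr)] at e2
      revert e1 e2
      simp only
      generalize I q = x1
      generalize I r = x2
      generalize cross p z c q r = x3
      generalize cross p z a q r = x4
      generalize cross p z d q r = x5
      generalize inTriangle p z c d q = x6
      generalize inTriangle p z c d r = x7
      clear * -
      revert x1 x2 x3 x4 x5 x6 x7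
      decide
    · have e1 := hg.inTriangle_eq_coneAt (hzQ' b hb) (hzP' c hc) (hzP' d hd)
        (hne c hc b hb).symm (hne d hd b hb).symm hcd.ne
        (h.plane z b c d hzb hcd (hzP' c hc) (hzP' d hd) (hne c hc b hb).symm
          (hne d hd b hb).symm)
      have e2 := hg.inTriangle_eq_coneAt (hzQ' b' hb') (hzP' c hc) (hzP' d hd)
        (hne c hc b' hb').symm (hne d hd b' hb').symm hcd.ne
        (h.plane z b' c d hzb' hcd (hzP' c hc) (hzP' d hd) (hne c hc b' hb').symm
          (hne d hd b' hb').symm)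
      have e3 := hg.cone_parity (hzQ' b hb) (hzQ' b' hb') (hzP' c hc) (hzP' d hd) hbb
        (hne c hc b hb).symm (hne d hd b hb).symm (hne c hc b' hb').symm (hne d hd b' hb').symm
        hcd.ne
      simp only
      rw [e1, e2]
      revert h2 e3
      generalize I b = x1
      generalize I b' = x2
      generalize coneAt p z a b b' = x3
      generalize coneAt p z c b b' = x4
      generalize coneAt p z d b b' = x5
      generalize coneAt p z b c d = x6
      generalize coneAt p z b' c d = x7
      clear * -
      revert x1 x2 x3 x4 x5 x6 x7
      decide
  obtain ⟨I, h1, h2⟩ := key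
  have hI : I b = I b' := by
    refine hQ.induction hb (P := fun q => I b = I q) rfl ?_ hb'
    intro q hq r hr hqr hbq
    have := h1 q hq r hr hqr
    rw [h.plane z a q r hza hqr (hzQ' q hq) (hzQ' r hr) (hne a ha q hq) (hne a ha r hr),
      h.plane z a' q r hza' hqr (hzQ' q hq) (hzQ' r hr) (hne a' ha' q hq) (hne a' ha' r hr)] at this
    rw [hbq]
    simpa using this
  rw [hI] at h2
  simpa using h2.symm

end Drawings

section Cones

open Filter Topology

variable {a b c d e : ℝ × ℝ}

theorem inCone_comm (a b c : ℝ × ℝ) : inCone a b c = inCone a c b := Bool.and_comm _ _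

/-- Whether three vectors positively span the plane. -/
def isSpanning (a b c : ℝ × ℝ) : Bool := (pos a b == pos b c) && (pos b c == pos c a)

theorem isSpanning_rot (a b c : ℝ × ℝ) : isSpanning b c a = isSpanning a b c := by
  unfold isSpanning
  generalize pos a b = x
  generalize pos b c = y
  generalize pos c a = z
  revert x y z
  decide

theorem isSpanning_of_not_inCone (hab : det a b ≠ 0) (hac : det a c ≠ 0) (hbc : det b c ≠ 0)
    (h1 : inCone a b c = false) (h2 : inCone b a c = false) (h3 : inCone c a b = false) :
    isSpanning a b c = true := by
  simp only [inCone, isSpanning, pos_swap hab, pos_swap hac, pos_swap hbc] at *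
  generalize pos a b = x at *
  generalize pos a c = y at *
  generalize pos b c = z at *
  clear * - h1 h2 h3
  revert x y z
  decide

theorem pos_ne_of_inCone (hab : det a b ≠ 0) (hac : det a c ≠ 0) (hbc : det b c ≠ 0)
    (h : inCone a b c = true) : pos a b = !pos a c := by
  simp only [inCone, pos_swap hab, pos_swap hac, pos_swap hbc] at *
  generalize pos a b = x at *
  generalize pos a c = y at *
  generalize pos b c = z at *
  clear * - h
  revert x y z
  decide

theorem isSpanning_pos (hac : det a c ≠ 0) (h : isSpanning a b c = true) :
    pos a b = !pos a c := by
  simp only [isSpanning, pos_swap hac] at *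
  generalize pos a b = x at *
  generalize pos a c = y at *
  generalize pos b c = z at *
  clear * - h
  revert x y z
  decide

section Four

variable (hab : det a b ≠ 0) (hac : det a c ≠ 0) (had : det a d ≠ 0) (hbc : det b c ≠ 0)
  (hbd : det b d ≠ 0) (hcd : det c d ≠ 0)

include hab hac had hbc hbd hcd

theorem inCone_trans (h1 : inCone b a c = true) (h2 : inCone d b c = true) :
    inCone d a c = true := by
  have g := plu_pos hab hac had hbc hbd hcd
  simp only [inCone, pos_swap hab, pos_swap hac, pos_swap had, pos_swap hbc, pos_swap hbd,
    pos_swap hcd] at *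
  generalize pos a b = x1 at *
  generalize pos a c = x2 at *
  generalize pos a d = x3 at *
  generalize pos b c = x4 at *
  generalize pos b d = x5 at *
  generalize pos c d = x6 at *
  clear * - g h1 h2
  revert x1 x2 x3 x4 x5 x6
  decide

theorem inCone_of_isSpanning (h : isSpanning a b c = true) :
    inCone d a b = true ∨ inCone d b c = true ∨ inCone d c a = true := by
  have g := plu_pos hab hac had hbc hbd hcd
  simp only [isSpanning, inCone, pos_swap hab, pos_swap hac, pos_swap had, pos_swap hbc,
    pos_swap hbd, pos_swap hcd] at *
  generalize pos a b = x1 at *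
  generalize pos a c = x2 at *
  generalize pos a d = x3 at *
  generalize pos b c = x4 at *
  generalize pos b d = x5 at *
  generalize pos c d = x6 at *
  clear * - g h
  revert x1 x2 x3 x4 x5 x6
  decide

theorem not_isSpanning_of_pos (h1 : pos d a = pos d b) (h2 : pos d b = pos d c) :
    isSpanning a b c = false := by
  have g := plu_pos hab hac had hbc hbd hcd
  simp only [isSpanning, inCone, pos_swap hab, pos_swap hac, pos_swap had, pos_swap hbc,
    pos_swap hbd, pos_swap hcd] at *
  generalize pos a b = x1 at *
  generalize pos a c = x2 at *
  generalize pos a d = x3 at *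
  generalize pos b c = x4 at *
  generalize pos b d = x5 at *
  generalize pos c d = x6 at *
  clear * - g h1 h2
  revert x1 x2 x3 x4 x5 x6
  decide

theorem not_interleaved (h1 : inCone c a b = true) (h2 : inCone d a b = true)
    (h3 : inCone c a d = inCone b a d) (h4 : inCone c d b = inCone a d b) : False := by
  have g := plu_pos hab hac had hbc hbd hcd
  simp only [inCone, pos_swap hab, pos_swap hac, pos_swap had, pos_swap hbc,
    pos_swap hbd, pos_swap hcd] at *
  generalize pos a b = x1 at *
  generalize pos a c = x2 at *
  generalize pos a d = x3 at *
  generalize pos b c = x4 at *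
  generalize pos b d = x5 at *
  generalize pos c d = x6 at *
  clear * - g h1 h2 h3 h4
  revert x1 x2 x3 x4 x5 x6
  decide

theorem not_inCone_extreme (h1 : inCone c a b = true) (h2 : inCone d a b = true) :
    inCone a d c = false := by
  have g := plu_pos hab hac had hbc hbd hcd
  simp only [inCone, pos_swap hab, pos_swap hac, pos_swap had, pos_swap hbc,
    pos_swap hbd, pos_swap hcd] at *
  generalize pos a b = x1 at *
  generalize pos a c = x2 at *
  generalize pos a d = x3 at *
  generalize pos b c = x4 at *
  generalize pos b d = x5 at *
  generalize pos c d = x6 at *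
  clear * - g h1 h2
  revert x1 x2 x3 x4 x5 x6
  decide

theorem not_inCone_sub (h1 : inCone d a b = true) (h2 : inCone c a b = false) :
    inCone c d a = false := by
  have g := plu_pos hab hac had hbc hbd hcd
  simp only [inCone, pos_swap hab, pos_swap hac, pos_swap had, pos_swap hbc,
    pos_swap hbd, pos_swap hcd] at *
  generalize pos a b = x1 at *
  generalize pos a c = x2 at *
  generalize pos a d = x3 at *
  generalize pos b c = x4 at *
  generalize pos b d = x5 at *
  generalize pos c d = x6 at *
  clear * - g h1 h2
  revert x1 x2 x3 x4 x5 x6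
  decide

theorem not_inCone_sub_of_inCone (hae : det a e ≠ 0) (hbe : det b e ≠ 0) (hce : det c e ≠ 0)
    (hde : det d e ≠ 0) (h1 : inCone d a b = true) (h2 : inCone c a b = false)
    (h3 : inCone e a b = true) : inCone c d e = false := by
  have g := plu_pos hab hac had hbc hbd hcd
  have g2 := plu_pos hab hac hae hbc hbe hce
  have g3 := plu_pos hab had hae hbd hbe hde
  have g4 := plu_pos hac had hae hcd hce hde
  have g5 := plu_pos hbc hbd hbe hcd hce hde
  simp only [inCone, pos_swap hab, pos_swap hac, pos_swap had, pos_swap hbc,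
    pos_swap hbd, pos_swap hcd, pos_swap hae, pos_swap hbe, pos_swap hce, pos_swap hde] at *
  generalize pos a b = x1 at *
  generalize pos a c = x2 at *
  generalize pos a d = x3 at *
  generalize pos b c = x4 at *
  generalize pos b d = x5 at *
  generalize pos c d = x6 at *
  generalize pos a e = x7 at *
  generalize pos b e = x8 at *
  generalize pos c e = x9 at *
  generalize pos d e = x0 at *
  clear * - g g2 g3 g4 g5 h1 h2 h3
  revert x1 x2 x3 x4 x5 x6 x7 x8 x9 x0
  decide

end Four

end Cones

section Direction

open Filter Topology

/-- Pairwise non-parallel nonzero vectors. -/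
structure NonParallel (W : Finset (ℝ × ℝ)) : Prop where
  det_ne : ∀ u ∈ W, ∀ v ∈ W, u ≠ v → det u v ≠ 0
  zero_notMem : (0 : ℝ × ℝ) ∉ W

variable {W A B : Finset (ℝ × ℝ)}

theorem tendsto_det (u v w : ℝ × ℝ) :
    Tendsto (fun s : ℝ => det (u + s • v) w) (𝓝[>] 0) (𝓝 (det u w)) := by
  have : Continuous fun s : ℝ => det (u + s • v) w := by
    unfold det
    fun_prop
  simpa using (this.tendsto 0).mono_left nhdsWithin_le_nhds

theorem eventually_det_ne_zero {u v w : ℝ × ℝ} (hv : det u v ≠ 0) (hw : w ≠ 0) :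
    ∀ᶠ s : ℝ in 𝓝[>] 0, det (u + s • v) w ≠ 0 := by
  by_cases h : det u w = 0
  · filter_upwards [self_mem_nhdsWithin] with s (hs : 0 < s)
    have e : det (u + s • v) w = det u w + s * det v w := by simp [det]; ring
    rw [e, h, zero_add]
    refine mul_ne_zero hs.ne' fun h' => hw ?_
    have e1 : det u v * w.1 = 0 := by
      have : det u v * w.1 = v.1 * det u w - u.1 * det v w := by unfold det; ring
      simp [this, h, h']
    have e2 : det u v * w.2 = 0 := by
      have : det u v * w.2 = v.2 * det u w - u.2 * det v w := by unfold det; ring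
      simp [this, h, h']
    exact Prod.ext ((mul_eq_zero.1 e1).resolve_left hv) ((mul_eq_zero.1 e2).resolve_left hv)
  · exact (tendsto_det u v w).eventually_ne h

theorem eventually_pos_eq {ι : Type*} {l : Filter ι} {F : ι → ℝ} {x : ℝ} (h : Tendsto F l (𝓝 x))
    (hx : x ≠ 0) : ∀ᶠ i in l, decide (0 < F i) = decide (0 < x) := by
  rcases hx.lt_or_gt with h0 | h0
  · filter_upwards [h.eventually_lt_const h0] with i hi
    simp [hi.not_gt, h0.not_gt]
  · filter_upwards [h.eventually_const_lt h0] with i hi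
    simp [hi, h0]

theorem NonParallel.eventually_generic (hW : NonParallel W) {u v : ℝ × ℝ} (hv : det u v ≠ 0) :
    ∀ᶠ s : ℝ in 𝓝[>] 0, ∀ w ∈ W, det (u + s • v) w ≠ 0 :=
  (eventually_all_finset W).2 fun w hw =>
    eventually_det_ne_zero hv fun h => hW.zero_notMem (h ▸ hw)

theorem NonParallel.exists_direction_of_card_le_one (hW : NonParallel W) (hB : B ⊆ W)
    (hc : B.card ≤ 1) : ∃ d, (∀ w ∈ W, det d w ≠ 0) ∧
      ∀ a ∈ W, ∀ b ∈ B, a ≠ b → inCone a d b = false := by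
  rcases Finset.card_le_one_iff_subset_singleton.1 hc with ⟨b, hb⟩
  by_cases hbB : b ∈ B
  · have hbW := hB hbB
    have hb0 : b ≠ 0 := fun h => hW.zero_notMem (h ▸ hbW)
    have hdet : det b (-b.2, b.1) ≠ 0 := by
      intro h
      apply hb0
      simp only [det] at h
      have h1 : b.1 = 0 := by nlinarith [sq_nonneg b.1, sq_nonneg b.2]
      have h2 : b.2 = 0 := by nlinarith [sq_nonneg b.1, sq_nonneg b.2]
      exact Prod.ext h1 h2
    have h2 : ∀ᶠ s : ℝ in 𝓝[>] 0, ∀ w ∈ W, w ≠ b →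
        pos (b + s • (-b.2, b.1)) w = pos b w := by
      refine (eventually_all_finset W).2 fun w hw => ?_
      by_cases hwb : w = b
      · simp [hwb]
      · filter_upwards [eventually_pos_eq (tendsto_det b (-b.2, b.1) w)
          (hW.det_ne b hbW w hw (Ne.symm hwb))] with s hs _
        exact hs
    obtain ⟨s, hs1, hs2⟩ := ((hW.eventually_generic hdet).and h2).exists
    refine ⟨_, hs1, fun a ha b' hb' hab => ?_⟩
    obtain rfl : b' = b := by simpa using hb hb'
    have e1 := hs2 a ha hab
    have e2 := hs1 b' hbW
    have e3 := hs1 a ha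
    have e4 := hW.det_ne a ha b' hbW hab
    simp only [inCone]
    generalize b' + s • (-b'.2, b'.1) = d at *
    rw [pos_swap e4] at *
    rw [pos_swap e2]
    rw [e1]
    generalize pos a b' = x at *
    generalize pos d b' = y at *
    clear * -
    revert x y
    decide
  · have hBe : ∀ b', b' ∉ B := fun b' hb' => by
      have : b' = b := by simpa using hb hb'
      exact hbB (this ▸ hb')
    obtain ⟨s, hs⟩ := (hW.eventually_generic (u := (1, 0)) (v := (0, 1)) (by simp [det])).exists
    exact ⟨_, hs, fun a _ b hb => absurd hb (hBe b)⟩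

theorem NonParallel.exists_direction_of_pointed (hW : NonParallel W) (hA : A ⊆ W) (hB : B ⊆ W)
    {b₁ b₂ : ℝ × ℝ} (hb₁ : b₁ ∈ B) (hb₂ : b₂ ∈ B) (hne : b₁ ≠ b₂)
    (hcone : ∀ b ∈ B, b = b₁ ∨ b = b₂ ∨ inCone b b₁ b₂ = true)
    (hout : ∀ a ∈ A, a ≠ b₁ → a ≠ b₂ → inCone a b₁ b₂ = false) :
    ∃ d, (∀ w ∈ W, det d w ≠ 0) ∧ ∀ a ∈ A, ∀ b ∈ B, a ≠ b → inCone a d b = false := by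
  have h12 := hW.det_ne b₁ (hB hb₁) b₂ (hB hb₂) hne
  obtain ⟨s, hs1, (hs : 0 < s)⟩ := ((hW.eventually_generic h12).and self_mem_nhdsWithin).exists
  have hdc : inCone (b₁ + s • b₂) b₁ b₂ = true := by
    have e1 : det b₁ (b₁ + s • b₂) = s * det b₁ b₂ := by simp [det]; ring
    have e2 : det b₂ (b₁ + s • b₂) = det b₂ b₁ := by simp [det]; ring
    simp [inCone, pos, e1, e2, hs]
  generalize b₁ + s • b₂ = d at *
  have hd : ∀ w ∈ W, det w d ≠ 0 := fun w hw => det_ne_zero_symm (hs1 w hw)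
  refine ⟨d, hs1, fun a ha b hb hab => ?_⟩
  have hd1 := hd b₁ (hB hb₁)
  have hd2 := hd b₂ (hB hb₂)
  have hda := hd a (hA ha)
  have hdb := hs1 b (hB hb)
  have h21 := det_ne_zero_symm h12
  have hdc' : inCone d b₂ b₁ = true := by rwa [inCone_comm]
  have key : ∀ {x y}, x ∈ B → y ∈ B → x ≠ y → det x d ≠ 0 → det y d ≠ 0 → det x y ≠ 0 →
      inCone d x y = true → (b = x ∨ b = y ∨ inCone b x y = true) → x ≠ b →
      inCone x d b = false := by
    intro x y hx hy hxy hxd hyd hdxy hdc hb3 hxb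
    by_cases hyb : y = b
    · subst hyb
      have := pos_ne_of_inCone (det_ne_zero_symm hxd) (det_ne_zero_symm hyd) hdxy hdc
      simp only [inCone, this]
      generalize pos d y = m
      generalize pos y x = n
      cases m <;> cases n <;> rfl
    rcases hb3 with rfl | rfl | hb3
    · exact absurd rfl hxb
    · exact absurd rfl hyb
    · exact not_inCone_extreme hdxy (hW.det_ne x (hB hx) b (hB hb) hxb) hxd
        (hW.det_ne y (hB hy) b (hB hb) hyb) hyd (det_ne_zero_symm hdb) hb3 hdc
  by_cases ha1 : a = b₁
  · rw [ha1] at hab ⊢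
    exact key hb₁ hb₂ hne hd1 hd2 h12 hdc (hcone b hb) hab
  by_cases ha2 : a = b₂
  · rw [ha2] at hab ⊢
    refine key hb₂ hb₁ hne.symm hd2 hd1 h21 hdc' ?_ hab
    rw [inCone_comm]
    have := hcone b hb
    tauto
  have hao := hout a ha ha1 ha2
  have ea1 := hW.det_ne b₁ (hB hb₁) a (hA ha) (Ne.symm ha1)
  have ea2 := hW.det_ne b₂ (hB hb₂) a (hA ha) (Ne.symm ha2)
  rcases hcone b hb with rfl | rfl | hbc
  · exact not_inCone_sub h12 ea1 hd1 ea2 hd2 hda hdc hao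
  · rw [inCone_comm] at hao
    exact not_inCone_sub h21 ea2 hd2 ea1 hd1 hda hdc' hao
  · by_cases hb1 : b = b₁
    · subst hb1
      exact not_inCone_sub h12 ea1 hd1 ea2 hd2 hda hdc hao
    by_cases hb2 : b = b₂
    · subst hb2
      rw [inCone_comm] at hao
      exact not_inCone_sub h21 ea2 hd2 ea1 hd1 hda hdc' hao
    exact not_inCone_sub_of_inCone h12 ea1 hd1 ea2 hd2 hda
      (hW.det_ne b₁ (hB hb₁) b (hB hb) (Ne.symm hb1))
      (hW.det_ne b₂ (hB hb₂) b (hB hb) (Ne.symm hb2)) (hW.det_ne a (hA ha) b (hB hb) hab)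
      hdb hdc hao hbc

/-- `B` spans a pointed cone with extreme rays `b₁` and `b₂`. -/
structure IsPointed (B : Finset (ℝ × ℝ)) (b₁ b₂ : ℝ × ℝ) : Prop where
  left : b₁ ∈ B
  right : b₂ ∈ B
  ne : b₁ ≠ b₂
  cone : ∀ b ∈ B, b = b₁ ∨ b = b₂ ∨ b ≠ b₁ ∧ b ≠ b₂ ∧ inCone b b₁ b₂ = true

theorem NonParallel.pointed_or_spanning (hB : NonParallel B) : B.card ≤ 1 ∨
    (∃ b₁ b₂, IsPointed B b₁ b₂) ∨
    ∃ a ∈ B, ∃ b ∈ B, ∃ c ∈ B, a ≠ b ∧ a ≠ c ∧ b ≠ c ∧ isSpanning a b c = true := by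
  classical
  induction B using Finset.induction_on with
  | empty => simp
  | insert v B hv ih =>
    have hB' : NonParallel B := ⟨fun u hu v hv => hB.det_ne u (by simp [hu]) v (by simp [hv]),
      fun h => hB.zero_notMem (by simp [h])⟩
    have hdet : ∀ u ∈ B, ∀ w ∈ B, u ≠ w → det u w ≠ 0 := hB'.det_ne
    have hdetv : ∀ u ∈ B, det v u ≠ 0 := fun u hu =>
      hB.det_ne v (by simp) u (by simp [hu]) (fun h => hv (h ▸ hu))
    rcases ih hB' with h | ⟨b₁, b₂, h⟩ | ⟨a, ha, b, hb, c, hc, h⟩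
    · obtain ⟨b, hb⟩ := Finset.card_le_one_iff_subset_singleton.1 h
      rcases Finset.subset_singleton_iff.1 hb with rfl | rfl
      · simp
      · exact Or.inr (Or.inl ⟨v, b, by simp, by simp, by simpa using hv, by simp⟩)
    · right
      have hv1 : v ≠ b₁ := fun h' => hv (h' ▸ h.left)
      have hv2 : v ≠ b₂ := fun h' => hv (h' ▸ h.right)
      have d1 := hdetv _ h.left
      have d2 := hdetv _ h.right
      have d12 := hdet _ h.left _ h.right h.ne
      by_cases c0 : inCone v b₁ b₂ = true
      · refine Or.inl ⟨b₁, b₂, by simp [h.left], by simp [h.right], h.ne, fun b hb => ?_⟩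
        rcases Finset.mem_insert.1 hb with rfl | hb
        · exact Or.inr (Or.inr ⟨hv1, hv2, c0⟩)
        · exact h.cone b hb
      by_cases c1 : inCone b₁ v b₂ = true
      · refine Or.inl ⟨v, b₂, by simp, by simp [h.right], hv2, fun b hb => ?_⟩
        rcases Finset.mem_insert.1 hb with rfl | hb
        · simp
        have hbv : b ≠ v := fun h' => hv (h' ▸ hb)
        rcases h.cone b hb with rfl | rfl | ⟨hb1, hb2, hb3⟩
        · exact Or.inr (Or.inr ⟨hbv, h.ne, c1⟩)
        · simp
        · exact Or.inr (Or.inr ⟨hbv, hb2, inCone_trans d1 d2 (hdetv b hb) d12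
            (hdet _ h.left _ hb hb1.symm) (hdet _ h.right _ hb hb2.symm) c1 hb3⟩)
      by_cases c2 : inCone b₂ v b₁ = true
      · refine Or.inl ⟨b₁, v, by simp [h.left], by simp, hv1.symm, fun b hb => ?_⟩
        rcases Finset.mem_insert.1 hb with rfl | hb
        · simp
        have hbv : b ≠ v := fun h' => hv (h' ▸ hb)
        rcases h.cone b hb with rfl | rfl | ⟨hb1, hb2, hb3⟩
        · simp
        · exact Or.inr (Or.inr ⟨h.ne.symm, hbv, by rwa [inCone_comm]⟩)
        · rw [inCone_comm] at hb3
          rw [inCone_comm]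
          exact Or.inr (Or.inr ⟨hb1, hbv, inCone_trans d2 d1 (hdetv b hb) (det_ne_zero_symm d12)
            (hdet _ h.right _ hb hb2.symm) (hdet _ h.left _ hb hb1.symm) c2 hb3⟩)
      · simp only [Bool.not_eq_true] at c0 c1 c2
        exact Or.inr ⟨v, by simp, b₁, by simp [h.left], b₂, by simp [h.right], hv1, hv2, h.ne,
          isSpanning_of_not_inCone d1 d2 d12 c0 c1 c2⟩
    · exact Or.inr (Or.inr ⟨a, by simp [ha], b, by simp [hb], c, by simp [hc], h⟩)

theorem IsPointed.not_isSpanning (hW : NonParallel W) {b₁ b₂ : ℝ × ℝ} (hb₁ : b₁ ∈ W) (hb₂ : b₂ ∈ W)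
    (h12 : b₁ ≠ b₂) (hA : A ⊆ W)
    (h : ∀ a ∈ A, a = b₁ ∨ a = b₂ ∨ a ≠ b₁ ∧ a ≠ b₂ ∧ inCone a b₁ b₂ = true)
    {a b c : ℝ × ℝ} (ha : a ∈ A) (hb : b ∈ A) (hc : c ∈ A) (hab : a ≠ b) (hac : a ≠ c)
    (hbc : b ≠ c) : isSpanning a b c = false := by
  have hp : ∀ a ∈ A, a ≠ b₁ → pos b₁ a = pos b₁ b₂ := by
    intro a ha hne
    rcases h a ha with rfl | rfl | ⟨-, -, h3⟩
    · exact absurd rfl hne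
    · rfl
    · simp only [inCone, Bool.and_eq_true, beq_iff_eq] at h3
      exact h3.1
  have hd : ∀ u ∈ A, ∀ v ∈ A, u ≠ v → det u v ≠ 0 := fun u hu v hv =>
    hW.det_ne u (hA hu) v (hA hv)
  have one : ∀ {a b c}, a ∈ A → b ∈ A → c ∈ A → a ≠ b → a ≠ c → a = b₁ →
      isSpanning a b c = false := by
    rintro a b c ha hb hc hab hac rfl
    by_contra hs
    rw [Bool.not_eq_false] at hs
    have := isSpanning_pos (hd _ ha c hc hac) hs
    rw [hp b hb hab.symm, hp c hc hac.symm] at this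
    simp at this
  by_cases h1 : a = b₁
  · exact one ha hb hc hab hac h1
  by_cases h2 : b = b₁
  · rw [← isSpanning_rot]
    exact one hb hc ha hbc hab.symm h2
  by_cases h3 : c = b₁
  · rw [← isSpanning_rot, ← isSpanning_rot]
    exact one hc ha hb hac.symm hbc.symm h3
  have hd' : ∀ u ∈ A, u ≠ b₁ → det u b₁ ≠ 0 := fun u hu => hW.det_ne u (hA hu) b₁ hb₁
  exact not_isSpanning_of_pos (hd a ha b hb hab) (hd a ha c hc hac) (hd' a ha h1)
    (hd b hb c hc hbc) (hd' b hb h2) (hd' c hc h3) ((hp a ha h1).trans (hp b hb h2).symm)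
    ((hp b hb h2).trans (hp c hc h3).symm)

theorem NonParallel.exists_direction (hW : NonParallel W) (hA : A ⊆ W) (hB : B ⊆ W)
    (hni : ∀ a ∈ A, ∀ a' ∈ A, ∀ b ∈ B, ∀ b' ∈ B, a ≠ a' → b ≠ b' → a ≠ b → a ≠ b' → a' ≠ b →
      a' ≠ b' → inCone a b b' = inCone a' b b')
    (h3 : ∀ a b c, a ∈ A → a ∈ B → b ∈ A → b ∈ B → c ∈ A → c ∈ B → a ≠ b → a ≠ c → b = c) :
    ∃ d, (∀ w ∈ W, det d w ≠ 0) ∧ ((∀ a ∈ A, ∀ b ∈ B, a ≠ b → inCone a d b = false) ∨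
      ∀ a ∈ A, ∀ b ∈ B, a ≠ b → inCone b d a = false) := by
  have hsub : ∀ {S : Finset (ℝ × ℝ)}, S ⊆ W → NonParallel S := fun hS =>
    ⟨fun u hu v hv => hW.det_ne u (hS hu) v (hS hv), fun h => hW.zero_notMem (hS h)⟩
  -- non-interleaving with the roles of the two sets exchanged
  have hni' : ∀ a ∈ A, ∀ a' ∈ A, ∀ b ∈ B, ∀ b' ∈ B, a ≠ a' → b ≠ b' → a ≠ b → a ≠ b' → a' ≠ b →
      a' ≠ b' → inCone b a a' = inCone b' a a' := by
    intro a ha a' ha' b hb b' hb' haa hbb h1 h2 h3 h4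
    have e := hni a ha a' ha' b hb b' hb' haa hbb h1 h2 h3 h4
    have d1 := hW.det_ne a (hA ha) a' (hA ha') haa
    have d2 := hW.det_ne a (hA ha) b (hB hb) h1
    have d3 := hW.det_ne a (hA ha) b' (hB hb') h2
    have d4 := hW.det_ne a' (hA ha') b (hB hb) h3
    have d5 := hW.det_ne a' (hA ha') b' (hB hb') h4
    have d6 := hW.det_ne b (hB hb) b' (hB hb') hbb
    have g := plu_pos d1 d2 d3 d4 d5 d6
    simp only [inCone, pos_swap d1, pos_swap d2, pos_swap d3, pos_swap d4, pos_swap d5,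
      pos_swap d6] at *
    generalize pos a a' = x1 at *
    generalize pos a b = x2 at *
    generalize pos a b' = x3 at *
    generalize pos a' b = x4 at *
    generalize pos a' b' = x5 at *
    generalize pos b b' = x6 at *
    clear * - g e
    revert x1 x2 x3 x4 x5 x6
    decide
  -- a pointed set either admits a direction or surrounds the other set
  have step : ∀ {A B : Finset (ℝ × ℝ)}, A ⊆ W → B ⊆ W →
      (∀ a ∈ A, ∀ a' ∈ A, ∀ b ∈ B, ∀ b' ∈ B, a ≠ a' → b ≠ b' → a ≠ b → a ≠ b' → a' ≠ b →
        a' ≠ b' → inCone a b b' = inCone a' b b') → ∀ b₁ b₂, IsPointed B b₁ b₂ →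
      (∃ d, (∀ w ∈ W, det d w ≠ 0) ∧ ∀ a ∈ A, ∀ b ∈ B, a ≠ b → inCone a d b = false) ∨
      ((∃ a ∈ A, a ≠ b₁ ∧ a ≠ b₂ ∧ inCone a b₁ b₂ = true) ∧
        ∀ a ∈ A, a = b₁ ∨ a = b₂ ∨ a ≠ b₁ ∧ a ≠ b₂ ∧ inCone a b₁ b₂ = true) := by
    intro A B hA hB hni b₁ b₂ h
    by_cases hout : ∀ a ∈ A, a ≠ b₁ → a ≠ b₂ → inCone a b₁ b₂ = false
    · exact Or.inl (hW.exists_direction_of_pointed hA hB h.left h.right h.ne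
        (fun b hb => by have := h.cone b hb; tauto) hout)
    · push Not at hout
      obtain ⟨a, ha, ha1, ha2, ha3⟩ := hout
      replace ha3 := Bool.eq_true_of_not_eq_false ha3
      refine Or.inr ⟨⟨a, ha, ha1, ha2, ha3⟩, fun a' ha' => ?_⟩
      by_cases h1 : a' = b₁
      · exact Or.inl h1
      by_cases h2 : a' = b₂
      · exact Or.inr (Or.inl h2)
      by_cases haa : a = a'
      · subst haa
        exact Or.inr (Or.inr ⟨h1, h2, ha3⟩)
      · refine Or.inr (Or.inr ⟨h1, h2, ?_⟩)
        rw [← ha3]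
        exact (hni a ha a' ha' b₁ h.left b₂ h.right haa h.ne ha1 ha2 h1 h2).symm
  have hniS : ∀ a ∈ B, ∀ a' ∈ B, ∀ b ∈ A, ∀ b' ∈ A, a ≠ a' → b ≠ b' → a ≠ b → a ≠ b' → a' ≠ b →
        a' ≠ b' → inCone a b b' = inCone a' b b' :=
    fun a ha a' ha' b hb b' hb' h1 h2 h3 h4 h5 h6 =>
      hni' b hb b' hb' a ha a' ha' h2 h1 h3.symm h5.symm h4.symm h6.symm
  have fin : (∃ d, (∀ w ∈ W, det d w ≠ 0) ∧ ∀ b ∈ B, ∀ a ∈ A, b ≠ a → inCone b d a = false) →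
      ∃ d, (∀ w ∈ W, det d w ≠ 0) ∧ ((∀ a ∈ A, ∀ b ∈ B, a ≠ b → inCone a d b = false) ∨
        ∀ a ∈ A, ∀ b ∈ B, a ≠ b → inCone b d a = false) :=
    fun ⟨d, h1, h2⟩ => ⟨d, h1, Or.inr fun a ha b hb hab => h2 b hb a ha hab.symm⟩
  rcases (hsub hA).pointed_or_spanning with hA1 | ⟨a₁, a₂, hA2⟩ | ⟨a₁, ha₁, a₂, ha₂, a₃, ha₃, hA3⟩
  · obtain ⟨d, h1, h2⟩ := hW.exists_direction_of_card_le_one hA hA1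
    exact fin ⟨d, h1, fun b hb => h2 b (hB hb)⟩
  · rcases step hB hA hniS a₁ a₂ hA2 with h | ⟨⟨b₀, hb₀, hb01, hb02, hb0c⟩, hBc⟩
    · exact fin h
    rcases (hsub hB).pointed_or_spanning with hB1 | ⟨b₁, b₂, hB2⟩ | ⟨b₁, hb₁, b₂, hb₂, b₃, hb₃, hB3⟩
    · obtain ⟨d, h1, h2⟩ := hW.exists_direction_of_card_le_one hB hB1
      exact ⟨d, h1, Or.inl fun a ha => h2 a (hA ha)⟩
    · rcases step hA hB hni b₁ b₂ hB2 with ⟨d, h1, h2⟩ | ⟨⟨a₀, ha₀, ha01, ha02, ha0c⟩, hAc⟩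
      · exact ⟨d, h1, Or.inl h2⟩
      exfalso
      -- the extreme rays agree
      have ext : ∀ {b₁ b₂}, b₁ ∈ W → b₁ ∈ B →
          (∀ a ∈ A, a = b₁ ∨ a = b₂ ∨ a ≠ b₁ ∧ a ≠ b₂ ∧ inCone a b₁ b₂ = true) →
          b₁ = a₁ ∨ b₁ = a₂ := by
        intro b₁ b₂ hbW hbB hAc
        by_contra! hcon
        have hc := hBc b₁ hbB
        have hc' : inCone b₁ a₁ a₂ = true := by tauto
        have h1 := hW.det_ne b₁ hbW a₁ (hA hA2.left) hcon.1
        have h2 := hW.det_ne b₁ hbW a₂ (hA hA2.right) hcon.2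
        have hp : ∀ a ∈ A, a ≠ b₁ → pos b₁ a = pos b₁ b₂ := by
          intro a ha hne
          rcases hAc a ha with rfl | rfl | ⟨-, -, h3⟩
          · exact absurd rfl hne
          · rfl
          · simp only [inCone, Bool.and_eq_true, beq_iff_eq] at h3
            exact h3.1
        have := pos_ne_of_inCone h1 h2 (hW.det_ne a₁ (hA hA2.left) a₂ (hA hA2.right) hA2.ne) hc'
        rw [hp a₁ hA2.left hcon.1.symm, hp a₂ hA2.right hcon.2.symm] at this
        simp at this
      have e1 := ext (hB hB2.left) hB2.left hAc
      have e2 := ext (b₂ := b₁) (hB hB2.right) hB2.right (fun a ha => by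
        have := hAc a ha
        rw [inCone_comm]
        tauto)
      have hne := hB2.ne
      have hb1A : b₁ ∈ A := by rcases e1 with rfl | rfl <;> [exact hA2.left; exact hA2.right]
      have hb2A : b₂ ∈ A := by rcases e2 with rfl | rfl <;> [exact hA2.left; exact hA2.right]
      have hb0' : b₀ ≠ b₁ ∧ b₀ ≠ b₂ ∧ inCone b₀ b₁ b₂ = true := by
        rcases e1 with rfl | rfl <;> rcases e2 with rfl | rfl
        · exact absurd rfl hne
        · exact ⟨hb01, hb02, hb0c⟩
        · exact ⟨hb02, hb01, by rwa [inCone_comm]⟩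
        · exact absurd rfl hne
      obtain ⟨hb01, hb02, hb0c⟩ := hb0'
      by_cases hab : a₀ = b₀
      · subst hab
        exact ha02 (h3 b₁ a₀ b₂ hb1A hB2.left ha₀ hb₀ hb2A hB2.right ha01.symm hne)
      · have m1 := hB hB2.left
        have m2 := hB hB2.right
        exact not_interleaved (hW.det_ne _ m1 _ m2 hne) (hW.det_ne _ m1 _ (hA ha₀) ha01.symm)
          (hW.det_ne _ m1 _ (hB hb₀) hb01.symm) (hW.det_ne _ m2 _ (hA ha₀) ha02.symm)
          (hW.det_ne _ m2 _ (hB hb₀) hb02.symm) (hW.det_ne _ (hA ha₀) _ (hB hb₀) hab) ha0c hb0c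
          (hni a₀ ha₀ b₂ hb2A b₁ hB2.left b₀ hb₀ ha02 hb01.symm ha01 hab hne.symm hb02.symm)
          (hni a₀ ha₀ b₁ hb1A b₀ hb₀ b₂ hB2.right ha01 hb02 hab ha02 hb01.symm hne)
    · have := IsPointed.not_isSpanning hW (hA hA2.left) (hA hA2.right) hA2.ne hB hBc hb₁ hb₂ hb₃
        hB3.1 hB3.2.1 hB3.2.2.1
      rw [hB3.2.2.2] at this
      simp at this
  · rcases (hsub hB).pointed_or_spanning with hB1 | ⟨b₁, b₂, hB2⟩ | ⟨b₁, hb₁, b₂, hb₂, b₃, hb₃, hB3⟩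
    · obtain ⟨d, h1, h2⟩ := hW.exists_direction_of_card_le_one hB hB1
      exact ⟨d, h1, Or.inl fun a ha => h2 a (hA ha)⟩
    · rcases step hA hB hni b₁ b₂ hB2 with ⟨d, h1, h2⟩ | ⟨-, hAc⟩
      · exact ⟨d, h1, Or.inl h2⟩
      have := IsPointed.not_isSpanning hW (hB hB2.left) (hB hB2.right) hB2.ne hA hAc ha₁ ha₂ ha₃
        hA3.1 hA3.2.1 hA3.2.2.1
      rw [hA3.2.2.2] at this
      simp at this
    · exfalso
      obtain ⟨a12, a13, a23, hAs⟩ := hA3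
      obtain ⟨b12, b13, b23, hBs⟩ := hB3
      have hmem : ∀ a ∈ A, a = b₁ ∨ a = b₂ ∨ a = b₃ := by
        intro a ha
        by_contra! hcon
        obtain ⟨c1, c2, c3⟩ := hcon
        have sur : ∀ {b₁ b₂}, b₁ ∈ B → b₂ ∈ B → b₁ ≠ b₂ → a ≠ b₁ → a ≠ b₂ →
            inCone a b₁ b₂ = true → False := by
          intro b₁ b₂ hb₁ hb₂ b12 c1 c2 hc
          have : ∀ a' ∈ A, a' = b₁ ∨ a' = b₂ ∨ a' ≠ b₁ ∧ a' ≠ b₂ ∧ inCone a' b₁ b₂ = true := by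
            intro a' ha'
            by_cases h1 : a' = b₁
            · exact Or.inl h1
            by_cases h2 : a' = b₂
            · exact Or.inr (Or.inl h2)
            by_cases haa : a = a'
            · subst haa
              exact Or.inr (Or.inr ⟨h1, h2, hc⟩)
            · refine Or.inr (Or.inr ⟨h1, h2, ?_⟩)
              rw [← hc]
              exact (hni a ha a' ha' b₁ hb₁ b₂ hb₂ haa b12 c1 c2 h1 h2).symm
          have := IsPointed.not_isSpanning hW (hB hb₁) (hB hb₂) b12 hA this ha₁ ha₂ ha₃ a12 a13 a23
          rw [hAs] at this
          simp at this
        rcases inCone_of_isSpanning (hW.det_ne _ (hB hb₁) _ (hB hb₂) b12)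
          (hW.det_ne _ (hB hb₁) _ (hB hb₃) b13) (hW.det_ne _ (hB hb₁) _ (hA ha) c1.symm)
          (hW.det_ne _ (hB hb₂) _ (hB hb₃) b23) (hW.det_ne _ (hB hb₂) _ (hA ha) c2.symm)
          (hW.det_ne _ (hB hb₃) _ (hA ha) c3.symm) hBs with h | h | h
        · exact sur hb₁ hb₂ b12 c1 c2 h
        · exact sur hb₂ hb₃ b23 c2 c3 h
        · exact sur hb₃ hb₁ b13.symm c3 c1 h
      have hmemB : ∀ a ∈ A, a ∈ B := by
        intro a ha
        rcases hmem a ha with rfl | rfl | rfl <;> assumption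
      exact a23 (h3 a₁ a₂ a₃ ha₁ (hmemB _ ha₁) ha₂ (hmemB _ ha₂) ha₃ (hmemB _ ha₃) a12 a13)

end Direction

section Split

open Filter Topology

variable {V : Type*} [Fintype V] [DecidableEq V] {G H : SimpleGraph V} {p : V → ℝ × ℝ} {x y : V}

theorem Generic.of_vertex {y : V} (h : ∀ a b c, a ≠ y → b ≠ y → c ≠ y → a ≠ b → a ≠ c → b ≠ c →
      det (p b - p a) (p c - p a) ≠ 0)
    (hy : ∀ a b, a ≠ y → b ≠ y → a ≠ b → det (p a - p y) (p b - p y) ≠ 0) : Generic p := by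
  have rot : ∀ a b c, det (p c - p b) (p a - p b) = det (p b - p a) (p c - p a) := by
    intro a b c
    simp only [det, Prod.fst_sub, Prod.snd_sub]
    ring
  intro a b c hab hac hbc
  by_cases ha : a = y
  · subst ha
    exact hy b c hab.symm hac.symm hbc
  by_cases hb : b = y
  · subst hb
    rw [← rot]
    exact hy c a hbc.symm hab hac.symm
  by_cases hc : c = y
  · subst hc
    rw [← rot, ← rot]
    exact hy a b hac hbc hab
  exact h a b c ha hb hc hab hac hbc

theorem cross_comm (p : V → ℝ × ℝ) (a b c d : V) : cross p c d a b = cross p a b c d :=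
  Bool.and_comm _ _

theorem Generic.cross_swap (h : Generic p) {a b c d : V} (hab : a ≠ b) (hac : a ≠ c) (had : a ≠ d)
    (hbc : b ≠ c) (hbd : b ≠ d) : cross p b a c d = cross p a b c d := by
  simp only [cross, h.ccw_swap' hab hac hbc, h.ccw_swap' hab had hbd]
  rw [bne_comm (a := ccw p c d b)]
  congr 1
  cases ccw p a b c <;> cases ccw p a b d <;> rfl

/-- To draw a graph it suffices to control the edges at one vertex. -/
theorem Drawing.of_vertex {y : V} (hp : Generic p)
    (h : ∀ a b c d, G.Adj a b → G.Adj c d → a ≠ c → a ≠ d → b ≠ c → b ≠ d →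
      a ≠ y → b ≠ y → c ≠ y → d ≠ y → cross p a b c d = false)
    (hy : ∀ b c d, G.Adj y b → G.Adj c d → b ≠ c → b ≠ d → c ≠ y → d ≠ y →
      cross p y b c d = false) : Drawing G p := by
  refine ⟨hp, fun a b c d hab hcd hac had hbc hbd => ?_⟩
  by_cases ha : a = y
  · subst ha
    exact hy b c d hab hcd hbc hbd hac.symm had.symm
  by_cases hb : b = y
  · subst hb
    rw [← hp.cross_swap hab.ne hac had hbc hbd]
    exact hy a c d hab.symm hcd hac had hbc.symm hbd.symm
  by_cases hc : c = y
  · subst hc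
    rw [← cross_comm]
    exact hy d a b hcd hab had.symm hbd.symm ha hb
  by_cases hd : d = y
  · subst hd
    rw [← cross_comm, ← hp.cross_swap hcd.ne hac.symm hbc.symm had.symm hbd.symm]
    exact hy c a b hcd.symm hab hac.symm hbc.symm ha hb
  exact h a b c d hab hcd hac had hbc hbd ha hb hc hd

theorem Drawing.split_of_direction (h : Drawing H p) (hxy : x ≠ y)
    (h0 : ∀ a b, G.Adj a b → a ≠ y → b ≠ y → H.Adj a b) (h1 : ∀ b, G.Adj y b → b ≠ x → H.Adj x b)
    {d : ℝ × ℝ} (hd : ∀ a, a ≠ x → a ≠ y → det d (p a - p x) ≠ 0)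
    (hc : ∀ a b, G.Adj x a → G.Adj y b → a ≠ x → a ≠ y → b ≠ x → b ≠ y → a ≠ b →
      inCone (p a - p x) d (p b - p x) = false) : Drawable G := by
  have tend : ∀ a b, Tendsto (fun s : ℝ => det (p a - (p x + s • d)) (p b - (p x + s • d)))
      (𝓝[>] 0) (𝓝 (det (p a - p x) (p b - p x))) := by
    intro a b
    have : Continuous fun s : ℝ => det (p a - (p x + s • d)) (p b - (p x + s • d)) := by
      unfold det
      fun_prop
    simpa using (this.tendsto 0).mono_left nhdsWithin_le_nhds
  have ev : ∀ᶠ s : ℝ in 𝓝[>] 0, ∀ a b, a ≠ b → a ≠ x → b ≠ x →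
      det (p a - (p x + s • d)) (p b - (p x + s • d)) ≠ 0 ∧
      pos (p a - (p x + s • d)) (p b - (p x + s • d)) = pos (p a - p x) (p b - p x) := by
    refine eventually_all.2 fun a => eventually_all.2 fun b => ?_
    by_cases hab : a ≠ b ∧ a ≠ x ∧ b ≠ x
    · have hne := h.generic x a b hab.2.1.symm hab.2.2.symm hab.1
      filter_upwards [(tend a b).eventually_ne hne, eventually_pos_eq (tend a b) hne] with s e1 e2
        _ _ _
      exact ⟨e1, e2⟩
    · exact Eventually.of_forall fun s e1 e2 e3 => absurd ⟨e1, e2, e3⟩ hab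
  obtain ⟨s, hs, (hs0 : 0 < s)⟩ := (ev.and self_mem_nhdsWithin).exists
  set p' := Function.update p y (p x + s • d) with hp'
  have py : p' y = p x + s • d := by simp [hp']
  have pne : ∀ a, a ≠ y → p' a = p a := fun a ha => by simp [hp', ha]
  have px := pne x hxy
  have dx : ∀ a, det (p' y - p' x) (p' a - p' x) = s * det d (p' a - p x) := by
    intro a
    rw [py, px]
    simp [det]
    ring
  have gen : Generic p' := by
    refine Generic.of_vertex (y := y) ?_ ?_
    · intro a b c ha hb hc
      rw [pne a ha, pne b hb, pne c hc]
      exact h.generic a b c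
    · have key : ∀ a, a ≠ y → a ≠ x → det (p' x - p' y) (p' a - p' y) ≠ 0 := by
        intro a ha hax
        have : det (p' x - p' y) (p' a - p' y) = -(s * det d (p' a - p x)) := by
          rw [← dx]
          simp only [det, Prod.fst_sub, Prod.snd_sub]
          ring
        rw [this, pne a ha]
        exact neg_ne_zero.2 (mul_ne_zero hs0.ne' (hd a hax ha))
      intro a b ha hb hab
      by_cases hax : a = x
      · subst hax
        exact key b hb hab.symm
      by_cases hbx : b = x
      · subst hbx
        exact det_ne_zero_symm (key a ha hab)
      rw [py, pne a ha, pne b hb]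
      exact (hs a b hab hax hbx).1
  have cc : ∀ a b c, a ≠ y → b ≠ y → c ≠ y → ccw p' a b c = ccw p a b c := by
    intro a b c ha hb hc
    simp only [ccw, pne a ha, pne b hb, pne c hc]
  have cy : ∀ a b, a ≠ y → b ≠ y → a ≠ x → b ≠ x → a ≠ b → ccw p' y a b = ccw p x a b := by
    intro a b ha hb hax hbx hab
    simp only [ccw, pne a ha, pne b hb, py]
    exact (hs a b hab hax hbx).2
  have cxy : ∀ a, a ≠ y → ccw p' x y a = pos d (p a - p x) := by
    intro a ha
    simp only [ccw, pos, dx]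
    simp [hs0, pne a ha]
  -- crossings of the two edge pencils
  have xcase : ∀ b c, G.Adj y b → G.Adj x c → b ≠ x → b ≠ y → b ≠ c → c ≠ y → c ≠ x →
      cross p' y b x c = false := by
    intro b c hb hc' hbx hby hbc hcy hcx
    have e := hc c b hc' hb hcx hcy hbx hby hbc.symm
    have e1 : ccw p' y b x = pos d (p b - p x) := by rw [ccw_rot, cxy b hby]
    have e2 : ccw p' y b c = ccw p x b c := cy b c hby hcy hbx hcx hbc
    have e3 : ccw p' x c y = !pos d (p c - p x) := by
      rw [gen.ccw_swap hxy hcx.symm hcy.symm, cxy c hcy]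
    have e4 : ccw p' x c b = !ccw p x b c := by
      rw [cc x c b hxy hcy hby, h.generic.ccw_swap hbx.symm hcx.symm hbc]
    have n1 : pos (p b - p x) d = !pos d (p b - p x) := pos_swap (hd b hbx hby)
    simp only [cross, e1, e2, e3, e4]
    simp only [inCone, n1] at e
    change (_ && (ccw p x b c == _)) = false at e
    revert e
    generalize ccw p x b c = r
    generalize pos d (p b - p x) = t
    generalize pos d (p c - p x) = q
    revert r t q
    decide
  refine ⟨p', Drawing.of_vertex (y := y) gen ?_ ?_⟩
  · intro a b c d hab hcd hac had hbc hbd ha hb hc hd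
    simp only [cross, cc, ha, hb, hc, hd, ne_eq, not_false_eq_true]
    exact h.plane a b c d (h0 a b hab ha hb) (h0 c d hcd hc hd) hac had hbc hbd
  · intro b c d hb hcd hbc hbd hcy hdy
    have hby : b ≠ y := hb.ne'
    by_cases hbx : b = x
    · subst hbx
      have e1 : ccw p' c d y = ccw p' c d b := by
        rw [← ccw_rot', cy c d hcy hdy hbc.symm hbd.symm hcd.ne, cc c d b hcy hdy hby,
          ccw_rot' p c d b]
      simp [cross, e1]
    by_cases hcx : c = x
    · subst hcx
      exact xcase b d hb hcd hbx hby hbd hdy hcd.ne'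
    by_cases hdx : d = x
    · subst hdx
      have := xcase b c hb hcd.symm hbx hby hbc hcy hcd.ne
      rw [cross_comm, ← gen.cross_swap hcd.ne hcy hbc.symm hdy hbd.symm, cross_comm]
      exact this
    · have e1 : ccw p' c d y = ccw p c d x := by
        rw [← ccw_rot', cy c d hcy hdy hcx hdx hcd.ne, ccw_rot' p c d x]
      simp only [cross, cy b c hby hcy hbx hcx hbc, cy b d hby hdy hbx hdx hbd, e1,
        cc c d b hcy hdy hby]
      exact h.plane x b c d (h1 b hb hbx) (h0 c d hcd hcy hdy) (Ne.symm hcx) (Ne.symm hdx) hbc hbd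

theorem Drawing.split (h : Drawing (contract G x y) p) (hne : x ≠ y)
    (hni : ∀ a a' b b', G.Adj x a → G.Adj x a' → G.Adj y b → G.Adj y b' → a ≠ y → a' ≠ y →
      b ≠ x → b' ≠ x → a ≠ a' → b ≠ b' → a ≠ b → a ≠ b' → a' ≠ b → a' ≠ b' →
      coneAt p x a b b' = coneAt p x a' b b')
    (h3 : ∀ a b c, G.Adj x a → G.Adj y a → G.Adj x b → G.Adj y b → G.Adj x c → G.Adj y c →
      a ≠ b → a ≠ c → b = c) : Drawable G := by
  classical
  set f : V → ℝ × ℝ := fun v => p v - p x with hf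
  set W := (Finset.univ.filter fun v => v ≠ x ∧ v ≠ y).image f with hW
  set A := (Finset.univ.filter fun v => v ≠ y ∧ G.Adj x v).image f with hA
  set B := (Finset.univ.filter fun v => v ≠ x ∧ G.Adj y v).image f with hB
  have mW : ∀ {w}, w ∈ W → ∃ v, v ≠ x ∧ v ≠ y ∧ f v = w := fun hw => by
    simpa [hW, and_assoc] using hw
  have mA : ∀ {w}, w ∈ A → ∃ v, v ≠ y ∧ G.Adj x v ∧ f v = w := fun hw => by
    simpa [hA, and_assoc] using hw
  have mB : ∀ {w}, w ∈ B → ∃ v, v ≠ x ∧ G.Adj y v ∧ f v = w := fun hw => by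
    simpa [hB, and_assoc] using hw
  have hdet : ∀ u v, u ≠ x → v ≠ x → u ≠ v → det (f u) (f v) ≠ 0 := fun u v hu hv huv =>
    h.generic x u v hu.symm hv.symm huv
  have hAW : A ⊆ W := by
    intro w hw
    obtain ⟨v, hv1, hv2, rfl⟩ := mA hw
    exact Finset.mem_image.2 ⟨v, by simp [hv1, hv2.ne'], rfl⟩
  have hBW : B ⊆ W := by
    intro w hw
    obtain ⟨v, hv1, hv2, rfl⟩ := mB hw
    exact Finset.mem_image.2 ⟨v, by simp [hv1, hv2.ne'], rfl⟩
  have inj : ∀ {u v}, u ≠ x → v ≠ x → f u = f v → u = v := by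
    intro u v hu hv huv
    by_contra hc
    exact hdet u v hu hv hc (by rw [huv, det_self])
  have hWp : NonParallel W := by
    refine ⟨fun u hu v hv huv => ?_, fun h0 => ?_⟩
    · obtain ⟨u, hu1, hu2, rfl⟩ := mW hu
      obtain ⟨v, hv1, hv2, rfl⟩ := mW hv
      exact hdet u v hu1 hv1 fun e => huv (e ▸ rfl)
    · obtain ⟨v, hv1, hv2, hv⟩ := mW h0
      exact hdet v y hv1 hne.symm hv2 (by rw [hv]; simp [det])
  obtain ⟨d, hd, hc⟩ := hWp.exists_direction hAW hBW (by
      intro a ha a' ha' b hb b' hb' e1 e2 e3 e4 e5 e6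
      obtain ⟨a, ha1, ha2, rfl⟩ := mA ha
      obtain ⟨a', ha1', ha2', rfl⟩ := mA ha'
      obtain ⟨b, hb1, hb2, rfl⟩ := mB hb
      obtain ⟨b', hb1', hb2', rfl⟩ := mB hb'
      have ne : ∀ {u v}, f u ≠ f v → u ≠ v := fun h e => h (e ▸ rfl)
      exact hni a a' b b' ha2 ha2' hb2 hb2' ha1 ha1' hb1 hb1' (ne e1) (ne e2) (ne e3) (ne e4)
        (ne e5) (ne e6)) (by
      intro a b c ha ha' hb hb' hc hc' e1 e2
      have com : ∀ {w}, w ∈ A → w ∈ B → ∃ v, G.Adj x v ∧ G.Adj y v ∧ f v = w := by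
        intro w hA hB
        obtain ⟨v, hv1, hv2, rfl⟩ := mA hA
        obtain ⟨u, hu1, hu2, hu3⟩ := mB hB
        obtain rfl := inj hu1 hv2.ne' hu3
        exact ⟨u, hv2, hu2, rfl⟩
      obtain ⟨a, h1, h2, rfl⟩ := com ha ha'
      obtain ⟨b, h4, h5, rfl⟩ := com hb hb'
      obtain ⟨c, h6, h7, rfl⟩ := com hc hc'
      have ne : ∀ {u v}, f u ≠ f v → u ≠ v := fun h e => h (e ▸ rfl)
      rw [h3 a b c h1 h2 h4 h5 h6 h7 (ne e1) (ne e2)])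
  have hd' : ∀ a, a ≠ x → a ≠ y → det d (f a) ≠ 0 := fun a ha hay =>
    hd _ (Finset.mem_image.2 ⟨a, by simp [ha, hay], rfl⟩)
  have memA : ∀ {a}, G.Adj x a → a ≠ y → f a ∈ A := fun ha hay =>
    Finset.mem_image.2 ⟨_, by simp [ha, hay], rfl⟩
  have memB : ∀ {a}, G.Adj y a → a ≠ x → f a ∈ B := fun ha hay =>
    Finset.mem_image.2 ⟨_, by simp [ha, hay], rfl⟩
  have adj1 : ∀ a b, G.Adj a b → a ≠ y → b ≠ y → (contract G x y).Adj a b :=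
    fun a b hab ha hb => ⟨hab.ne, ha, hb, Or.inl hab⟩
  have adj2 : ∀ b, G.Adj y b → b ≠ x → (contract G x y).Adj x b :=
    fun b hb hbx => ⟨hbx.symm, hne, hb.ne', Or.inr (Or.inl ⟨rfl, hb⟩)⟩
  rcases hc with hc | hc
  · exact h.split_of_direction hne adj1 adj2 hd' fun a b ha hb hax hay hbx hby hab =>
      hc _ (memA ha hay) _ (memB hb hbx) fun e => hab (inj hax hbx e)
  · have hs := h.comp (H := (contract G x y).comap (Equiv.swap x y)) (Equiv.swap x y).injective
      fun _ _ h => h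
    have sw : ∀ a, a ≠ x → a ≠ y → Equiv.swap x y a = a := fun a => Equiv.swap_apply_of_ne_of_ne
    refine hs.split_of_direction (d := d) hne.symm ?_ ?_ ?_ ?_
    · intro a b hab ha hb
      change (contract G x y).Adj _ _
      by_cases hay : a = y
      · subst hay
        rw [Equiv.swap_apply_right, sw b hb hab.ne']
        exact adj2 b hab hb
      by_cases hby : b = y
      · subst hby
        rw [Equiv.swap_apply_right, sw a ha hab.ne]
        exact (adj2 a hab.symm ha).symm
      rw [sw a ha hay, sw b hb hby]
      exact adj1 a b hab hay hby
    · intro b hb hby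
      change (contract G x y).Adj _ _
      rw [Equiv.swap_apply_right, sw b hb.ne' hby]
      exact adj1 x b hb hne hby
    · intro a hay hax
      simp only [Function.comp, Equiv.swap_apply_right, sw a hax hay]
      exact hd' a hax hay
    · intro b a hb ha hby hbx hay hax hab
      simp only [Function.comp, Equiv.swap_apply_right, sw a hax hay, sw b hbx hby]
      exact hc _ (memA ha hay) _ (memB hb hbx) fun e => hab (inj hbx hax e.symm)

end Split

section Realize

variable {V : Type*} [DecidableEq V] {G : SimpleGraph V} {p : V → ℝ × ℝ}

theorem decide_pos_bne_of_convex {m n x y : ℝ} (hm : 0 ≤ m) (hn : 0 ≤ n) (hmn : m + n = 1)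
    (hx : x ≠ 0) (hy : y ≠ 0) (h : m * x + n * y = 0) :
    (decide (0 < x) != decide (0 < y)) = true := by
  rcases hx.lt_or_gt with hx | hx <;> rcases hy.lt_or_gt with hy | hy
  · have h1 : m * x = 0 := by nlinarith
    have h2 : n * y = 0 := by nlinarith
    replace h1 := (mul_eq_zero.1 h1).resolve_right hx.ne
    replace h2 := (mul_eq_zero.1 h2).resolve_right hy.ne
    linarith
  · simp [hx.not_gt, hy]
  · simp [hx, hy.not_gt]
  · have h1 : m * x = 0 := by nlinarith [mul_nonneg hm hx.le, mul_nonneg hn hy.le]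
    have h2 : n * y = 0 := by nlinarith [mul_nonneg hm hx.le, mul_nonneg hn hy.le]
    replace h1 := (mul_eq_zero.1 h1).resolve_right hx.ne'
    replace h2 := (mul_eq_zero.1 h2).resolve_right hy.ne'
    linarith

theorem Generic.cross_of_mem (h : Generic p) {a b c d : V} (hab : a ≠ b) (hac : a ≠ c) (had : a ≠ d)
    (hbc : b ≠ c) (hbd : b ≠ d) (hcd : c ≠ d) {k l m n : ℝ} (hk : 0 ≤ k) (hl : 0 ≤ l)
    (hkl : k + l = 1) (hm : 0 ≤ m) (hn : 0 ≤ n) (hmn : m + n = 1)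
    (e : k • p a + l • p b = m • p c + n • p d) : cross p a b c d = true := by
  have e1 := congrArg Prod.fst e
  have e2 := congrArg Prod.snd e
  simp only [Prod.fst_add, Prod.smul_fst, Prod.snd_add, Prod.smul_snd, smul_eq_mul] at e1 e2
  rw [cross, Bool.and_eq_true]
  refine ⟨decide_pos_bne_of_convex hm hn hmn (h a b c hab hac hbc) (h a b d hab had hbd) ?_,
    decide_pos_bne_of_convex hk hl hkl (h c d a hcd hac.symm had.symm)
      (h c d b hcd hbc.symm hbd.symm) ?_⟩
  · obtain rfl : k = 1 - l := by linarith
    obtain rfl : m = 1 - n := by linarith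
    simp only [det, Prod.fst_sub, Prod.snd_sub]
    linear_combination -((p b).1 - (p a).1) * e2 + ((p b).2 - (p a).2) * e1
  · obtain rfl : k = 1 - l := by linarith
    obtain rfl : m = 1 - n := by linarith
    simp only [det, Prod.fst_sub, Prod.snd_sub]
    linear_combination ((p d).1 - (p c).1) * e2 - ((p d).2 - (p c).2) * e1

theorem Generic.eq_zero_of_smul (h : Generic p) {a b d : V} (hab : a ≠ b) (had : a ≠ d)
    (hbd : b ≠ d) {k l m n : ℝ} (hkl : k + l = 1) (hmn : m + n = 1)
    (e : k • p a + l • p b = m • p a + n • p d) : l = 0 ∧ n = 0 := by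
  have e1 := congrArg Prod.fst e
  have e2 := congrArg Prod.snd e
  simp only [Prod.fst_add, Prod.smul_fst, Prod.snd_add, Prod.smul_snd, smul_eq_mul] at e1 e2
  obtain rfl : k = 1 - l := by linarith
  obtain rfl : m = 1 - n := by linarith
  have hd := h a b d hab had hbd
  constructor
  · refine (mul_eq_zero.1 (?_ : l * det (p b - p a) (p d - p a) = 0)).resolve_right hd
    simp only [det, Prod.fst_sub, Prod.snd_sub]
    linear_combination ((p d).2 - (p a).2) * e1 - ((p d).1 - (p a).1) * e2
  · refine (mul_eq_zero.1 (?_ : n * det (p b - p a) (p d - p a) = 0)).resolve_right hd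
    simp only [det, Prod.fst_sub, Prod.snd_sub]
    linear_combination ((p b).2 - (p a).2) * e1 - ((p b).1 - (p a).1) * e2

theorem eq_of_smul_eq {u v : ℝ × ℝ} (huv : u ≠ v) {k l m n : ℝ} (hkl : k + l = 1) (hmn : m + n = 1)
    (e : k • u + l • v = m • u + n • v) : k = m ∧ l = n := by
  obtain rfl : k = 1 - l := by linarith
  obtain rfl : m = 1 - n := by linarith
  have e1 : (l - n) • (u - v) = 0 := by
    rw [← sub_eq_zero] at e
    rw [← neg_eq_zero, ← e]
    module
  have := (smul_eq_zero.1 e1).resolve_right (sub_ne_zero.2 huv)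
  constructor <;> linarith

variable [Fintype V]

/-- The piecewise linear map into the plane extending a placement of the vertices. -/
def extend (p : V → ℝ × ℝ) (x : V → ℝ) : ℝ × ℝ := ∑ v, x v • p v

theorem extend_eq {x : V → ℝ} {a b : V} (hab : a ≠ b) (hx : ∀ v, v ≠ a → v ≠ b → x v = 0) :
    extend p x = x a • p a + x b • p b := by
  rw [extend, ← Finset.sum_pair (f := fun v => x v • p v) hab]
  refine (Finset.sum_subset (Finset.subset_univ _) fun v _ hv => ?_).symm
  simp only [Finset.mem_insert, Finset.mem_singleton, not_or] at hv
  rw [hx v hv.1 hv.2, zero_smul]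

theorem Drawing.injOn_extend (h : Drawing G p) (hp : Function.Injective p) :
    InjOn (extend p) (graphRealization G) := by
  intro x hx y hy e
  obtain ⟨a, b, hab, hxa, hxb, hx1, hx0⟩ := mem_graphRealization.1 hx
  obtain ⟨c, d, hcd, hyc, hyd, hy1, hy0⟩ := mem_graphRealization.1 hy
  rw [extend_eq hab.ne hx0, extend_eq hcd.ne hy0] at e
  have same : ∀ {a b}, a ≠ b → x a + x b = 1 → y a + y b = 1 → (∀ v, v ≠ a → v ≠ b → x v = 0) →
      (∀ v, v ≠ a → v ≠ b → y v = 0) → x a • p a + x b • p b = y a • p a + y b • p b → x = y := by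
    intro a b hab hx1 hy1 hx0 hy0 e
    obtain ⟨h1, h2⟩ := eq_of_smul_eq (hp.ne hab) hx1 hy1 e
    funext v
    by_cases hva : v = a
    · rw [hva, h1]
    by_cases hvb : v = b
    · rw [hvb, h2]
    rw [hx0 v hva hvb, hy0 v hva hvb]
  have share : ∀ {a b d}, a ≠ b → a ≠ d → b ≠ d → x a + x b = 1 → y a + y d = 1 →
      (∀ v, v ≠ a → v ≠ b → x v = 0) → (∀ v, v ≠ a → v ≠ d → y v = 0) →
      x a • p a + x b • p b = y a • p a + y d • p d → x = y := by
    intro a b d hab had hbd hx1 hy1 hx0 hy0 e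
    obtain ⟨h1, h2⟩ := h.generic.eq_zero_of_smul hab had hbd hx1 hy1 e
    funext v
    by_cases hva : v = a
    · rw [hva]
      linarith
    have e1 : x v = 0 := by
      by_cases hvb : v = b
      · rw [hvb, h1]
      · exact hx0 v hva hvb
    have e2 : y v = 0 := by
      by_cases hvd : v = d
      · rw [hvd, h2]
      · exact hy0 v hva hvd
    rw [e1, e2]
  have hx1' : x b + x a = 1 := by rw [add_comm, hx1]
  have hy1' : y d + y c = 1 := by rw [add_comm, hy1]
  have hx0' : ∀ v, v ≠ b → v ≠ a → x v = 0 := fun v h1 h2 => hx0 v h2 h1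
  have hy0' : ∀ v, v ≠ d → v ≠ c → y v = 0 := fun v h1 h2 => hy0 v h2 h1
  have e' : x b • p b + x a • p a = y c • p c + y d • p d := by rw [add_comm, e]
  by_cases hac : a = c
  · subst hac
    by_cases hbd : b = d
    · subst hbd
      exact same hab.ne hx1 hy1 hx0 hy0 e
    · exact share hab.ne hcd.ne hbd hx1 hy1 hx0 hy0 e
  by_cases had : a = d
  · subst had
    rw [add_comm (y c • p c)] at e
    by_cases hbc : b = c
    · subst hbc
      exact same hab.ne hx1 hy1' hx0 hy0' e
    · exact share hab.ne hcd.ne' hbc hx1 hy1' hx0 hy0' e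
  by_cases hbc : b = c
  · subst hbc
    exact share hab.ne' hcd.ne had hx1' hy1 hx0' hy0 e'
  by_cases hbd : b = d
  · subst hbd
    rw [add_comm (y c • p c)] at e'
    exact share hab.ne' hcd.ne' hac hx1' hy1' hx0' hy0' e'
  have h1 := h.plane a b c d hab hcd hac had hbc hbd
  rw [h.generic.cross_of_mem hab.ne hac had hbc hbd hcd.ne hxa hxb hx1 hyc hyd hy1 e] at h1
  cases h1

theorem exists_generic (V : Type*) [Fintype V] :
    ∃ p : V → ℝ × ℝ, Generic p ∧ Function.Injective p := by
  let i : V → ℝ := fun v => ((Fintype.equivFin V v : ℕ) : ℝ)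
  have hi : Function.Injective i := fun a b h => by
    simpa [i, Fin.val_inj] using h
  refine ⟨fun v => (i v, i v ^ 2), fun a b c hab hac hbc => ?_, fun a b h => hi ?_⟩
  · have : det ((i b, i b ^ 2) - (i a, i a ^ 2)) ((i c, i c ^ 2) - (i a, i a ^ 2)) =
        (i b - i a) * (i c - i a) * (i c - i b) := by
      simp only [det, Prod.fst_sub, Prod.snd_sub]
      ring
    rw [this]
    exact mul_ne_zero (mul_ne_zero (sub_ne_zero.2 (hi.ne hab.symm))
      (sub_ne_zero.2 (hi.ne hac.symm)))
      (sub_ne_zero.2 (hi.ne hbc.symm))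
  · exact congrArg Prod.fst h

theorem drawable_of_no_disjoint (h : ∀ a b c d, G.Adj a b → G.Adj c d → a ≠ c → a ≠ d → b ≠ c →
    b = d) : Drawable G := by
  obtain ⟨p, hp, -⟩ := exists_generic V
  exact ⟨p, hp, fun a b c d h1 h2 h3 h4 h5 h6 => absurd (h a b c d h1 h2 h3 h4 h5) h6⟩

theorem Drawable.exists_injective (h : Drawable G) : ∃ p, Drawing G p ∧ Function.Injective p := by
  obtain ⟨p, hp⟩ := h
  by_cases hi : Function.Injective p
  · exact ⟨p, hp, hi⟩
  simp only [Function.Injective, not_forall] at hi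
  obtain ⟨a, b, hpab, hab⟩ := hi
  have two : ∀ c, c = a ∨ c = b := by
    intro c
    by_contra! hc
    exact hp.generic a b c hab hc.1.symm hc.2.symm (by simp [hpab, det])
  obtain ⟨q, hq, hqi⟩ := exists_generic V
  refine ⟨q, ⟨hq, fun c d e f h1 h2 h3 h4 h5 h6 => ?_⟩, hqi⟩
  have := h1.ne
  rcases two c with rfl | rfl <;> rcases two d with rfl | rfl <;> rcases two e with rfl | rfl <;>
    simp_all

theorem Drawable.exists_isEmbedding (h : Drawable G) :
    ∃ f : ↥(graphRealization G) → EuclideanSpace ℝ (Fin 2), Topology.IsEmbedding f := by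
  obtain ⟨p, hp, hi⟩ := h.exists_injective
  obtain ⟨e, he⟩ := exists_isEmbedding_of_injOn (G := G) (s := (Set.univ : Set (ℝ × ℝ)))
    (extend p) (by unfold extend; fun_prop) (fun _ _ => trivial) (hp.injOn_extend hi)
  let g : ℝ × ℝ ≃ₜ EuclideanSpace ℝ (Fin 2) :=
    (Homeomorph.finTwoArrow (X := ℝ)).symm.trans (EuclideanSpace.equiv (Fin 2) ℝ).symm.toHomeomorph
  exact ⟨_, g.isEmbedding.comp (Topology.IsEmbedding.subtypeVal.comp he)⟩

end Realize

section Connectivity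

variable {V κ : Type*} [DecidableEq V] {G H : SimpleGraph V} {K : SimpleGraph κ}
  {X Y T : Finset V}

/-- `Y` induces a connected subgraph without cut vertices. -/
structure TwoConn (H : SimpleGraph V) (Y : Finset V) : Prop where
  linked : Linked H Y
  erase : ∀ t, Linked H (Y.erase t)

/-- `X` induces a subgraph which stays connected when at most two vertices are deleted. -/
def ThreeConn (H : SimpleGraph V) (X : Finset V) : Prop := ∀ s t, Linked H ((X.erase s).erase t)

theorem Linked.exists_adj {S A : Finset V} (h : Linked G S) (hA : A ⊆ S) {a d : V} (ha : a ∈ A)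
    (hd : d ∈ S) (hdA : d ∉ A) : ∃ b ∈ A, ∃ c ∈ S, c ∉ A ∧ G.Adj b c := by
  by_contra! hcon
  exact hdA (h A hA ⟨a, ha⟩ (fun b hb c hc hbc => by
    by_contra hcA
    exact hcon b hb c hc hcA hbc) hd)

theorem Linked.exists_neighbor {S : Finset V} (h : Linked G S) {s d : V} (hs : s ∈ S) (hd : d ∈ S)
    (hsd : d ≠ s) : ∃ t ∈ S, G.Adj s t := by
  obtain ⟨b, hb, c, hc, -, hbc⟩ := h.exists_adj (A := {s}) (by simpa using hs) (a := s) (by simp) hd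
    (by simpa using hsd)
  rw [Finset.mem_singleton.1 hb] at hbc
  exact ⟨c, hc, hbc⟩

theorem adj_of_linked_pair {a b : V} (hab : a ≠ b) (h : Linked G {a, b}) : G.Adj a b := by
  obtain ⟨t, ht, hat⟩ := h.exists_neighbor (s := a) (d := b) (by simp) (by simp) hab.symm
  rcases Finset.mem_insert.1 ht with rfl | ht
  · exact absurd hat (G.irrefl)
  · rwa [← Finset.mem_singleton.1 ht]

/-- A vertex of a 2-connected graph has a neighbour together with which it can be deleted. -/
theorem TwoConn.exists_neighbor (h : TwoConn H Y) {s d : V} (hs : s ∈ Y) (hd : d ∈ Y)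
    (hsd : d ≠ s) : ∃ t ∈ Y, H.Adj s t ∧ Linked H ((Y.erase s).erase t) := by
  by_contra! hcon
  have key : ∀ C t, t ∈ Y → H.Adj s t → ¬ Part H ((Y.erase s).erase t) C := by
    intro C
    induction C using Finset.strongInduction with
    | H C ih =>
      intro t ht hst hC
      obtain ⟨t', ht', c, hc, hcC, htc⟩ := (h.erase t).exists_adj (A := C)
        (fun x hx => by have := hC.subset hx; grind) hC.nonempty.choose_spec
        (d := s) (by simp [hs, hst.ne]) (fun hsC => by have := hC.subset hsC; simp at this)
      obtain rfl : c = s := by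
        by_contra hcs
        exact hcC (hC.closed t' ht' c (by grind) htc)
      have ht'Y := hC.subset ht'
      obtain ⟨C', hC', htC', -⟩ := exists_part_avoiding (hcon t' (by grind) htc.symm)
        (u := t) (v := c) hst.symm
      have hsub : C' ⊆ C := by
        by_contra hn
        obtain ⟨r, hr, hrC⟩ := Finset.not_subset.1 hn
        have hC's := hC'.subset
        obtain ⟨b, hb, e, he, heA, hbe⟩ := (h.erase c).exists_adj (A := C' \ C)
          (fun x hx => by have := hC's (Finset.mem_sdiff.1 hx).1; grind) (a := r) (by grind)
          (d := t) (by simp [ht, hst.ne']) (by grind)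
        rw [Finset.mem_sdiff] at hb heA
        have hbY := hC's hb.1
        by_cases het : e = t'
        · subst het
          exact hb.2 (hC.closed e ht' b (by grind) hbe.symm)
        have he' := hC'.closed b hb.1 e (by grind) hbe
        have : e ∈ C := by
          by_contra heC
          exact heA ⟨he', heC⟩
        exact hb.2 (hC.closed e this b (by grind) hbe.symm)
      refine ih C' ⟨hsub, fun hn => ?_⟩ t' (by grind) htc.symm hC'
      have := hC'.subset (hn ht')
      simp at this
  obtain ⟨t, ht, hst⟩ := h.linked.exists_neighbor hs hd hsd
  obtain ⟨C, hC⟩ := not_linked_iff.1 (hcon t ht hst)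
  exact key C t ht hst hC

/-- A minor of `H` on the subset `T` of a 2-connected set `Y`, fixing everything outside `Y`. -/
structure IsRetract (H H' : SimpleGraph V) (Y T : Finset V) : Prop where
  twoConn : TwoConn H' T
  adj : ∀ a b, (a ∈ Y → a ∈ T) → (b ∈ Y → b ∈ T) → H.Adj a b → H'.Adj a b
  lift : ∀ P Q, P ⊆ T → Q ⊆ T → Disjoint P Q → Linked H' P → Linked H' Q →
    ∃ P' Q', P ⊆ P' ∧ Q ⊆ Q' ∧ P' ⊆ Y ∧ Q' ⊆ Y ∧ Disjoint P' Q' ∧ Linked H P' ∧ Linked H Q'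

theorem TwoConn.exists_retract (h : TwoConn H Y) (hT : T ⊆ Y) (hne : T.Nonempty) :
    ∃ H', IsRetract H H' Y T ∧ ∀ {κ : Type} (K : SimpleGraph κ), (∀ k, ∃ l, K.Adj k l) →
      HasMinor K H' → HasMinor K H := by
  induction hn : Y.card generalizing Y H with
  | zero =>
    rw [Finset.card_eq_zero] at hn
    obtain ⟨a, ha⟩ := hne
    simpa [hn] using hT ha
  | succ n ih =>
    by_cases hTY : Y ⊆ T
    · obtain rfl := hT.antisymm hTY
      exact ⟨H, ⟨h, fun _ _ _ _ h => h, fun P Q h1 h2 h3 h4 h5 =>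
        ⟨P, Q, subset_rfl, subset_rfl, h1, h2, h3, h4, h5⟩⟩, fun _ _ h => h⟩
    obtain ⟨s, hs, hsT⟩ := Finset.not_subset.1 hTY
    obtain ⟨d, hd⟩ := hne
    obtain ⟨t, ht, hst, hl⟩ := h.exists_neighbor hs (hT hd) (fun e => hsT (e ▸ hd))
    have htw : TwoConn (contract H t s) (Y.erase s) := by
      refine ⟨h.linked.contract_erase ht hst.ne', fun c => ?_⟩
      by_cases hc : c = t
      · subst hc
        exact hl.mono fun a ha b hb hab => contract_adj_of_adj hab (by grind) (by grind)
      · rw [Finset.erase_right_comm]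
        exact (h.erase c).contract_erase (by grind) hst.ne'
    have hcon := isContraction_contract hst.symm
    obtain ⟨H', hr, hmin⟩ := ih htw (fun a ha => Finset.mem_erase.2 ⟨fun e => hsT (e ▸ ha), hT ha⟩)
      (by rw [Finset.card_erase_of_mem hs, hn]; rfl)
    refine ⟨H', ⟨hr.twoConn, fun a b ha hb hab => ?_, fun P Q hP hQ hPQ h1 h2 => ?_⟩,
      fun K hK h => (hmin K hK h).of_contraction hcon hK⟩
    · have hT' : ∀ {a}, (a ∈ Y → a ∈ T) → a ≠ s := fun ha e => hsT (e ▸ ha (e ▸ hs))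
      exact hr.adj a b (fun h => ha (by grind)) (fun h => hb (by grind))
        (contract_adj_of_adj hab (hT' ha) (hT' hb))
    · obtain ⟨P', Q', p1, q1, p2, q2, d, l1, l2⟩ := hr.lift P Q hP hQ hPQ h1 h2
      refine ⟨unfold t {s} P', unfold t {s} Q', p1.trans subset_unfold, q1.trans subset_unfold,
        ?_, ?_, disjoint_unfold d ?_ ?_, hcon.linked_unfold l1, hcon.linked_unfold l2⟩
      · unfold unfold
        grind
      · unfold unfold
        grind
      · rw [Finset.disjoint_singleton_right]
        grind
      · rw [Finset.disjoint_singleton_right]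
        grind

end Connectivity

section GoodEdge

variable {V : Type*} [DecidableEq V] {H : SimpleGraph V} {X D : Finset V} {p q r u v w : V}

/-- The vertices `p`, `q` and `r` separate `D` from some other vertex of `X`. -/
structure Separation (H : SimpleGraph V) (X D : Finset V) (p q r : V) : Prop where
  subset : D ⊆ X
  nonempty : D.Nonempty
  fst : p ∉ D
  snd : q ∉ D
  trd : r ∉ D
  closed : ∀ a ∈ D, ∀ b ∈ X, H.Adj a b → b ∈ D ∨ b = p ∨ b = q ∨ b = r
  proper : ∃ d ∈ X, d ∉ D ∧ d ≠ p ∧ d ≠ q ∧ d ≠ r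

theorem Separation.rotate (h : Separation H X D p q r) : Separation H X D r p q :=
  ⟨h.subset, h.nonempty, h.trd, h.fst, h.snd, fun a ha b hb hab => by
    have := h.closed a ha b hb hab; tauto, by
    obtain ⟨d, h1, h2, h3, h4, h5⟩ := h.proper
    exact ⟨d, h1, h2, h5, h3, h4⟩⟩

theorem Separation.swap (h : Separation H X D p q r) : Separation H X D q p r :=
  ⟨h.subset, h.nonempty, h.snd, h.fst, h.trd, fun a ha b hb hab => by
    have := h.closed a ha b hb hab; tauto, by
    obtain ⟨d, h1, h2, h3, h4, h5⟩ := h.proper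
    exact ⟨d, h1, h2, h4, h3, h5⟩⟩

theorem Separation.exists_adj (h3 : ThreeConn H X) (h : Separation H X D p q r) :
    r ∈ X ∧ r ≠ q ∧ ∃ w ∈ D, H.Adj r w := by
  obtain ⟨d, h1, h2, h3', h4, -⟩ := h.proper
  have hp := h.fst
  have hq := h.snd
  obtain ⟨b, hb, c, hc, hcD, hbc⟩ := (h3 p q).exists_adj (A := D)
    (fun x hx => by have := h.subset hx; grind) h.nonempty.choose_spec (d := d) (by grind) h2
  have := h.closed b hb c (by grind) hbc
  obtain rfl : c = r := by grind
  exact ⟨by grind, by grind, b, hb, hbc.symm⟩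

theorem Separation.exists_smaller (h3 : ThreeConn H X) (h : Separation H X D p q r)
    (hpq : H.Adj p q) (hw : w ∈ D) {t : V} (ht : ¬ Linked H (((X.erase r).erase w).erase t)) :
    ∃ D' ⊂ D, Separation H X D' r w t := by
  obtain ⟨C, hC, hpC, hqC⟩ := exists_part_avoiding ht hpq
  have hsub := hC.subset
  have hr : r ∉ C := fun h => by simpa using hsub h
  have hwC : w ∉ C := fun h => by simpa using hsub h
  have htC : t ∉ C := fun h => by simpa using hsub h
  obtain ⟨d, hd, hdC⟩ := hC.proper
  refine ⟨C ∩ D, ⟨Finset.inter_subset_right, fun hn => hwC (Finset.mem_inter.1 (hn hw)).1⟩,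
    Finset.inter_subset_right.trans h.subset, ?_, ?_, ?_, ?_, ?_, d, ?_⟩
  · obtain ⟨b, hb, c, hc, hcC, hbc⟩ := (h3 r t).exists_adj (A := C)
      (fun x hx => by have := hsub hx; grind) hC.nonempty.choose_spec (d := d) (by grind) hdC
    obtain rfl : c = w := by
      by_contra hcw
      exact hcC (hC.closed b hb c (by grind) hbc)
    have hbX := hsub hb
    have := h.closed c hw b (by grind) hbc.symm
    exact ⟨b, by grind⟩
  · grind
  · grind
  · grind
  · intro a ha b hb hab
    rw [Finset.mem_inter] at ha
    have h1 := h.closed a ha.2 b hb hab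
    have h2 := hC.closed a ha.1 b
    grind
  · grind

theorem ThreeConn.exists_good_edge (h3 : ThreeConn H X) (hX : 5 ≤ X.card) (huv : H.Adj u v)
    (hu' : u ∈ X) (hv' : v ∈ X) :
    ∃ x ∈ X, ∃ y ∈ X, H.Adj x y ∧ y ≠ u ∧ y ≠ v ∧
      (x ≠ u ∧ x ≠ v ∨ x = u ∧ ¬ H.Adj y v ∨ x = v ∧ ¬ H.Adj y u) ∧
      ∀ t, Linked H (((X.erase x).erase y).erase t) := by
  have key : ∀ D p q r, Separation H X D p q r → H.Adj p q → u ∉ D → v ∉ D →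
      ∃ x ∈ X, ∃ y ∈ X, H.Adj x y ∧ y ≠ u ∧ y ≠ v ∧
        (x ≠ u ∧ x ≠ v ∨ x = u ∧ ¬ H.Adj y v ∨ x = v ∧ ¬ H.Adj y u) ∧
        ∀ t, Linked H (((X.erase x).erase y).erase t) := by
    intro D
    induction D using Finset.strongInduction with
    | H D ih =>
      intro p q r hS hpq hu hv
      have step : ∀ p q r w, Separation H X D p q r → H.Adj p q → w ∈ D → H.Adj r w → r ∈ X →
          (r ≠ u ∧ r ≠ v ∨ r = u ∧ ¬ H.Adj w v ∨ r = v ∧ ¬ H.Adj w u) →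
          ∃ x ∈ X, ∃ y ∈ X, H.Adj x y ∧ y ≠ u ∧ y ≠ v ∧
            (x ≠ u ∧ x ≠ v ∨ x = u ∧ ¬ H.Adj y v ∨ x = v ∧ ¬ H.Adj y u) ∧
            ∀ t, Linked H (((X.erase x).erase y).erase t) := by
        intro p q r w hS hpq hw hrw hr hgood
        by_cases hl : ∀ t, Linked H (((X.erase r).erase w).erase t)
        · exact ⟨r, hr, w, hS.subset hw, hrw, fun e => hu (e ▸ hw), fun e => hv (e ▸ hw), hgood, hl⟩
        · push Not at hl
          obtain ⟨t, ht⟩ := hl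
          obtain ⟨D', hD, hS'⟩ := hS.exists_smaller h3 hpq hw ht
          exact ih D' hD r w t hS' hrw (fun h => hu (hD.1 h)) fun h => hv (hD.1 h)
      have far : ∀ p q r, Separation H X D p q r → H.Adj p q → r ≠ u → r ≠ v →
          ∃ x ∈ X, ∃ y ∈ X, H.Adj x y ∧ y ≠ u ∧ y ≠ v ∧
            (x ≠ u ∧ x ≠ v ∨ x = u ∧ ¬ H.Adj y v ∨ x = v ∧ ¬ H.Adj y u) ∧
            ∀ t, Linked H (((X.erase x).erase y).erase t) := by
        intro p q r hS hpq hru hrv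
        obtain ⟨hr, -, w, hw, hrw⟩ := hS.exists_adj h3
        exact step p q r w hS hpq hw hrw hr (Or.inl ⟨hru, hrv⟩)
      obtain ⟨hr, hrq, w, hw, hrw⟩ := hS.exists_adj h3
      have hrp := (hS.swap.exists_adj h3).2.1
      have hwX := hS.subset hw
      by_cases hru : r = u
      · subst hru
        by_cases hwv : H.Adj w v
        · have := hS.closed w hw v hv' hwv
          have hne := huv.ne
          obtain rfl | rfl : v = p ∨ v = q := by grind
          · exact far r v q (hS.rotate) huv hrq.symm hpq.ne'
          · exact far r v p (hS.rotate.rotate.swap) huv hrp.symm hpq.ne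
        · exact step p q r w hS hpq hw hrw hr (Or.inr (Or.inl ⟨rfl, hwv⟩))
      by_cases hrv : r = v
      · subst hrv
        by_cases hwu : H.Adj w u
        · have := hS.closed w hw u hu' hwu
          obtain rfl | rfl : u = p ∨ u = q := by grind
          · exact far r u q (hS.rotate) huv.symm hpq.ne' hrq.symm
          · exact far r u p (hS.rotate.rotate.swap) huv.symm hpq.ne hrp.symm
        · exact step p q r w hS hpq hw hrw hr (Or.inr (Or.inr ⟨rfl, hwu⟩))
      · exact far p q r hS hpq hru hrv
  have hcard : 3 ≤ ((X.erase u).erase v).card := by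
    have h1 := Finset.pred_card_le_card_erase (s := X) (a := u)
    have h2 := Finset.pred_card_le_card_erase (s := X.erase u) (a := v)
    omega
  obtain ⟨x, hx, d, hd, hxd⟩ := Finset.one_lt_card.1 (by omega : 1 < ((X.erase u).erase v).card)
  obtain ⟨y, hy, hxy⟩ := (h3 u v).exists_neighbor hx hd hxd.symm
  rw [Finset.mem_erase, Finset.mem_erase] at hx hy
  by_cases hl : ∀ t, Linked H (((X.erase x).erase y).erase t)
  · exact ⟨x, hx.2.2, y, hy.2.2, hxy, hy.2.1, hy.1, Or.inl ⟨hx.2.1, hx.1⟩, hl⟩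
  push Not at hl
  obtain ⟨t, ht⟩ := hl
  obtain ⟨C, hC, huC, hvC⟩ := exists_part_avoiding ht huv
  have hsub := hC.subset
  refine key C x y t ⟨fun a ha => ?_, hC.nonempty, fun h => ?_, fun h => ?_, fun h => ?_,
    fun a ha b hb hab => ?_, ?_⟩ hxy huC hvC
  · have := hsub ha
    grind
  · simpa using hsub h
  · simpa using hsub h
  · simpa using hsub h
  · have := hC.closed a ha b
    grind
  · obtain ⟨d, hd, hdC⟩ := hC.proper
    exact ⟨d, by grind⟩

end GoodEdge

section Gluing

variable {V : Type*} [DecidableEq V] {D H G : SimpleGraph V} {V₁ X Y : Finset V}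
  {u v x y : V} {p : V → ℝ × ℝ}

theorem exists_completeBipartite_adj (k : Fin 3 ⊕ Fin 3) :
    ∃ l, (completeBipartiteGraph (Fin 3) (Fin 3)).Adj k l := by
  rcases k with i | i
  · exact ⟨Sum.inr 0, by simp⟩
  · exact ⟨Sum.inl 0, by simp⟩

theorem exists_top_adj (k : Fin 5) : ∃ l, (⊤ : SimpleGraph (Fin 5)).Adj k l := by
  obtain ⟨l, hl⟩ := exists_ne k
  exact ⟨l, hl.symm⟩

theorem TwoConn.adj_of_triple {a b c : V} (h : TwoConn H {a, b, c}) (hab : a ≠ b) (hac : a ≠ c)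
    (hbc : b ≠ c) : H.Adj a b := by
  have := h.erase c
  refine adj_of_linked_pair hab ?_
  convert this using 1
  ext z
  grind

theorem TwoConn.adj_of_quadruple {a b c d : V} (h : TwoConn H {a, b, c, d}) (hab : a ≠ b)
    (hac : a ≠ c) (had : a ≠ d) (hbc : b ≠ c) (hbd : b ≠ d) (hcd : c ≠ d) (hn : ¬ H.Adj a b) :
    H.Adj a c := by
  obtain ⟨t, ht, hat⟩ := (h.erase d).exists_neighbor (s := a) (d := b) (by grind) (by grind)
    hab.symm
  have := hat.ne
  have : t = c := by grind
  exact this ▸ hat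

theorem hasMinor_top_of_common (hY : TwoConn H Y) (hxY : x ∉ Y) (hyY : y ∉ Y) (hxy : H.Adj x y)
    {a b c : V} (ha : a ∈ Y) (hb : b ∈ Y) (hc : c ∈ Y) (hab : a ≠ b) (hac : a ≠ c) (hbc : b ≠ c)
    (hxa : H.Adj x a) (hxb : H.Adj x b) (hxc : H.Adj x c) (hya : H.Adj y a) (hyb : H.Adj y b)
    (hyc : H.Adj y c) : HasMinor (⊤ : SimpleGraph (Fin 5)) H := by
  obtain ⟨H', hr, hm⟩ := hY.exists_retract (T := {a, b, c})
    (by simp [Finset.insert_subset_iff, ha, hb, hc]) (by simp)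
  refine hm _ exists_top_adj ?_
  have hT := hr.twoConn
  have e1 : ({a, c, b} : Finset V) = {a, b, c} := by grind
  have e2 : ({b, c, a} : Finset V) = {a, b, c} := by grind
  have c1 := hT.adj_of_triple hab hac hbc
  have c2 := (e1 ▸ hT).adj_of_triple hac hab hbc.symm
  have c3 := (e2 ▸ hT).adj_of_triple hbc hab.symm hac.symm
  have hx : ∀ z, z ∈ ({a, b, c} : Finset V) → H.Adj x z → H'.Adj x z := fun z hz h =>
    hr.adj x z (fun h => absurd h hxY) (fun _ => hz) h
  have hy : ∀ z, z ∈ ({a, b, c} : Finset V) → H.Adj y z → H'.Adj y z := fun z hz h =>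
    hr.adj y z (fun h => absurd h hyY) (fun _ => hz) h
  have m0 := hr.adj x y (fun h => absurd h hxY) (fun h => absurd h hyY) hxy
  have m1 := hx a (by simp) hxa
  have m2 := hx b (by simp) hxb
  have m3 := hx c (by simp) hxc
  have m4 := hy a (by simp) hya
  have m5 := hy b (by simp) hyb
  have m6 := hy c (by simp) hyc
  have key : ∀ k l : Fin 5, k ≠ l → H'.Adj (![x, y, a, b, c] k) (![x, y, a, b, c] l) := by
    intro k l hkl
    fin_cases k <;> fin_cases l <;> first | exact absurd rfl hkl | assumption |
      exact SimpleGraph.Adj.symm (by assumption)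
  refine hasMinor_of_injective ![x, y, a, b, c] (fun k l h => ?_) key
  by_contra hkl
  exact (key k l hkl).ne h

theorem exists_disjoint_linked (hY : TwoConn H Y) (hxY : x ∉ Y) (hyY : y ∉ Y) (hxy : H.Adj x y)
    (hK : ¬ HasMinor (completeBipartiteGraph (Fin 3) (Fin 3)) H)
    {a a' b b' : V} (ha : a ∈ Y) (ha' : a' ∈ Y) (hb : b ∈ Y) (hb' : b' ∈ Y) (haa : a ≠ a')
    (hbb : b ≠ b') (hab : a ≠ b) (hab' : a ≠ b') (ha'b : a' ≠ b) (ha'b' : a' ≠ b')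
    (hxa : H.Adj x a) (hxa' : H.Adj x a') (hyb : H.Adj y b) (hyb' : H.Adj y b') :
    ∃ P Q, P ⊆ Y ∧ Q ⊆ Y ∧ Disjoint P Q ∧ Linked H P ∧ Linked H Q ∧ a ∈ P ∧ a' ∈ P ∧ b ∈ Q ∧
      b' ∈ Q := by
  obtain ⟨H', hr, hm⟩ := hY.exists_retract (T := {a, a', b, b'})
    (by simp [Finset.insert_subset_iff, ha, ha', hb, hb']) (by simp)
  by_cases h : H'.Adj a a' ∧ H'.Adj b b'
  · obtain ⟨P, Q, h1, h2, h3, h4, h5, h6, h7⟩ := hr.lift {a, a'} {b, b'} (by grind) (by grind)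
      (by simp [Finset.disjoint_left]; grind) (linked_pair h.1) (linked_pair h.2)
    exact ⟨P, Q, h3, h4, h5, h6, h7, h1 (by simp), h1 (by simp), h2 (by simp), h2 (by simp)⟩
  exfalso
  have hT := hr.twoConn
  have e1 : ({a', a, b, b'} : Finset V) = {a, a', b, b'} := by grind
  have e2 : ({a, a', b', b} : Finset V) = {a, a', b, b'} := by grind
  have e3 : ({a', a, b', b} : Finset V) = {a, a', b, b'} := by grind
  have e4 : ({b, b', a, a'} : Finset V) = {a, a', b, b'} := by grind
  have e5 : ({b, b', a', a} : Finset V) = {a, a', b, b'} := by grind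
  have e6 : ({b', b, a, a'} : Finset V) = {a, a', b, b'} := by grind
  have e7 : ({b', b, a', a} : Finset V) = {a, a', b, b'} := by grind
  have cyc : H'.Adj a b ∧ H'.Adj a b' ∧ H'.Adj a' b ∧ H'.Adj a' b' := by
    rw [not_and_or] at h
    rcases h with h | h
    · have h' : ¬ H'.Adj a' a := fun e => h e.symm
      exact ⟨hT.adj_of_quadruple haa hab hab' ha'b ha'b' hbb h,
        (e2 ▸ hT).adj_of_quadruple haa hab' hab ha'b' ha'b hbb.symm h,
        (e1 ▸ hT).adj_of_quadruple haa.symm ha'b ha'b' hab hab' hbb h',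
        (e3 ▸ hT).adj_of_quadruple haa.symm ha'b' ha'b hab' hab hbb.symm h'⟩
    · have h' : ¬ H'.Adj b' b := fun e => h e.symm
      exact ⟨((e4 ▸ hT).adj_of_quadruple hbb hab.symm ha'b.symm hab'.symm ha'b'.symm haa h).symm,
        ((e6 ▸ hT).adj_of_quadruple hbb.symm hab'.symm ha'b'.symm hab.symm ha'b.symm haa h').symm,
        ((e5 ▸ hT).adj_of_quadruple hbb ha'b.symm hab.symm ha'b'.symm hab'.symm haa.symm h).symm,
        ((e7 ▸ hT).adj_of_quadruple hbb.symm ha'b'.symm hab'.symm ha'b.symm hab.symm haa.symm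
          h').symm⟩
  have hx : ∀ c, c ∈ ({a, a', b, b'} : Finset V) → H.Adj x c → H'.Adj x c := fun c hc h =>
    hr.adj x c (fun h => absurd h hxY) (fun _ => hc) h
  have hy : ∀ c, c ∈ ({a, a', b, b'} : Finset V) → H.Adj y c → H'.Adj y c := fun c hc h =>
    hr.adj y c (fun h => absurd h hyY) (fun _ => hc) h
  have hxy' := hr.adj x y (fun h => absurd h hxY) (fun h => absurd h hyY) hxy
  have m1 := hx a (by simp) hxa
  have m2 := hx a' (by simp) hxa'
  have m3 := hy b (by simp) hyb
  have m4 := hy b' (by simp) hyb'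
  obtain ⟨c1, c2, c3, c4⟩ := cyc
  have key : ∀ i j : Fin 3, H'.Adj (![a, a', y] i) (![b, b', x] j) := by
    intro i j
    fin_cases i <;> fin_cases j <;> first | assumption | exact SimpleGraph.Adj.symm (by assumption)
  have n6 : x ≠ b := fun e => hxY (e ▸ hb)
  have n7 : x ≠ b' := fun e => hxY (e ▸ hb')
  have n8 : y ≠ a := fun e => hyY (e ▸ ha)
  have n9 : y ≠ a' := fun e => hyY (e ▸ ha')
  refine hK (hm _ exists_completeBipartite_adj
    (hasMinor_of_injective (Sum.elim ![a, a', y] ![b, b', x]) ?_ ?_))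
  · rw [Sum.elim_injective]
    refine ⟨?_, ?_, ?_⟩
    · intro i j
      fin_cases i <;> fin_cases j <;> simp [haa, haa.symm, n8, n8.symm, n9, n9.symm]
    · intro i j
      fin_cases i <;> fin_cases j <;> simp [hbb, hbb.symm, n6, n6.symm, n7, n7.symm]
    · exact fun i j => (key i j).ne
  · rintro (i | i) (j | j) hij
    · simp at hij
    · exact key i j
    · exact (key j i).symm
    · simp at hij

/-- The graphs `D` on `V₁` and `H` on `X` share exactly the edge `uv`, the former being drawn and
2-connected. -/
structure Gluing (D : SimpleGraph V) (V₁ : Finset V) (H : SimpleGraph V) (X : Finset V)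
    (u v : V) : Prop where
  left_adj : D.Adj u v
  right_adj : H.Adj u v
  left_support : ∀ {a b}, D.Adj a b → a ∈ V₁
  right_support : ∀ {a b}, H.Adj a b → a ∈ X
  inter : ∀ {a}, a ∈ V₁ → a ∈ X → a = u ∨ a = v
  twoConn : TwoConn D V₁
  drawable : Drawable D

namespace Gluing

theorem symm (g : Gluing D V₁ H X u v) : Gluing D V₁ H X v u where
  left_adj := g.left_adj.symm
  right_adj := g.right_adj.symm
  left_support := g.left_support
  right_support := g.right_support
  inter ha hb := (g.inter ha hb).symm
  twoConn := g.twoConn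
  drawable := g.drawable

theorem adj_right (g : Gluing D V₁ H X u v) {a b : V} (h : (D ⊔ H).Adj a b) (ha : a ∈ X)
    (hb : b ∈ X) : H.Adj a b := by
  rcases h with h | h
  · have := h.ne
    rcases g.inter (g.left_support h) ha with rfl | rfl <;>
    rcases g.inter (g.left_support h.symm) hb with rfl | rfl
    · exact absurd rfl this
    · exact g.right_adj
    · exact g.right_adj.symm
    · exact absurd rfl this
  · exact h

theorem adj_right_of_ne (g : Gluing D V₁ H X u v) {a b : V} (h : (D ⊔ H).Adj a b) (ha : a ∈ X)
    (hu : a ≠ u) (hv : a ≠ v) : H.Adj a b := by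
  rcases h with h | h
  · rcases g.inter (g.left_support h) ha with h | h
    · exact absurd h hu
    · exact absurd h hv
  · exact h

theorem contract (g : Gluing D V₁ H X u v) (hx : x ∈ X) (hyu : y ≠ u)
    (hyv : y ≠ v) : Gluing D V₁ (Planarity.contract H x y) (X.erase y) u v where
  left_adj := g.left_adj
  right_adj := contract_adj_of_adj g.right_adj hyu.symm hyv.symm
  left_support := g.left_support
  right_support := by
    rintro a b ⟨-, ha, hb, h | ⟨rfl, h⟩ | ⟨rfl, h⟩⟩
    · exact Finset.mem_erase.2 ⟨ha, g.right_support h⟩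
    · exact Finset.mem_erase.2 ⟨ha, hx⟩
    · exact Finset.mem_erase.2 ⟨ha, g.right_support h⟩
  inter h h' := g.inter h (Finset.mem_of_mem_erase h')
  twoConn := g.twoConn
  drawable := g.drawable

theorem contract_le (g : Gluing D V₁ H X u v) (hy : y ∈ X) (hyu : y ≠ u) (hyv : y ≠ v) :
    Planarity.contract (D ⊔ H) x y ≤ D ⊔ Planarity.contract H x y := by
  rintro a b ⟨hab, ha, hb, h | ⟨rfl, h⟩ | ⟨rfl, h⟩⟩
  · rcases h with h | h
    · exact Or.inl h
    · exact Or.inr ⟨hab, ha, hb, Or.inl h⟩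
  · exact Or.inr ⟨hab, ha, hb, Or.inr (Or.inl ⟨rfl, g.adj_right_of_ne h hy hyu hyv⟩)⟩
  · exact Or.inr ⟨hab, ha, hb,
      Or.inr (Or.inr ⟨rfl, (g.adj_right_of_ne h.symm hy hyu hyv).symm⟩)⟩

theorem linked_sup_contract {S : Finset V} (hS : Linked H S) (hy : y ∉ S) :
    Linked (D ⊔ Planarity.contract H x y) S :=
  hS.mono fun _ ha _ hb hab => Or.inr
    (contract_adj_of_adj hab (fun e => hy (e ▸ ha)) (fun e => hy (e ▸ hb)))

theorem coneAt_eq_of_mem (hxy : H.Adj x y) (hY : TwoConn H ((X.erase x).erase y))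
    (hK : ¬ HasMinor (completeBipartiteGraph (Fin 3) (Fin 3)) H)
    (hp : Drawing (D ⊔ Planarity.contract H x y) p) {a a' b b' : V}
    (haX : a ∈ X) (haX' : a' ∈ X) (hbX : b ∈ X) (hbX' : b' ∈ X)
    (ha : H.Adj x a) (ha' : H.Adj x a') (hb : H.Adj y b) (hb' : H.Adj y b') (hay : a ≠ y)
    (hay' : a' ≠ y) (hbx : b ≠ x) (hbx' : b' ≠ x) (haa : a ≠ a') (hbb : b ≠ b') (hab : a ≠ b)
    (hab' : a ≠ b') (ha'b : a' ≠ b) (ha'b' : a' ≠ b') :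
    coneAt p x a b b' = coneAt p x a' b b' := by
  have m1 := ha.ne'
  have m2 := ha'.ne'
  have m3 := hb.ne'
  have m4 := hb'.ne'
  have m5 := hxy.ne
  obtain ⟨P, Q, hPY, hQY, hPQ, hP, hQ, haP, haP', hbQ, hbQ'⟩ := exists_disjoint_linked hY
    (x := x) (y := y) (a := a) (a' := a') (b := b) (b' := b') (by simp) (by simp) hxy hK
    (by grind) (by grind) (by grind) (by grind) haa hbb hab hab' ha'b ha'b' ha ha' hb hb'
  exact hp.coneAt_eq_of_linked (linked_sup_contract hP fun h => by simpa using hPY h)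
    (linked_sup_contract hQ fun h => by simpa using hQY h) hPQ (fun h => by simpa using hPY h)
    (fun h => by simpa using hQY h) haP haP' hbQ hbQ' hbb
    (Or.inr ⟨ha.ne, m5, hay, Or.inl ha⟩) (Or.inr ⟨ha'.ne, m5, hay', Or.inl ha'⟩)
    (Or.inr ⟨hbx.symm, m5, m3, Or.inr (Or.inl ⟨rfl, hb⟩)⟩)
    (Or.inr ⟨hbx'.symm, m5, m4, Or.inr (Or.inl ⟨rfl, hb'⟩)⟩)

theorem coneAt_eq_of_end (g : Gluing D V₁ H X u v) (huy : H.Adj u y)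
    (hyv : y ≠ v) (hn : ¬ H.Adj y v) (hY : TwoConn H ((X.erase u).erase y))
    (hK : ¬ HasMinor (completeBipartiteGraph (Fin 3) (Fin 3)) H)
    (hp : Drawing (D ⊔ Planarity.contract H u y) p) {a a' b b' : V}
    (ha : (D ⊔ H).Adj u a) (ha' : (D ⊔ H).Adj u a') (hb : H.Adj y b) (hb' : H.Adj y b')
    (hay : a ≠ y) (hay' : a' ≠ y) (hbx : b ≠ u) (hbx' : b' ≠ u) (haa : a ≠ a') (hbb : b ≠ b')
    (hab : a ≠ b) (hab' : a ≠ b') (ha'b : a' ≠ b) (ha'b' : a' ≠ b') :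
    coneAt p u a b b' = coneAt p u a' b b' := by
  have m3 := hb.ne'
  have m4 := hb'.ne'
  have m5 := huy.ne
  have huv := g.right_adj.ne
  have hvX := g.right_support g.right_adj.symm
  have hbX := g.right_support hb.symm
  have hbX' := g.right_support hb'.symm
  have hbv : b ≠ v := fun e => hn (e ▸ hb)
  have hbv' : b' ≠ v := fun e => hn (e ▸ hb')
  have hR := g.twoConn.erase u
  have hRX : ∀ w ∈ V₁.erase u, w ∈ X → w = v := fun w hw hwX => by
    rcases g.inter (Finset.mem_of_mem_erase hw) hwX with rfl | h
    · simp at hw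
    · exact h
  have hvR : v ∈ V₁.erase u := Finset.mem_erase.2 ⟨huv.symm, g.left_support g.left_adj.symm⟩
  have hyR : y ∉ V₁.erase u := fun h => hyv (hRX y h (g.right_support huy.symm))
  have hR' : Linked (D ⊔ Planarity.contract H u y) (V₁.erase u) :=
    hR.mono fun _ _ _ _ h => Or.inl h
  have lift : ∀ {w}, (D ⊔ H).Adj u w → w ≠ y → (D ⊔ Planarity.contract H u y).Adj u w := by
    rintro w (h | h) hw
    · exact Or.inl h
    · exact Or.inr (contract_adj_of_adj h m5 hw)
  have lb : (D ⊔ Planarity.contract H u y).Adj u b :=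
    Or.inr ⟨hbx.symm, m5, m3, Or.inr (Or.inl ⟨rfl, hb⟩)⟩
  have lb' : (D ⊔ Planarity.contract H u y).Adj u b' :=
    Or.inr ⟨hbx'.symm, m5, m4, Or.inr (Or.inl ⟨rfl, hb'⟩)⟩
  have both : ∀ {a a'}, a ∈ V₁.erase u → a' ∈ V₁.erase u → (D ⊔ H).Adj u a → (D ⊔ H).Adj u a' →
      a ≠ y → a' ≠ y → coneAt p u a b b' = coneAt p u a' b b' := by
    intro a a' haR haR' ha ha' hay hay'
    refine hp.coneAt_eq_of_linked hR' (linked_sup_contract (hY.erase v) (by simp)) ?_ (by simp)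
      (by simp) haR haR' (by simp [*]) (by simp [*]) hbb (lift ha hay) (lift ha' hay') lb lb'
    refine Finset.disjoint_left.2 fun w hw hw' => ?_
    have := hRX w hw (by simp at hw'; tauto)
    simp [this] at hw'
  have mixed : ∀ {a a'}, H.Adj u a → a' ∈ V₁.erase u → (D ⊔ H).Adj u a' → a ≠ y → a' ≠ y →
      a ≠ b → a ≠ b' → coneAt p u a b b' = coneAt p u a' b b' := by
    intro a a' ha haR' ha' hay hay' hab hab'
    by_cases hav : a = v
    · exact both (hav ▸ hvR) haR' (Or.inr ha) ha' hay hay'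
    have haX := g.right_support ha.symm
    have m1 := ha.ne'
    obtain ⟨P, Q, hPY, hQY, hPQ, hP, hQ, haP, haP', hbQ, hbQ'⟩ := exists_disjoint_linked hY
      (x := u) (y := y) (a := a) (a' := v) (b := b) (b' := b') (by simp) (by simp) huy hK
      (by grind) (by grind) (by grind) (by grind) hav hbb hab hab' hbv.symm hbv'.symm ha
      g.right_adj hb hb'
    refine hp.coneAt_eq_of_linked
      ((linked_sup_contract hP fun h => by simpa using hPY h).union hR' haP' hvR)
      (linked_sup_contract hQ fun h => by simpa using hQY h) ?_
      (fun h => ?_) (fun h => by simpa using hQY h) (Finset.mem_union_left _ haP)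
      (Finset.mem_union_right _ haR') hbQ hbQ' hbb (lift (Or.inr ha) hay) (lift ha' hay') lb lb'
    · refine Finset.disjoint_union_left.2 ⟨hPQ, Finset.disjoint_left.2 fun w hw hw' => ?_⟩
      have := hRX w hw (by have := hQY hw'; simp at this; tauto)
      exact Finset.disjoint_left.1 hPQ haP' (this ▸ hw')
    · rcases Finset.mem_union.1 h with h | h
      · simpa using hPY h
      · simp at h
  have mem : ∀ {w}, D.Adj u w → w ∈ V₁.erase u := fun h =>
    Finset.mem_erase.2 ⟨h.ne', g.left_support h.symm⟩
  rcases ha with h1 | h1 <;> rcases ha' with h2 | h2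
  · exact both (mem h1) (mem h2) (Or.inl h1) (Or.inl h2) hay hay'
  · exact (mixed h2 (mem h1) (Or.inl h1) hay' hay ha'b ha'b').symm
  · exact mixed h1 (mem h2) (Or.inl h2) hay hay' hab hab'
  · exact coneAt_eq_of_mem huy hY hK hp (g.right_support h1.symm) (g.right_support h2.symm) hbX
      hbX' h1 h2 hb hb' hay hay' hbx hbx' haa hbb hab hab' ha'b ha'b'

theorem drawable_sup [Fintype V] (g : Gluing D V₁ H X u v)
    (h : 5 ≤ X.card → ThreeConn H X ∧ ¬ HasMinor (⊤ : SimpleGraph (Fin 5)) H ∧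
      ¬ HasMinor (completeBipartiteGraph (Fin 3) (Fin 3)) H) : Drawable (D ⊔ H) := by
  induction hn : X.card generalizing H X with
  | zero =>
    rw [Finset.card_eq_zero] at hn
    simpa [hn] using g.right_support g.right_adj
  | succ n ih =>
    have huX := g.right_support g.right_adj
    have hvX := g.right_support g.right_adj.symm
    have huv := g.right_adj.ne
    by_cases h5 : 5 ≤ X.card
    · obtain ⟨h3, hK5, hK33⟩ := h h5
      obtain ⟨x, hx, y, hy, hxy, hyu, hyv, hcase, htri⟩ :=
        h3.exists_good_edge h5 g.right_adj huX hvX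
      have hY : TwoConn H ((X.erase x).erase y) := ⟨by simpa using htri x, htri⟩
      have h3' : ThreeConn (Planarity.contract H x y) (X.erase y) := by
        intro s t
        have tri' : ∀ t,
            Linked (Planarity.contract H x y) (((X.erase x).erase y).erase t) := fun t =>
          (htri t).mono fun a ha b hb hab => contract_adj_of_adj hab
            (by simp at ha; tauto) (by simp at hb; tauto)
        by_cases hs : s = x
        · rw [hs, Finset.erase_right_comm (a := y)]
          exact tri' t
        by_cases ht : t = x
        · rw [ht, Finset.erase_right_comm, Finset.erase_right_comm (a := y)]
          exact tri' s
        have := (h3 s t).contract_erase (x := x) (y := y) (by simp [hx, Ne.symm hs, Ne.symm ht])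
          hxy.ne
        rwa [Finset.erase_right_comm, Finset.erase_right_comm (a := s)] at this
      obtain ⟨p, hp⟩ := ih (g.contract hx hyu hyv) (fun _ => ⟨h3',
        fun hm => hK5 (hm.of_contraction (isContraction_contract hxy) exists_top_adj),
        fun hm => hK33 (hm.of_contraction (isContraction_contract hxy)
          exists_completeBipartite_adj)⟩)
        (by rw [Finset.card_erase_of_mem hy, hn, Nat.add_sub_cancel])
      refine (hp.mono (g.contract_le hy hyu hyv)).split hxy.ne ?_ ?_
      · intro a a' b b' ha ha' hb hb' hay hay' hbx hbx' haa hbb hab hab' ha'b ha'b'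
        have hb := g.adj_right_of_ne hb hy hyu hyv
        have hb' := g.adj_right_of_ne hb' hy hyu hyv
        rcases hcase with ⟨hxu, hxv⟩ | ⟨rfl, hn⟩ | ⟨rfl, hn⟩
        · have ha := g.adj_right_of_ne ha hx hxu hxv
          have ha' := g.adj_right_of_ne ha' hx hxu hxv
          exact coneAt_eq_of_mem hxy hY hK33 hp (g.right_support ha.symm)
            (g.right_support ha'.symm) (g.right_support hb.symm)
            (g.right_support hb'.symm) ha ha' hb hb' hay hay' hbx hbx' haa hbb hab hab' ha'b ha'b'
        · exact g.coneAt_eq_of_end hxy hyv hn hY hK33 hp ha ha' hb hb' hay hay' hbx hbx' haa hbb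
            hab hab' ha'b ha'b'
        · exact g.symm.coneAt_eq_of_end hxy hyu hn hY hK33 hp ha ha' hb hb' hay hay' hbx hbx' haa
            hbb hab hab' ha'b ha'b'
      · intro a b c hxa hya hxb hyb hxc hyc hab hac
        by_contra hbc
        have key : ∀ {w}, (D ⊔ H).Adj x w → (D ⊔ H).Adj y w →
            H.Adj x w ∧ H.Adj y w ∧ w ∈ (X.erase x).erase y := by
          intro w hxw hyw
          have h1 := g.adj_right_of_ne hyw hy hyu hyv
          have h2 := g.right_support h1.symm
          exact ⟨g.adj_right hxw hx h2, h1, by simp [h1.ne', hxw.ne', h2]⟩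
        obtain ⟨a1, a2, a3⟩ := key hxa hya
        obtain ⟨b1, b2, b3⟩ := key hxb hyb
        obtain ⟨c1, c2, c3⟩ := key hxc hyc
        exact hK5 (hasMinor_top_of_common hY (by simp) (by simp) hxy a3 b3 c3 hab hac hbc
          a1 b1 c1 a2 b2 c2)
    · by_cases hX : X ⊆ {u, v}
      · refine g.drawable.mono (sup_le le_rfl fun a b hab => ?_)
        have h1 := hX (g.right_support hab)
        have h2 := hX (g.right_support hab.symm)
        have := hab.ne
        simp only [Finset.mem_insert, Finset.mem_singleton] at h1 h2
        rcases h1 with rfl | rfl <;> rcases h2 with rfl | rfl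
        · exact absurd rfl this
        · exact g.left_adj
        · exact g.left_adj.symm
        · exact absurd rfl this
      obtain ⟨y, hy, hyuv⟩ := Finset.not_subset.1 hX
      simp only [Finset.mem_insert, Finset.mem_singleton, not_or] at hyuv
      obtain ⟨x, hx, hxy, hcard⟩ : ∃ x ∈ X, x ≠ y ∧
          (x ≠ u ∧ x ≠ v ∨ ∀ w ∈ X, w = u ∨ w = v ∨ w = y) ∧ (x = u ∨ (x ≠ u ∧ x ≠ v)) := by
        by_cases h : ∃ x ∈ X, x ≠ u ∧ x ≠ v ∧ x ≠ y
        · obtain ⟨x, hx, h1, h2, h3⟩ := h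
          exact ⟨x, hx, h3, Or.inl ⟨h1, h2⟩, Or.inr ⟨h1, h2⟩⟩
        · refine ⟨u, huX, Ne.symm hyuv.1, Or.inr fun w hw => ?_, Or.inl rfl⟩
          by_contra! hcon
          exact h ⟨w, hw, hcon⟩
      have hYc : ((X.erase x).erase y).card ≤ 2 := by
        rw [Finset.card_erase_of_mem (by simp [hy, hxy.symm]), Finset.card_erase_of_mem hx]
        omega
      have hmem : ∀ {w}, (D ⊔ H).Adj y w → w ≠ x → w ∈ (X.erase x).erase y := fun h hw => by
        have h1 := g.adj_right_of_ne h hy hyuv.1 hyuv.2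
        simp [hw, h1.ne', g.right_support h1.symm]
      have hthree : ∀ {a b c}, a ∈ (X.erase x).erase y → b ∈ (X.erase x).erase y →
          c ∈ (X.erase x).erase y → a ≠ b → a ≠ c → b = c := by
        intro a b c ha hb hc hab hac
        by_contra hbc
        have := Finset.two_lt_card.2 ⟨a, ha, b, hb, c, hc, hab, hac, hbc⟩
        omega
      have ⟨p, hp⟩ := ih (g.contract (y := y) hx hyuv.1 hyuv.2) (fun h' => by
        rw [Finset.card_erase_of_mem hy] at h'; omega)
        (by rw [Finset.card_erase_of_mem hy, hn]; rfl)
      refine (hp.mono (g.contract_le hy hyuv.1 hyuv.2)).split hxy ?_ ?_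
      · intro a a' b b' ha ha' hb hb' hay hay' hbx hbx' haa hbb hab hab' ha'b ha'b'
        exfalso
        have mb := hmem hb hbx
        have mb' := hmem hb' hbx'
        rcases hcard.1 with ⟨hxu, hxv⟩ | hall
        · have h1 := g.adj_right_of_ne ha hx hxu hxv
          exact hbb (hthree (a := a) (by simp [h1.ne', hay, g.right_support h1.symm]) mb mb'
            hab hab')
        · rcases hcard.2 with rfl | ⟨hxu, hxv⟩
          · have h1 := hall b (by simp at mb; tauto)
            have h2 := hall b' (by simp at mb'; tauto)
            simp at mb mb'
            grind
          · have := hall x hx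
            tauto
      · intro a b c hxa hya hxb hyb hxc hyc hab hac
        exact hthree (hmem hya hxa.ne') (hmem hyb hxb.ne') (hmem hyc hxc.ne') hab hac

end Gluing

end Gluing

section Extension

variable {V : Type*} [DecidableEq V] {D H : SimpleGraph V} {V₁ X : Finset V} {s t u v y : V}

theorem linked_of_clique {S : Finset V} (h : ∀ a ∈ S, ∀ b ∈ S, a ≠ b → H.Adj a b) :
    Linked H S := by
  rintro C hC ⟨c, hc⟩ hcl b hb
  by_cases hcb : c = b
  · exact hcb ▸ hc
  · exact hcl c hc b hb (h c (hC hc) b hb hcb)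

theorem TwoConn.sup (hD : TwoConn D V₁) (hH : TwoConn H X) (hst : s ≠ t) (hs : s ∈ V₁)
    (ht : t ∈ V₁) (hs' : s ∈ X) (ht' : t ∈ X) : TwoConn (D ⊔ H) (V₁ ∪ X) where
  linked := (hD.linked.mono fun _ _ _ _ h => Or.inl h).union
    (hH.linked.mono fun _ _ _ _ h => Or.inr h) hs hs'
  erase r := by
    rw [Finset.erase_union_distrib]
    have h1 : Linked (D ⊔ H) (V₁.erase r) := (hD.erase r).mono fun _ _ _ _ h => Or.inl h
    have h2 : Linked (D ⊔ H) (X.erase r) := (hH.erase r).mono fun _ _ _ _ h => Or.inr h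
    by_cases hr : s = r
    · exact h1.union h2 (c := t) (by grind) (by grind)
    · exact h1.union h2 (c := s) (by grind) (by grind)

/-- The subgraph of edges with both ends in `S`. -/
def restrict (H : SimpleGraph V) (S : Finset V) : SimpleGraph V where
  Adj a b := H.Adj a b ∧ a ∈ S ∧ b ∈ S
  symm := ⟨fun _ _ h => ⟨h.1.symm, h.2.2, h.2.1⟩⟩
  loopless := ⟨fun _ h => h.1.ne rfl⟩

theorem restrict_le (H : SimpleGraph V) (S : Finset V) : restrict H S ≤ H := fun _ _ h => h.1

/-- A drawable 2-connected graph with vertex set `V₁`. -/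
structure Host (D : SimpleGraph V) (V₁ : Finset V) : Prop where
  support : ∀ {a b}, D.Adj a b → a ∈ V₁
  card : 1 < V₁.card
  twoConn : TwoConn D V₁
  drawable : Drawable D

theorem Gluing.host (g : Gluing D V₁ H X u v) : Host D V₁ where
  support := g.left_support
  card := Finset.one_lt_card.2
    ⟨u, g.left_support g.left_adj, v, g.left_support g.left_adj.symm, g.left_adj.ne⟩
  twoConn := g.twoConn
  drawable := g.drawable

theorem Gluing.host_sup [Fintype V] (g : Gluing D V₁ H X u v) (hX : TwoConn H X)
    (h : 5 ≤ X.card → ThreeConn H X ∧ ¬ HasMinor (⊤ : SimpleGraph (Fin 5)) H ∧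
      ¬ HasMinor (completeBipartiteGraph (Fin 3) (Fin 3)) H) : Host (D ⊔ H) (V₁ ∪ X) where
  support := by
    rintro a b (h | h)
    · exact Finset.mem_union_left _ (g.left_support h)
    · exact Finset.mem_union_right _ (g.right_support h)
  card := g.host.card.trans_le (Finset.card_le_card Finset.subset_union_left)
  twoConn := g.twoConn.sup hX g.left_adj.ne (g.left_support g.left_adj)
    (g.left_support g.left_adj.symm) (g.right_support g.right_adj)
    (g.right_support g.right_adj.symm)
  drawable := g.drawable_sup h

/-- A host can be enlarged by a vertex forming a triangle with one of its edges. -/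
theorem Host.exists_insert [Fintype V] (h : Host D V₁) (hs : s ∈ V₁) (hy : y ∉ V₁) :
    ∃ D', D ≤ D' ∧ D'.Adj s y ∧ Host D' (insert y V₁) := by
  obtain ⟨d, hd, hds⟩ := Finset.exists_mem_ne h.card s
  obtain ⟨g, hg, hsg⟩ := h.twoConn.linked.exists_neighbor hs hd hds
  have hsy : s ≠ y := fun e => hy (e ▸ hs)
  have hgy : g ≠ y := fun e => hy (e ▸ hg)
  have glue : Gluing D V₁ (restrict ⊤ {s, g, y}) {s, g, y} s g :=
    { left_adj := hsg
      right_adj := ⟨hsg.ne, by simp, by simp⟩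
      left_support := h.support
      right_support := fun h => h.2.1
      inter := fun ha ha' => by
        simp only [Finset.mem_insert, Finset.mem_singleton] at ha'
        grind
      twoConn := h.twoConn
      drawable := h.drawable }
  have hT : TwoConn (restrict ⊤ {s, g, y}) {s, g, y} :=
    ⟨linked_of_clique fun a ha b hb hab => ⟨hab, ha, hb⟩, fun t => linked_of_clique
      fun a ha b hb hab => ⟨hab, Finset.mem_of_mem_erase ha, Finset.mem_of_mem_erase hb⟩⟩
  have hc := Finset.card_le_three (a := s) (b := g) (c := y)
  have key := glue.host_sup hT (fun h => by omega)
  refine ⟨D ⊔ restrict ⊤ {s, g, y}, le_sup_left, Or.inr ⟨hsy, by simp, by simp⟩, ?_⟩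
  convert key using 1
  ext a
  grind

/-- `H` can be drawn together with `D` in such a way that the result is part of a host. -/
def Extends (D : SimpleGraph V) (V₁ : Finset V) (H : SimpleGraph V) (X : Finset V) : Prop :=
  ∃ D', D ≤ D' ∧ H ≤ D' ∧ Host D' (V₁ ∪ X)

/-- Neither Kuratowski graph is a minor. -/
def MinorFree (H : SimpleGraph V) : Prop :=
  ¬ HasMinor (⊤ : SimpleGraph (Fin 5)) H ∧
    ¬ HasMinor (completeBipartiteGraph (Fin 3) (Fin 3)) H

theorem MinorFree.mono {H' : SimpleGraph V} (h : MinorFree H) (hle : H' ≤ H) : MinorFree H' :=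
  ⟨fun hm => h.1 (hm.mono hle), fun hm => h.2 (hm.mono hle)⟩

theorem MinorFree.of_contraction {H' : SimpleGraph V} {C : Finset V} (h : MinorFree H)
    (hc : IsContraction H H' s C) : MinorFree H' :=
  ⟨fun hm => h.1 (hm.of_contraction hc exists_top_adj),
    fun hm => h.2 (hm.of_contraction hc exists_completeBipartite_adj)⟩

theorem TwoConn.minorFree_restrict_sup_edge (hX : TwoConn H X) (hm : MinorFree H) {A C : Finset V}
    (hC : Part H ((X.erase s).erase t) C) (hCl : Linked H C) (hs : s ∈ X) (ht : t ∈ X)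
    (hst : s ≠ t) (hA : Disjoint A C) :
    MinorFree (restrict H A ⊔ SimpleGraph.edge s t) := by
  have hsC : s ∉ C := fun h => by simpa using hC.subset h
  have htC : t ∉ C := fun h => by simpa using hC.subset h
  have nbr : ∀ a b, a ∈ X → a ≠ b → (∀ w ∈ X, w ≠ a → w ≠ b → w ∈ (X.erase s).erase t) → b ∉ C →
      a ∉ C → ∃ d ∈ C, H.Adj d a := by
    intro a b ha hab hw hbC haC
    obtain ⟨c₀, hc₀⟩ := hC.nonempty
    obtain ⟨d, hd, c, hc, hcC, hdc⟩ := (hX.erase b).exists_adj (A := C) (a := c₀) (d := a)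
      (fun w hw => Finset.mem_erase.2 ⟨fun e => hbC (e ▸ hw), by
        have := hC.subset hw; simp at this; tauto⟩) hc₀ (by simp [ha, hab]) haC
    simp only [Finset.mem_erase] at hc
    by_cases hca : c = a
    · exact ⟨d, hd, hca ▸ hdc⟩
    · exact absurd (hC.closed d hd c (hw c hc.2 hca hc.1) hdc) hcC
  obtain ⟨d, hd, hds⟩ := nbr s t hs hst (fun w h1 h2 h3 => by simp [*]) htC hsC
  obtain ⟨e, he, het⟩ := nbr t s ht hst.symm (fun w h1 h2 h3 => by simp [*]) hsC htC
  refine hm.of_contraction (s := s) (C := C)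
    { linked := hCl, notMem := hsC, adj := ⟨d, hd, hds.symm⟩, edges := ?_ }
  rintro a b (⟨hab, ha, hb⟩ | hab)
  · exact ⟨Finset.disjoint_left.1 hA ha, Finset.disjoint_left.1 hA hb, Or.inl hab⟩
  · rw [SimpleGraph.edge_adj] at hab
    rcases hab with ⟨⟨rfl, rfl⟩ | ⟨rfl, rfl⟩, -⟩
    · exact ⟨hsC, htC, Or.inr (Or.inl ⟨rfl, e, he, het⟩)⟩
    · exact ⟨htC, hsC, Or.inr (Or.inr ⟨rfl, e, he, het.symm⟩)⟩

theorem Extends.trans {H₁ H₂ : SimpleGraph V} {X₁ X₂ : Finset V} (h₁ : Extends D V₁ H₁ X₁)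
    (h₂ : ∀ D', D ≤ D' → H₁ ≤ D' → Host D' (V₁ ∪ X₁) → Extends D' (V₁ ∪ X₁) H₂ X₂)
    (hX : X₁ ∪ X₂ = X) (hH : H ≤ H₁ ⊔ H₂) : Extends D V₁ H X := by
  obtain ⟨D₁, hD, hH₁, host⟩ := h₁
  obtain ⟨D₂, hD', hH₂, host'⟩ := h₂ D₁ hD hH₁ host
  exact ⟨D₂, hD.trans hD', hH.trans (sup_le (hH₁.trans hD') hH₂),
    by rwa [Finset.union_assoc, hX] at host'⟩

theorem Host.extends_of_singleton [Fintype V]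
    (ih1 : ∀ (D H : SimpleGraph V) (V₁ X' : Finset V) (s : V), X'.card < X.card → Host D V₁ →
      MinorFree H → (∀ {a b}, H.Adj a b → a ∈ X') → s ∈ V₁ → s ∈ X' →
      (∀ a ∈ V₁, a ∈ X' → a = s) → Extends D V₁ H X')
    (h2 : ∀ (D : SimpleGraph V) (V₁ : Finset V) (y : V), Gluing D V₁ H X s y → Extends D V₁ H X)
    (h : Host D V₁) (hm : MinorFree H) (hH : ∀ {a b}, H.Adj a b → a ∈ X) (hs : s ∈ V₁)
    (hsX : s ∈ X) (hi : ∀ a ∈ V₁, a ∈ X → a = s) : Extends D V₁ H X := by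
  by_cases hn : ∃ y, H.Adj s y
  · obtain ⟨y, hsy⟩ := hn
    have hy : y ∉ V₁ := fun hy => hsy.ne' (hi y hy (hH hsy.symm))
    obtain ⟨D', hle, hadj, host⟩ := h.exists_insert hs hy
    obtain ⟨D'', hle', hH', host'⟩ := h2 D' (insert y V₁) y
      { left_adj := hadj
        right_adj := hsy
        left_support := host.support
        right_support := hH
        inter := fun ha ha' => by
          rcases Finset.mem_insert.1 ha with h | h
          · exact Or.inr h
          · exact Or.inl (hi _ h ha')
        twoConn := host.twoConn
        drawable := host.drawable }
    refine ⟨D'', hle.trans hle', hH', ?_⟩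
    convert host' using 1
    have := hH hsy.symm
    grind
  push Not at hn
  by_cases hX : ∃ y ∈ X, y ≠ s
  · obtain ⟨y, hyX, hys⟩ := hX
    have hy : y ∉ V₁ := fun hy => hys (hi y hy hyX)
    obtain ⟨D', hle, hadj, host⟩ := h.exists_insert hs hy
    obtain ⟨D'', hle', hH', host'⟩ := ih1 D' H (insert y V₁) (X.erase s) y
      (Finset.card_erase_lt_of_mem hsX) host hm
      (fun hab => Finset.mem_erase.2 ⟨fun e => hn _ (e ▸ hab), hH hab⟩) (by simp)
      (by simp [hys, hyX]) (fun a ha ha' => by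
        rcases Finset.mem_insert.1 ha with h | h
        · exact h
        · simp only [Finset.mem_erase] at ha'
          exact absurd (hi a h ha'.2) ha'.1)
    refine ⟨D'', hle.trans hle', hH', ?_⟩
    convert host' using 1
    grind
  · push Not at hX
    refine ⟨D, le_rfl, fun a b hab => absurd hab ?_, ?_⟩
    · rw [hX a (hH hab)]
      exact hn b
    · convert h using 1
      grind

theorem exists_of_not_twoConn (huv : H.Adj u v) (hu : u ∈ X) (h : ¬ TwoConn H X) :
    ∃ s ∈ X, ∃ C ⊆ X, C.Nonempty ∧ u ∉ C ∧ v ∉ C ∧ s ∉ C ∧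
      ∀ a ∈ C, ∀ b ∈ X, H.Adj a b → b ∈ C ∨ b = s := by
  by_cases hl : Linked H X
  · obtain ⟨t, ht⟩ : ∃ t, ¬ Linked H (X.erase t) := by
      by_contra! hcon
      exact h ⟨hl, hcon⟩
    obtain ⟨C, hC, huC, hvC⟩ := exists_part_avoiding ht huv
    have htX : t ∈ X := by
      by_contra htX
      rw [Finset.erase_eq_of_notMem htX] at ht
      exact ht hl
    refine ⟨t, htX, C, fun c hc => Finset.mem_of_mem_erase (hC.subset hc), hC.nonempty, huC, hvC,
      fun htC => by simpa using hC.subset htC, fun a ha b hb hab => ?_⟩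
    by_cases hbt : b = t
    · exact Or.inr hbt
    · exact Or.inl (hC.closed a ha b (Finset.mem_erase.2 ⟨hbt, hb⟩) hab)
  · obtain ⟨C, hC, huC, hvC⟩ := exists_part_avoiding hl huv
    exact ⟨u, hu, C, hC.subset, hC.nonempty, huC, hvC, huC,
      fun a ha b hb hab => Or.inl (hC.closed a ha b hb hab)⟩

theorem Gluing.extends_of_smaller [Fintype V]
    (ih1 : ∀ (D H : SimpleGraph V) (V₁ X' : Finset V) (s : V), X'.card < X.card → Host D V₁ →
      MinorFree H → (∀ {a b}, H.Adj a b → a ∈ X') → s ∈ V₁ → s ∈ X' →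
      (∀ a ∈ V₁, a ∈ X' → a = s) → Extends D V₁ H X')
    (ih2 : ∀ (D H : SimpleGraph V) (V₁ X' : Finset V) (u v : V), X'.card < X.card →
      Gluing D V₁ H X' u v → MinorFree H → Extends D V₁ H X')
    (g : Gluing D V₁ H X u v) (hm : MinorFree H) : Extends D V₁ H X := by
  have huX := g.right_support g.right_adj
  have hvX := g.right_support g.right_adj.symm
  have huv := g.right_adj.ne
  by_cases hT : TwoConn H X
  · by_cases h3 : 5 ≤ X.card → ThreeConn H X
    · exact ⟨D ⊔ H, le_sup_left, le_sup_right, g.host_sup hT fun h => ⟨h3 h, hm⟩⟩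
    push Not at h3
    obtain ⟨-, h3⟩ := h3
    unfold ThreeConn at h3
    push Not at h3
    obtain ⟨s, t, hst⟩ := h3
    have hsX : s ∈ X := by
      by_contra h
      exact hst (by simpa [Finset.erase_eq_of_notMem h] using hT.erase t)
    have htX : t ∈ X := by
      by_contra h
      refine hst ?_
      rw [Finset.erase_eq_of_notMem (a := t) (by simp [h])]
      exact hT.erase s
    have hne : s ≠ t := by
      rintro rfl
      exact hst (by simpa using hT.erase s)
    obtain ⟨C₀, hC₀, huC₀, hvC₀⟩ := exists_part_avoiding hst g.right_adj
    obtain ⟨C, hCC, hC, hCl⟩ := hC₀.exists_linked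
    have huC : u ∉ C := fun h => huC₀ (hCC h)
    have hvC : v ∉ C := fun h => hvC₀ (hCC h)
    obtain ⟨C', hCC', hC', hCl'⟩ := hC.compl.exists_linked
    have hCX : ∀ c ∈ C, c ∈ X ∧ c ≠ s ∧ c ≠ t := fun c hc => by
      have := hC.subset hc
      simp only [Finset.mem_erase] at this
      tauto
    have hCX' : ∀ c ∈ C', c ∈ X ∧ c ≠ s ∧ c ≠ t ∧ c ∉ C := fun c hc => by
      have := hCC' hc
      simp only [Finset.mem_sdiff, Finset.mem_erase] at this
      tauto
    have hsC : s ∉ C := fun h => (hCX s h).2.1 rfl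
    have htC : t ∉ C := fun h => (hCX t h).2.2 rfl
    have m1 := hT.minorFree_restrict_sup_edge hm hC hCl hsX htX hne (A := X \ C)
      Finset.sdiff_disjoint
    have m2 := hT.minorFree_restrict_sup_edge hm hC' hCl' hsX htX hne (A := C ∪ {s, t})
      (Finset.disjoint_left.2 fun a ha ha' => by have := hCX' a ha'; grind)
    have edge_mem : ∀ {a b A}, (restrict H A ⊔ SimpleGraph.edge s t).Adj a b → s ∈ A → t ∈ A →
        a ∈ A := by
      rintro a b A (h | h) hs ht
      · exact h.2.1
      · rw [SimpleGraph.edge_adj] at h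
        rcases h with ⟨⟨rfl, rfl⟩ | ⟨rfl, rfl⟩, -⟩ <;> assumption
    have st_adj : ∀ A, (restrict H A ⊔ SimpleGraph.edge s t).Adj s t := fun A =>
      Or.inr (by simp [SimpleGraph.edge_adj, hne])
    have g1 : Gluing D V₁ (restrict H (X \ C) ⊔ SimpleGraph.edge s t) (X \ C) u v :=
      { left_adj := g.left_adj
        right_adj := Or.inl ⟨g.right_adj, by simp [*], by simp [*]⟩
        left_support := g.left_support
        right_support := fun h => edge_mem h (by simp [*]) (by simp [*])
        inter := fun ha ha' => g.inter ha (Finset.sdiff_subset ha')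
        twoConn := g.twoConn
        drawable := g.drawable }
    obtain ⟨c, hc⟩ := hC.nonempty
    obtain ⟨c', hc'⟩ := hC'.nonempty
    refine Extends.trans (ih2 _ _ _ _ _ _ (Finset.card_lt_card ?_) g1 m1)
      (fun D' hD hH host => ih2 D' (restrict H (C ∪ {s, t}) ⊔ SimpleGraph.edge s t) _
        (C ∪ {s, t}) s t (Finset.card_lt_card ?_)
        { left_adj := hH (st_adj _)
          right_adj := st_adj _
          left_support := host.support
          right_support := fun h => edge_mem h (by simp) (by simp)
          inter := fun {a} ha ha' => ?_
          twoConn := host.twoConn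
          drawable := host.drawable } m2) ?_ ?_
    · exact Finset.ssubset_iff_subset_ne.2 ⟨Finset.sdiff_subset, fun e => by
        have := (hCX c hc).1
        rw [← e] at this
        simp [hc] at this⟩
    · refine Finset.ssubset_iff_subset_ne.2 ⟨?_, fun e => ?_⟩
      · intro a ha
        have := hCX a
        grind
      · have := hCX' c' hc'
        rw [← e] at this
        simp at this
        tauto
    · have := g.inter (a := a)
      have := hCX a
      grind
    · ext a
      have := hCX a
      grind
    · intro a b hab
      have ha := g.right_support hab
      have hb := g.right_support hab.symm
      have key : ∀ {a b}, H.Adj a b → a ∈ C → b ∈ X → b ∈ C ∪ {s, t} := by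
        intro a b hab ha hb
        have := hC.closed a ha b
        simp only [Finset.mem_erase] at this
        grind
      by_cases haC : a ∈ C
      · exact Or.inr (Or.inl ⟨hab, by simp [haC], key hab haC hb⟩)
      by_cases hbC : b ∈ C
      · exact Or.inr (Or.inl ⟨hab, key hab.symm hbC ha, by simp [hbC]⟩)
      · exact Or.inl (Or.inl ⟨hab, by simp [*], by simp [*]⟩)
  · obtain ⟨s, hsX, C, hCX, ⟨c, hc⟩, huC, hvC, hsC, hcl⟩ := exists_of_not_twoConn g.right_adj huX hT
    have g1 : Gluing D V₁ (restrict H (X \ C)) (X \ C) u v :=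
      { left_adj := g.left_adj
        right_adj := ⟨g.right_adj, by simp [*], by simp [*]⟩
        left_support := g.left_support
        right_support := fun h => h.2.1
        inter := fun ha ha' => g.inter ha (Finset.sdiff_subset ha')
        twoConn := g.twoConn
        drawable := g.drawable }
    refine Extends.trans (ih2 _ _ _ _ _ _ (Finset.card_lt_card ?_) g1 (hm.mono (restrict_le _ _)))
      (fun D' hD hH host => ih1 D' (restrict H (insert s C)) _ (insert s C) s
        (Finset.card_lt_card ?_) host (hm.mono (restrict_le _ _)) (fun h => h.2.1) ?_ (by simp)
        fun a ha ha' => ?_) ?_ ?_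
    · exact Finset.ssubset_iff_subset_ne.2 ⟨Finset.sdiff_subset, fun e => by
        have := hCX hc
        rw [← e] at this
        simp [hc] at this⟩
    · refine Finset.ssubset_iff_subset_ne.2 ⟨?_, fun e => ?_⟩
      · exact Finset.insert_subset hsX hCX
      · rw [← e] at huX hvX
        grind
    · simp [hsX, hsC]
    · have := g.inter (a := a)
      grind
    · grind
    · intro a b hab
      have ha := g.right_support hab
      have hb := g.right_support hab.symm
      by_cases haC : a ∈ C
      · exact Or.inr ⟨hab, by simp [haC], by have := hcl a haC b hb hab; grind⟩
      by_cases hbC : b ∈ C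
      · exact Or.inr ⟨hab, by have := hcl b hbC a ha hab.symm; grind, by simp [hbC]⟩
      · exact Or.inl ⟨hab, by simp [*], by simp [*]⟩

theorem extends_of_minorFree [Fintype V] (n : ℕ) :
    (∀ (D H : SimpleGraph V) (V₁ X : Finset V) (s : V), X.card < n → Host D V₁ →
      MinorFree H → (∀ {a b}, H.Adj a b → a ∈ X) → s ∈ V₁ → s ∈ X →
      (∀ a ∈ V₁, a ∈ X → a = s) → Extends D V₁ H X) ∧
    (∀ (D H : SimpleGraph V) (V₁ X : Finset V) (u v : V), X.card < n →
      Gluing D V₁ H X u v → MinorFree H → Extends D V₁ H X) := by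
  induction n with
  | zero => simp
  | succ n ih =>
    obtain ⟨ih1, ih2⟩ := ih
    have h2 : ∀ (D H : SimpleGraph V) (V₁ X : Finset V) (u v : V), X.card < n + 1 →
        Gluing D V₁ H X u v → MinorFree H → Extends D V₁ H X := fun D H V₁ X u v hX g hm =>
      g.extends_of_smaller (fun D H V₁ X' s h' => ih1 D H V₁ X' s (by omega))
        (fun D H V₁ X' u v h' => ih2 D H V₁ X' u v (by omega)) hm
    exact ⟨fun D H V₁ X s hX h hm hH hs hsX hi => h.extends_of_singleton
      (fun D H V₁ X' s h' => ih1 D H V₁ X' s (by omega))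
      (fun D V₁ y g => h2 D H V₁ X s y hX g hm) hm hH hs hsX hi, h2⟩

/-- A finite graph without Kuratowski minors can be drawn with straight edges. -/
theorem MinorFree.drawable [Fintype V] (h : MinorFree H) : Drawable H := by
  by_cases hE : ∃ u v, H.Adj u v
  · obtain ⟨u, v, huv⟩ := hE
    have hadj : ∀ {a b}, (SimpleGraph.edge u v).Adj a b ↔ (a = u ∧ b = v ∨ a = v ∧ b = u) := by
      intro a b
      rw [SimpleGraph.edge_adj]
      have := huv.ne
      grind
    have g : Gluing (SimpleGraph.edge u v) {u, v} H Finset.univ u v :=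
      { left_adj := hadj.2 (by simp)
        right_adj := huv
        left_support := fun h => by
          rcases hadj.1 h with ⟨rfl, rfl⟩ | ⟨rfl, rfl⟩ <;> simp
        right_support := fun _ => Finset.mem_univ _
        inter := fun h _ => by simpa using h
        twoConn := ⟨linked_of_clique fun a ha b hb hab => hadj.2 (by grind),
          fun t => linked_of_clique fun a ha b hb hab => hadj.2 (by grind)⟩
        drawable := drawable_of_no_disjoint fun a b c d h1 h2 => by
          rw [hadj] at h1 h2
          grind }
    obtain ⟨D, -, hD, host⟩ := (extends_of_minorFree _).2 _ _ _ _ _ _ (Nat.lt_succ_self _) g h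
    exact host.drawable.mono hD
  · push Not at hE
    exact drawable_of_no_disjoint fun a b _ _ hab => absurd hab (hE a b)

end Extension

end Planarity

/-- Kuratowski's theorem (topological form): a finite graph whose geometric realization does
not embed in the plane contains a subspace homeomorphic to `K₅` or to `K₃,₃`, i.e. `K₅` or
`K₃,₃` embeds topologically into its realization (a subdivision of `K₅` or `K₃,₃` occurs as a
subgraph). -/
theorem kuratowski {V : Type*} [Fintype V] [DecidableEq V] (G : SimpleGraph V)
    (h : ¬ ∃ f : ↥(graphRealization G) → EuclideanSpace ℝ (Fin 2), Topology.IsEmbedding f) :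
    (∃ e : ↥(graphRealization (⊤ : SimpleGraph (Fin 5))) → ↥(graphRealization G),
      Topology.IsEmbedding e) ∨
    (∃ e : ↥(graphRealization (completeBipartiteGraph (Fin 3) (Fin 3))) →
        ↥(graphRealization G),
      Topology.IsEmbedding e) := by
  by_contra hcon
  rw [not_or] at hcon
  refine h (Planarity.Drawable.exists_isEmbedding (Planarity.MinorFree.drawable ⟨fun hm => ?_,
    fun hm => hcon.2 (Planarity.embeds_of_hasMinor_bipartite hm)⟩))
  exact (Planarity.embeds_of_hasMinor_top hm).elim hcon.1 hcon.2
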